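/- arXiv:2404.03151 — 12 statements merged into one kernel-verified Lean document; each statement's English description precedes it below -/
import Mathlib

section
/- Let n ∈ ℕ and 0 ≤ β ≤ n−2, and let H_{n,β} be the graph on vertices {1,…,n} with edge set {(i,i+1) : 1 ≤ i < n} ∪ {(i,i+2) : 1 ≤ i ≤ β}, so β(H_{n,β}) = β. Then there exists a matrix M ∈ S(H_{n,β}) satisfying the Nodal Count Condition whose eigenvectors φ_1,…,φ_n (ordered by increasing eigenvalue) have sign structure sign(φ_k(ℓ)) = (−1)^{k−ℓ} for ℓ < k and sign(φ_k(ℓ)) = +1 for ℓ ≥ k, and whose total nodal count equals C(n,2) + β. -/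
open Matrix

/-- A matrix is supported on a simple graph `G` if its off-diagonal entries vanish
outside the edges of `G`. -/
def SupportedOn {V : Type*} (G : SimpleGraph V) (A : Matrix V V ℝ) : Prop :=
  ∀ i j, i ≠ j → ¬ G.Adj i j → A i j = 0

/-- The nodal count of a vector `φ` with respect to a matrix `A`. -/
noncomputable def nodalCount {n : ℕ} (A : Matrix (Fin n) (Fin n) ℝ) (φ : Fin n → ℝ) : ℕ :=
  Nat.card {p : Fin n × Fin n // p.1 < p.2 ∧ 0 < A p.1 p.2 * φ p.1 * φ p.2}

/-- The first Betti number of a graph on `n` vertices: `|E(G)| - (n - 1)`. -/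
noncomputable def betti {n : ℕ} (G : SimpleGraph (Fin n)) : ℕ :=
  Nat.card G.edgeSet - (n - 1)

/-- The graph `H_{n,β}` (0-indexed): a path `0 - 1 - ⋯ - (n-1)` together with the `β` extra
edges `(i, i+2)` for `0 ≤ i < β`. -/
def Hgraph (n β : ℕ) : SimpleGraph (Fin n) :=
  SimpleGraph.fromRel (fun i j =>
    (j : ℕ) = (i : ℕ) + 1 ∨ ((j : ℕ) = (i : ℕ) + 2 ∧ (i : ℕ) < β))

/-- The matrix with diagonal `4 i`, path entries `-ε` and all other edge entries `-ε ^ 3`. -/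
noncomputable def pathPerturbation (n β : ℕ) (ε : ℝ) : Matrix (Fin n) (Fin n) ℝ :=
  open Classical in
  Matrix.of fun i j =>
    if i = j then 4 * (i : ℝ)
    else if (j : ℕ) = i + 1 ∨ (i : ℕ) = j + 1 then -ε
    else if (Hgraph n β).Adj i j then -ε ^ 3 else 0

lemma Hgraph_adj {n β : ℕ} {i j : Fin n} :
    (Hgraph n β).Adj i j ↔
      ((j : ℕ) = i + 1 ∨ ((j : ℕ) = i + 2 ∧ (i : ℕ) < β)) ∨
        ((i : ℕ) = j + 1 ∨ ((i : ℕ) = j + 2 ∧ (j : ℕ) < β)) := by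
  rw [Hgraph, SimpleGraph.fromRel_adj, and_iff_right_iff_imp]
  rintro h rfl
  omega

lemma pathPerturbation_isSymm (n β : ℕ) (ε : ℝ) : (pathPerturbation n β ε).IsSymm := by
  ext i j
  have h1 : j = i ↔ i = j := eq_comm
  have h2 : ((i : ℕ) = j + 1 ∨ (j : ℕ) = i + 1) ↔ ((j : ℕ) = i + 1 ∨ (i : ℕ) = j + 1) := or_comm
  have h3 := (Hgraph n β).adj_comm j i
  simp only [pathPerturbation, Matrix.transpose_apply, Matrix.of_apply, h1, h2]
  split_ifs with h <;> simp_all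

lemma pathPerturbation_diag {n β : ℕ} {ε : ℝ} (i : Fin n) :
    pathPerturbation n β ε i i = 4 * (i : ℝ) := by
  simp [pathPerturbation]

lemma pathPerturbation_path {n β : ℕ} {ε : ℝ} {i j : Fin n}
    (h : (j : ℕ) = i + 1 ∨ (i : ℕ) = j + 1) : pathPerturbation n β ε i j = -ε := by
  have : i ≠ j := by rintro rfl; omega
  simp [pathPerturbation, this, h]

lemma pathPerturbation_supportedOn (n β : ℕ) (ε : ℝ) :
    SupportedOn (Hgraph n β) (pathPerturbation n β ε) := by
  intro i j hij h
  have h' : ¬((j : ℕ) = i + 1 ∨ (i : ℕ) = j + 1) := by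
    rw [Hgraph_adj] at h; omega
  simp [pathPerturbation, hij, h, h']

lemma pathPerturbation_neg {n β : ℕ} {ε : ℝ} (hε : 0 < ε) {i j : Fin n}
    (h : (Hgraph n β).Adj i j) : pathPerturbation n β ε i j < 0 := by
  simp only [pathPerturbation, Matrix.of_apply, h.ne, h, if_true, if_false]
  split_ifs <;> simp [hε]

/-- Off-diagonal entries decay except towards the reference vertex `k`. -/
lemma abs_pathPerturbation_mul_le {n β : ℕ} {ε : ℝ} (hε : 0 < ε) (hε1 : ε ≤ 1)
    {i j k : Fin n} (hij : i ≠ j)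
    (h : (j : ℕ) = i + 1 ∨ (i : ℕ) = j + 1 → Nat.dist j k + 1 ≠ Nat.dist i k) :
    |pathPerturbation n β ε i j| * ε ^ Nat.dist j k ≤ ε ^ (Nat.dist i k + 1) := by
  simp only [pathPerturbation, Matrix.of_apply, hij, if_false]
  have hij' : (i : ℕ) ≠ j := fun e => hij (Fin.ext e)
  split_ifs with h1 h2
  · rw [abs_neg, abs_of_pos hε, ← pow_succ']
    apply pow_le_pow_of_le_one hε.le hε1
    unfold Nat.dist at *; omega
  · rw [abs_neg, abs_of_pos (by positivity), ← pow_add]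
    apply pow_le_pow_of_le_one hε.le hε1
    rw [Hgraph_adj] at h2
    unfold Nat.dist at *; omega
  · simpa using by positivity

lemma abs_pathPerturbation_le {n β : ℕ} {ε : ℝ} (hε : 0 < ε) (hε1 : ε ≤ 1)
    {i j : Fin n} (hij : i ≠ j) : |pathPerturbation n β ε i j| ≤ ε := by
  simp only [pathPerturbation, Matrix.of_apply, hij, if_false]
  split_ifs
  · simp [abs_of_pos hε]
  · rw [abs_neg, abs_of_pos (by positivity)]
    exact pow_le_of_le_one hε.le hε1 (by norm_num)
  · simpa using hε.le

section Eigenvector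

variable {n β : ℕ} {ε μ : ℝ} {v : Fin n → ℝ} {k : Fin n}

lemma abs_eigenvalue_sub_le (hε : 0 < ε) (hε1 : ε ≤ 1) (hn : n * ε ≤ 1)
    (hv : pathPerturbation n β ε *ᵥ v = μ • v) (hk : v k = 1) (hmax : ∀ j, |v j| ≤ 1) :
    |4 * (k : ℝ) - μ| ≤ 1 := by
  have h := congrFun hv k
  rw [Matrix.mulVec, dotProduct, ← Finset.add_sum_erase _ _ (Finset.mem_univ k),
    pathPerturbation_diag, Pi.smul_apply, hk, smul_eq_mul] at h
  have h2 : 4 * (k : ℝ) - μ = -∑ j ∈ Finset.univ.erase k, pathPerturbation n β ε k j * v j := by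
    linarith
  rw [h2, abs_neg]
  calc _ ≤ ∑ j ∈ Finset.univ.erase k, |pathPerturbation n β ε k j * v j| :=
        Finset.abs_sum_le_sum_abs _ _
    _ ≤ ∑ j ∈ Finset.univ.erase k, ε := by
        refine Finset.sum_le_sum fun j hj => ?_
        rw [abs_mul]
        have := abs_pathPerturbation_le (β := β) hε hε1 (Finset.ne_of_mem_erase hj).symm
        nlinarith [hmax j, abs_nonneg (v j), abs_nonneg (pathPerturbation n β ε k j)]
    _ ≤ ∑ j : Fin n, ε :=
        Finset.sum_le_sum_of_subset_of_nonneg (Finset.erase_subset _ _) fun _ _ _ => hε.le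
    _ ≤ 1 := by simpa using hn

lemma abs_row_sub_le (hε : 0 < ε) (hε1 : ε ≤ 1)
    (hv : pathPerturbation n β ε *ᵥ v = μ • v) {W : ℝ} (hW : 0 ≤ W)
    (hb : ∀ j, |v j| ≤ W * ε ^ Nat.dist j k) {i p : Fin n}
    (hip : (p : ℕ) = i + 1 ∨ (i : ℕ) = p + 1) (hp : Nat.dist p k + 1 = Nat.dist i k) :
    |(4 * (i : ℝ) - μ) * v i - ε * v p| ≤ n * ε * ε ^ Nat.dist i k * W := by
  have hpi : p ≠ i := by rintro rfl; omega
  have h := congrFun hv i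
  rw [Matrix.mulVec, dotProduct, ← Finset.add_sum_erase _ _ (Finset.mem_univ i),
    ← Finset.add_sum_erase _ _ (Finset.mem_erase.2 ⟨hpi, Finset.mem_univ p⟩),
    pathPerturbation_diag, pathPerturbation_path hip, Pi.smul_apply, smul_eq_mul] at h
  have h2 : (4 * (i : ℝ) - μ) * v i - ε * v p =
      -∑ j ∈ (Finset.univ.erase i).erase p, pathPerturbation n β ε i j * v j := by
    linarith
  rw [h2, abs_neg]
  calc _ ≤ ∑ j ∈ (Finset.univ.erase i).erase p, |pathPerturbation n β ε i j * v j| :=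
        Finset.abs_sum_le_sum_abs _ _
    _ ≤ ∑ j ∈ (Finset.univ.erase i).erase p, ε ^ (Nat.dist i k + 1) * W := by
        refine Finset.sum_le_sum fun j hj => ?_
        simp only [Finset.mem_erase, Finset.mem_univ, and_true] at hj
        rw [abs_mul]
        have hd : (j : ℕ) = i + 1 ∨ (i : ℕ) = j + 1 → Nat.dist j k + 1 ≠ Nat.dist i k := by
          have hjp : (j : ℕ) ≠ p := fun e => hj.1 (Fin.ext e)
          unfold Nat.dist at *; omega
        have := abs_pathPerturbation_mul_le (β := β) hε hε1 (Ne.symm hj.2) hd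
        calc _ ≤ |pathPerturbation n β ε i j| * (W * ε ^ Nat.dist j k) := by gcongr; exact hb j
          _ = (|pathPerturbation n β ε i j| * ε ^ Nat.dist j k) * W := by ring
          _ ≤ _ := by gcongr
    _ ≤ ∑ j : Fin n, ε ^ (Nat.dist i k + 1) * W :=
        Finset.sum_le_sum_of_subset_of_nonneg (Finset.subset_univ _) fun _ _ _ => by positivity
    _ = _ := by simp; ring

/-- A vertex other than `k` has a path neighbour one step closer to `k`, on which the prescribed
sign agrees or flips according to the sign of `i - k`. -/
lemma exists_closer_vertex {i k : Fin n} (hik : i ≠ k) :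
    ∃ p : Fin n, ((p : ℕ) = i + 1 ∨ (i : ℕ) = p + 1) ∧ Nat.dist p k + 1 = Nat.dist i k ∧
      ((k : ℕ) < i ∧ (-1 : ℝ) ^ ((k : ℕ) - i) = 1 ∧ (-1 : ℝ) ^ ((k : ℕ) - p) = 1 ∨
        (i : ℕ) < k ∧ (-1 : ℝ) ^ ((k : ℕ) - i) = -(-1 : ℝ) ^ ((k : ℕ) - p)) := by
  rcases lt_or_gt_of_ne (fun e => hik (Fin.ext e) : (i : ℕ) ≠ k) with h | h
  · refine ⟨⟨i + 1, by omega⟩, Or.inl rfl, by simp only [Nat.dist]; omega, Or.inr ⟨h, ?_⟩⟩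
    have : (k : ℕ) - i = k - (i + 1) + 1 := by omega
    simp [this, pow_succ]
  · refine ⟨⟨i - 1, by omega⟩, Or.inr (by simp only; omega), by simp only [Nat.dist]; omega,
      Or.inl ⟨h, ?_, ?_⟩⟩
    · simp [Nat.sub_eq_zero_of_le h.le]
    · simp [Nat.sub_eq_zero_of_le (Nat.le_sub_one_of_lt h)]

lemma three_le_abs_sub (hμ : |4 * (k : ℝ) - μ| ≤ 1) {i : Fin n} (hik : i ≠ k) :
    3 ≤ |4 * (i : ℝ) - μ| := by
  rw [abs_le] at hμ
  rcases lt_or_gt_of_ne (fun e => hik (Fin.ext e) : (i : ℕ) ≠ k) with h | h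
  · have : (i : ℝ) + 1 ≤ k := by exact_mod_cast h
    rw [abs_of_neg] <;> linarith
  · have : (k : ℝ) + 1 ≤ i := by exact_mod_cast h
    rw [abs_of_pos] <;> linarith

lemma abs_sub_le_four_mul (hμ : |4 * (k : ℝ) - μ| ≤ 1) (i : Fin n) :
    |4 * (i : ℝ) - μ| ≤ 4 * n + 1 := by
  have hi : (i : ℝ) ≤ n := by exact_mod_cast i.2.le
  have hk : (k : ℝ) ≤ n := by exact_mod_cast k.2.le
  have := abs_le.1 hμ
  have : (0 : ℝ) ≤ i := by positivity
  have : (0 : ℝ) ≤ k := by positivity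
  rw [abs_le]; constructor <;> linarith

lemma abs_le_pow_dist (hε : 0 < ε) (hε1 : ε ≤ 1) (hn : n * ε ≤ 1)
    (hv : pathPerturbation n β ε *ᵥ v = μ • v) (hk : v k = 1)
    (hμ : |4 * (k : ℝ) - μ| ≤ 1) (j : Fin n) : |v j| ≤ ε ^ Nat.dist j k := by
  obtain ⟨i, -, hi⟩ := Finset.exists_max_image Finset.univ
    (fun j : Fin n => |v j| / ε ^ Nat.dist j k) ⟨k, Finset.mem_univ k⟩
  set W := |v i| / ε ^ Nat.dist i k with hWdef
  have hpow : ∀ j : Fin n, 0 < ε ^ Nat.dist j k := fun j => by positivity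
  have hb : ∀ j, |v j| ≤ W * ε ^ Nat.dist j k := fun j =>
    (div_le_iff₀ (hpow j)).1 (hi j (Finset.mem_univ j))
  have hW1 : 1 ≤ W := by simpa [hk, Nat.dist_self] using hi k (Finset.mem_univ k)
  have hvi : |v i| = W * ε ^ Nat.dist i k := (div_mul_cancel₀ _ (hpow i).ne').symm
  have hik : i = k := by
    by_contra hik
    obtain ⟨p, hip, hp, -⟩ := exists_closer_vertex hik
    have h1 := abs_row_sub_le hε hε1 hv (by linarith) hb hip hp
    have h2 : |(4 * (i : ℝ) - μ) * v i| ≤ ε * |v p| + n * ε * ε ^ Nat.dist i k * W := by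
      have := abs_sub_abs_le_abs_sub ((4 * (i : ℝ) - μ) * v i) (ε * v p)
      rw [abs_mul ε, abs_of_pos hε] at this
      linarith
    have h3 : ε * |v p| ≤ ε ^ Nat.dist i k * W := by
      rw [← hp, pow_succ]
      nlinarith [mul_le_mul_of_nonneg_left (hb p) hε.le]
    have h4 : n * ε * ε ^ Nat.dist i k * W ≤ 1 * (ε ^ Nat.dist i k * W) := by
      rw [mul_assoc (n * ε)]
      gcongr
    have h5 : 3 * (W * ε ^ Nat.dist i k) ≤ |(4 * (i : ℝ) - μ) * v i| := by
      rw [abs_mul, ← hvi]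
      gcongr
      exact three_le_abs_sub hμ hik
    have : 0 < W * ε ^ Nat.dist i k := mul_pos (by linarith) (hpow i)
    linarith
  have hW : W = 1 := by rw [hWdef, hik, hk]; simp [Nat.dist_self]
  simpa [hW] using hb j

lemma pow_le_sign_mul (hε : 0 < ε) (hε1 : ε ≤ 1) (hn : n * ε ≤ (1 / (4 * n + 4) : ℝ) ^ n)
    (hv : pathPerturbation n β ε *ᵥ v = μ • v) (hk : v k = 1)
    (hμ : |4 * (k : ℝ) - μ| ≤ 1) (i : Fin n) :
    (1 / (4 * n + 4) * ε : ℝ) ^ Nat.dist i k ≤ (-1) ^ ((k : ℕ) - i) * v i := by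
  have hc1 : (1 / (4 * n + 4) : ℝ) ≤ 1 := by
    rw [div_le_one (by positivity)]; linarith [(Nat.cast_nonneg n : (0 : ℝ) ≤ n)]
  have hc : (4 * n + 4) * (1 / (4 * n + 4) : ℝ) = 1 := by field_simp
  have hc0 : (0 : ℝ) < 1 / (4 * n + 4) := by positivity
  set c : ℝ := 1 / (4 * n + 4)
  have hn1 : n * ε ≤ 1 := hn.trans (pow_le_one₀ hc0.le hc1)
  induction hm : Nat.dist i k generalizing i with
  | zero =>
    obtain rfl : i = k := Fin.ext (Nat.eq_of_dist_eq_zero hm)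
    simp [hk]
  | succ m ih =>
    have hik : i ≠ k := by rintro rfl; simp [Nat.dist_self] at hm
    obtain ⟨p, hip, hp, hs⟩ := exists_closer_vertex hik
    have hpm : Nat.dist p k = m := by omega
    have hmn : m + 1 ≤ n := by
      rw [← hm]; unfold Nat.dist; omega
    have hrow := abs_row_sub_le hε hε1 hv zero_le_one
      (by simpa using abs_le_pow_dist hε hε1 hn1 hv hk hμ) hip hp
    rw [hm, mul_one] at hrow
    have h1 : ε * ((-1) ^ ((k : ℕ) - p) * v p) - n * ε * ε ^ (m + 1) ≤
        |4 * (i : ℝ) - μ| * ((-1) ^ ((k : ℕ) - i) * v i) := by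
      have hμ' := abs_le.1 hμ
      rcases hs with ⟨h, hsi, hsp⟩ | ⟨h, hs⟩
      · have : (k : ℝ) + 1 ≤ i := by exact_mod_cast h
        rw [hsi, hsp, abs_of_pos (by linarith)]
        linarith [(abs_le.1 hrow).1]
      · have : (i : ℝ) + 1 ≤ k := by exact_mod_cast h
        rw [hs, abs_of_neg (by linarith)]
        rcases neg_one_pow_eq_or ℝ ((k : ℕ) - p) with e | e <;> rw [e] <;>
          linarith [(abs_le.1 hrow).1, (abs_le.1 hrow).2]
    have h2 := mul_le_mul_of_nonneg_left (ih p hpm) hε.le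
    have h3 : n * ε * ε ^ (m + 1) ≤ c ^ (m + 1) * ε ^ (m + 1) := by
      gcongr
      exact hn.trans (pow_le_pow_of_le_one hc0.le hc1 hmn)
    have h4 := abs_sub_le_four_mul hμ i
    have h5 := three_le_abs_sub hμ hik
    have h6 : (4 * n + 1) * (c * ε) ^ (m + 1) ≤
        |4 * (i : ℝ) - μ| * ((-1) ^ ((k : ℕ) - i) * v i) := by
      have h7 : ε * (c * ε) ^ m = (4 * n + 4) * (c * ε) ^ (m + 1) := by
        rw [pow_succ]
        linear_combination (-(c * ε) ^ m * ε) * hc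
      rw [← mul_pow] at h3
      have : 0 < (c * ε) ^ (m + 1) := by positivity
      linarith
    have h8 : 0 < (c * ε) ^ (m + 1) := by positivity
    by_contra! hlt
    have h9 := mul_lt_mul_of_pos_left hlt (by linarith : 0 < |4 * (i : ℝ) - μ|)
    have h10 := mul_le_mul_of_nonneg_right h4 h8.le
    linarith

end Eigenvector

lemma dotProduct_ne_zero_of_localized {n : ℕ} {ε : ℝ} (hε : 0 < ε) (hn : n * ε ^ 2 < 1)
    {v w : Fin n → ℝ} {k : Fin n} (hvk : v k = 1) (hwk : w k = 1)
    (hv : ∀ j ≠ k, |v j| ≤ ε) (hw : ∀ j ≠ k, |w j| ≤ ε) : v ⬝ᵥ w ≠ 0 := by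
  intro h
  rw [dotProduct, ← Finset.add_sum_erase _ _ (Finset.mem_univ k), hvk, hwk] at h
  have : |∑ j ∈ Finset.univ.erase k, v j * w j| ≤ n * ε ^ 2 := by
    calc _ ≤ ∑ j ∈ Finset.univ.erase k, |v j * w j| := Finset.abs_sum_le_sum_abs _ _
      _ ≤ ∑ j ∈ Finset.univ.erase k, ε ^ 2 := by
        refine Finset.sum_le_sum fun j hj => ?_
        rw [abs_mul, sq]
        exact mul_le_mul (hv j (Finset.ne_of_mem_erase hj)) (hw j (Finset.ne_of_mem_erase hj))
          (abs_nonneg _) hε.le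
      _ ≤ ∑ j : Fin n, ε ^ 2 := Finset.sum_le_sum_of_subset_of_nonneg
          (Finset.erase_subset _ _) fun _ _ _ => by positivity
      _ = _ := by simp
  linarith [(abs_le.1 this).1]

lemma card_pairs_eq {n : ℕ} {S : Finset (ℕ × ℕ)} (hS : ∀ p ∈ S, p.1 < n ∧ p.2 < n)
    {P : Fin n → Fin n → Prop} (hP : ∀ i j, P i j ↔ ((i : ℕ), (j : ℕ)) ∈ S) :
    Nat.card {p : Fin n × Fin n // P p.1 p.2} = S.card := by
  rw [← Nat.card_eq_finsetCard]
  refine Nat.card_eq_of_bijective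
    (fun p => (⟨((p.1.1 : ℕ), (p.1.2 : ℕ)), (hP _ _).1 p.2⟩ : S)) ⟨?_, ?_⟩
  · rintro ⟨⟨a, b⟩, _⟩ ⟨⟨c, d⟩, _⟩ h
    simpa [Fin.ext_iff] using h
  · rintro ⟨⟨i, j⟩, h⟩
    exact ⟨⟨(⟨i, (hS _ h).1⟩, ⟨j, (hS _ h).2⟩), (hP _ _).2 h⟩, rfl⟩

/-- The pairs `(i, i + 1)` with `i < m` and `(i, i + 2)` with `i ∈ T`. -/
def pathPairs (m : ℕ) (T : Finset ℕ) : Finset (ℕ × ℕ) :=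
  (Finset.range m).image (fun i => (i, i + 1)) ∪ T.image (fun i => (i, i + 2))

lemma mem_pathPairs {m : ℕ} {T : Finset ℕ} {i j : ℕ} :
    (i, j) ∈ pathPairs m T ↔ (j = i + 1 ∧ i < m) ∨ (j = i + 2 ∧ i ∈ T) := by
  simp only [pathPairs, Finset.mem_union, Finset.mem_image, Finset.mem_range, Prod.mk.injEq]
  grind

lemma card_pathPairs (m : ℕ) (T : Finset ℕ) : (pathPairs m T).card = m + T.card := by
  rw [pathPairs, Finset.card_union_of_disjoint, Finset.card_image_of_injective,
    Finset.card_image_of_injective, Finset.card_range]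
  · intro a b h; simpa using h
  · intro a b h; simpa using h
  · rw [Finset.disjoint_left]
    simp only [Finset.mem_image, not_exists, not_and]
    rintro _ ⟨a, -, rfl⟩ b -
    simp only [Prod.mk.injEq]
    omega

lemma card_edgeSet_eq {n : ℕ} (G : SimpleGraph (Fin n)) :
    Nat.card G.edgeSet = Nat.card {p : Fin n × Fin n // p.1 < p.2 ∧ G.Adj p.1 p.2} := by
  symm
  refine Nat.card_eq_of_bijective
    (fun p : {p : Fin n × Fin n // p.1 < p.2 ∧ G.Adj p.1 p.2} =>
      (⟨s(p.1.1, p.1.2), p.2.2⟩ : G.edgeSet)) ⟨?_, ?_⟩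
  · rintro ⟨⟨a, b⟩, hab, _⟩ ⟨⟨c, d⟩, hcd, _⟩ h
    rcases Sym2.eq_iff.1 (congrArg Subtype.val h) with ⟨rfl, rfl⟩ | ⟨rfl, rfl⟩
    · rfl
    · exact absurd hab hcd.asymm
  · rintro ⟨e, he⟩
    induction e using Sym2.ind with
    | _ a b =>
      rcases lt_or_gt_of_ne (G.ne_of_adj he) with h | h
      · exact ⟨⟨(a, b), h, he⟩, rfl⟩
      · exact ⟨⟨(b, a), h, G.adj_symm he⟩, Subtype.ext Sym2.eq_swap⟩

lemma betti_Hgraph {n β : ℕ} (hβ : β ≤ n - 2) : betti (Hgraph n β) = β := by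
  rw [betti, card_edgeSet_eq,
    card_pairs_eq (S := pathPairs (n - 1) (Finset.range β))
      (P := fun i j => i < j ∧ (Hgraph n β).Adj i j),
    card_pathPairs, Finset.card_range, Nat.add_sub_cancel_left]
  · rintro ⟨i, j⟩ h
    rw [mem_pathPairs, Finset.mem_range] at h
    simp only
    omega
  · intro i j
    rw [mem_pathPairs, Finset.mem_range, Hgraph_adj, Fin.lt_def]
    omega

lemma mul_mul_pos_iff_odd {A x y : ℝ} {a b : ℕ} (hA : A < 0) (hx : 0 < (-1) ^ a * x)
    (hy : 0 < (-1) ^ b * y) : 0 < A * x * y ↔ Odd (a + b) := by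
  have h := mul_pos hx hy
  rw [mul_mul_mul_comm, ← pow_add] at h
  rcases Nat.even_or_odd (a + b) with e | e
  · rw [e.neg_one_pow, one_mul] at h
    simp only [Nat.not_odd_iff_even.2 e, iff_false, not_lt, mul_assoc]
    exact (mul_neg_of_neg_of_pos hA h).le
  · rw [e.neg_one_pow] at h
    simp only [e, iff_true, mul_assoc]
    exact mul_pos_of_neg_of_neg hA (by linarith)

lemma nodalCount_eq {n β : ℕ} (hβ : β ≤ n - 2) {M : Matrix (Fin n) (Fin n) ℝ}
    (hM : SupportedOn (Hgraph n β) M) (hneg : ∀ i j, (Hgraph n β).Adj i j → M i j < 0)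
    {φ : Fin n → ℝ} (k : Fin n) (hφ : ∀ i : Fin n, 0 < (-1 : ℝ) ^ ((k : ℕ) - i) * φ i) :
    nodalCount M φ = k + ((Finset.range β).filter (fun i => i + 1 = (k : ℕ))).card := by
  rw [nodalCount, ← card_pathPairs]
  refine card_pairs_eq (P := fun i j => i < j ∧ 0 < M i j * φ i * φ j) ?_ ?_
  · rintro ⟨i, j⟩ h
    rw [mem_pathPairs, Finset.mem_filter, Finset.mem_range] at h
    simp only
    omega
  · intro i j
    rw [mem_pathPairs, Finset.mem_filter, Finset.mem_range]
    by_cases hadj : (Hgraph n β).Adj i j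
    · rw [mul_mul_pos_iff_odd (hneg i j hadj) (hφ i) (hφ j), Nat.odd_iff, Fin.lt_def]
      rw [Hgraph_adj] at hadj
      omega
    · have : i < j → M i j = 0 := fun h => hM i j h.ne hadj
      rw [Hgraph_adj] at hadj
      constructor
      · rintro ⟨h1, h2⟩
        simp [this h1] at h2
      · omega

lemma sum_nodalCount_eq {n β : ℕ} (hβ : β ≤ n - 2) {M : Matrix (Fin n) (Fin n) ℝ}
    (hM : SupportedOn (Hgraph n β) M) (hneg : ∀ i j, (Hgraph n β).Adj i j → M i j < 0)
    {φ : Fin n → Fin n → ℝ} (hφ : ∀ k i : Fin n, 0 < (-1 : ℝ) ^ ((k : ℕ) - i) * φ k i) :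
    ∑ k, nodalCount M (φ k) = n.choose 2 + β := by
  rw [Finset.sum_congr rfl fun k _ => nodalCount_eq hβ hM hneg k (hφ k),
    Fin.sum_univ_eq_sum_range
      (fun k => k + ((Finset.range β).filter (fun i => i + 1 = k)).card) n,
    Finset.sum_add_distrib, Finset.sum_range_id, Nat.choose_two_right]
  congr 1
  rw [← Finset.card_eq_sum_card_fiberwise, Finset.card_range]
  intro i hi
  simp only [Finset.coe_range, Set.mem_Iio] at hi ⊢
  omega

lemma exists_normalized_eigenvectors {n : ℕ} {M : Matrix (Fin n) (Fin n) ℝ} (hM : M.IsSymm) :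
    ∃ (μ : Fin n → ℝ) (v : Fin n → Fin n → ℝ) (τ : Fin n → Fin n),
      (∀ j, M *ᵥ v j = μ j • v j) ∧ (∀ j, v j (τ j) = 1) ∧ (∀ j i, |v j i| ≤ 1) ∧
        Pairwise fun i j => v i ⬝ᵥ v j = 0 := by
  have hH : M.IsHermitian := by
    rw [Matrix.IsHermitian, Matrix.conjTranspose_eq_transpose_of_trivial]; exact hM
  have hmax : ∀ j, ∃ k, ∀ i, |hH.eigenvectorBasis j i| ≤ |hH.eigenvectorBasis j k| := fun j => by
    obtain ⟨k, -, hk⟩ := Finset.exists_max_image Finset.univ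
      (fun i => |hH.eigenvectorBasis j i|) ⟨j, Finset.mem_univ j⟩
    exact ⟨k, fun i => hk i (Finset.mem_univ i)⟩
  choose τ hτ using hmax
  have hne : ∀ j, hH.eigenvectorBasis j (τ j) ≠ 0 := fun j h => by
    refine hH.eigenvectorBasis.orthonormal.ne_zero j ?_
    ext i
    have := hτ j i
    rw [h, abs_zero] at this
    simpa using this
  refine ⟨hH.eigenvalues, fun j => (hH.eigenvectorBasis j (τ j))⁻¹ • ⇑(hH.eigenvectorBasis j), τ,
    fun j => ?_, fun j => ?_, fun j i => ?_, fun i j hij => ?_⟩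
  · rw [Matrix.mulVec_smul, hH.mulVec_eigenvectorBasis, smul_comm]
  · simp [hne j]
  · dsimp only
    rw [Pi.smul_apply, smul_eq_mul, abs_mul, abs_inv, inv_mul_le_one₀ (abs_pos.2 (hne j))]
    exact hτ j i
  · have := hH.eigenvectorBasis.orthonormal.2 hij
    dsimp only at this ⊢
    rw [EuclideanSpace.inner_eq_star_dotProduct, star_trivial, dotProduct_comm] at this
    simp only [smul_dotProduct, dotProduct_smul, this, smul_zero]

lemma exists_sign_structured_eigenvectors {n : ℕ} (β : ℕ) :
    ∃ ε : ℝ, 0 < ε ∧ ∃ (lam : Fin n → ℝ) (φ : Fin n → Fin n → ℝ),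
      StrictMono lam ∧ (∀ k, pathPerturbation n β ε *ᵥ φ k = lam k • φ k) ∧
      ∀ k ℓ : Fin n, 0 < (-1 : ℝ) ^ ((k : ℕ) - ℓ) * φ k ℓ := by
  rcases Nat.eq_zero_or_pos n with rfl | hn0
  · exact ⟨1, one_pos, 0, 0, fun i => i.elim0, fun i => i.elim0, fun i => i.elim0⟩
  have hnpos : (0 : ℝ) < n := by exact_mod_cast hn0
  set c : ℝ := 1 / (4 * n + 4) with hc
  have hc0 : 0 < c := by positivity
  have hc1 : c ≤ 1 := by rw [hc, div_le_one (by positivity)]; linarith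
  have hcn : c ^ n ≤ 1 := pow_le_one₀ hc0.le hc1
  set ε : ℝ := c ^ n / (n + 1) with hεdef
  have hε : 0 < ε := by positivity
  have hεmul : (n + 1) * ε = c ^ n := by rw [hεdef]; field_simp
  have hε1 : ε < 1 := by nlinarith
  have hnε : n * ε ≤ c ^ n := by linarith
  have hnε1 : n * ε ≤ 1 := hnε.trans hcn
  obtain ⟨μ, v, τ, hv, hvτ, hvle, horth⟩ :=
    exists_normalized_eigenvectors (pathPerturbation_isSymm n β ε)
  have hμ : ∀ j, |4 * (τ j : ℝ) - μ j| ≤ 1 := fun j =>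
    abs_eigenvalue_sub_le hε hε1.le hnε1 (hv j) (hvτ j) (hvle j)
  have hloc : ∀ j, ∀ i ≠ τ j, |v j i| ≤ ε := fun j i hi =>
    (abs_le_pow_dist hε hε1.le hnε1 (hv j) (hvτ j) (hμ j) i).trans <| by
      refine pow_le_of_le_one hε.le hε1.le fun h => hi (Fin.ext (Nat.eq_of_dist_eq_zero h))
  have hinj : Function.Injective τ := fun i j hij => by
    by_contra hne
    exact dotProduct_ne_zero_of_localized hε (by nlinarith) (hvτ i) (hij ▸ hvτ j) (hloc i)
      (hij ▸ hloc j) (horth hne)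
  let e : Fin n ≃ Fin n := Equiv.ofBijective τ (Finite.injective_iff_bijective.1 hinj)
  have he : ∀ k, τ (e.symm k) = k := e.apply_symm_apply
  refine ⟨ε, hε, fun k => μ (e.symm k), fun k => v (e.symm k), fun k l hkl => ?_,
    fun k => hv _, fun k ℓ => ?_⟩
  · have h1 := abs_le.1 (hμ (e.symm k))
    have h2 := abs_le.1 (hμ (e.symm l))
    rw [he] at h1 h2
    have : (k : ℝ) + 1 ≤ l := by exact_mod_cast hkl
    simp only
    linarith
  · refine (by positivity : 0 < (c * ε) ^ Nat.dist ℓ k).trans_le ?_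
    refine pow_le_sign_mul hε hε1.le hnε (hv _) ?_ ?_ ℓ
    · simpa only [he] using hvτ (e.symm k)
    · simpa only [he] using hμ (e.symm k)

/-- for `0 ≤ β ≤ n - 2` the graph `H_{n,β}` has Betti number `β` and carries a
matrix `M ∈ S(H_{n,β})` satisfying the Nodal Count Condition, whose eigenvectors have the sign
structure `sign(φ k ℓ) = (-1)^(k-ℓ)` for `ℓ < k` and `+1` for `ℓ ≥ k`, with total nodal count
`C(n,2) + β`. -/
theorem exists_path_based_extremizer (n β : ℕ) (hβ : β ≤ n - 2) :
    betti (Hgraph n β) = β ∧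
    ∃ (M : Matrix (Fin n) (Fin n) ℝ) (lam : Fin n → ℝ) (φ : Fin n → Fin n → ℝ),
      M.IsSymm ∧ SupportedOn (Hgraph n β) M ∧ (∀ i j, (Hgraph n β).Adj i j → M i j ≠ 0) ∧
      StrictMono lam ∧ (∀ k, M.mulVec (φ k) = lam k • φ k) ∧ (∀ k i, φ k i ≠ 0) ∧
      (∀ k ℓ : Fin n, 0 < (-1 : ℝ) ^ ((k : ℕ) - (ℓ : ℕ)) * φ k ℓ) ∧
      ∑ k : Fin n, nodalCount M (φ k) = n.choose 2 + β := by
  obtain ⟨ε, hε, lam, φ, hlam, heig, hsign⟩ := exists_sign_structured_eigenvectors (n := n) β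
  have hneg : ∀ i j, (Hgraph n β).Adj i j → pathPerturbation n β ε i j < 0 :=
    fun _ _ => pathPerturbation_neg hε
  have hsupp := pathPerturbation_supportedOn n β ε
  refine ⟨betti_Hgraph hβ, pathPerturbation n β ε, lam, φ, pathPerturbation_isSymm n β ε, hsupp,
    fun i j h => (hneg i j h).ne, hlam, heig, fun k i h => ?_, hsign,
    sum_nodalCount_eq hβ hsupp hneg hsign⟩
  simpa [h] using hsign k i
end

section
/- Let n ∈ ℕ and 0 ≤ β ≤ 2(n−2), and let H^{(0)}_{2n,β} be the graph on vertices {1,…,2n} with edge set {(i,i+1) : 1 ≤ i < 2n} ∪ {(i,i+4) : 1 ≤ i ≤ β}. Then there exists a real symmetric 2n×2n matrix M with zero diagonal, M ∈ S_0(H^{(0)}_{2n,β}), satisfying the Nodal Count Condition and having total nodal count equal to C(2n,2) + 2β. -/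
open Matrix

/-- The graph `H⁰_{2n,β}` (0-indexed): a path `0 - 1 - ⋯ - (2n-1)` together with the `β`
extra edges `(i, i+4)` for `0 ≤ i < β`. -/
def H0graph (n β : ℕ) : SimpleGraph (Fin (2 * n)) :=
  SimpleGraph.fromRel (fun i j =>
    (j : ℕ) = (i : ℕ) + 1 ∨ ((j : ℕ) = (i : ℕ) + 4 ∧ (i : ℕ) < β))

open Filter Topology in
/-- Perturbation of a simple eigenvalue: if `v p = 0` and `(N 0 - lam₀) v ∈ span u₀` force
`v = 0`, then for small `t` the matrix `N t` has an eigenpair close to `(lam₀, u₀)`. -/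
theorem eventually_exists_eigenpair_near {ι : Type*} [Fintype ι]
    (N : ℝ → Matrix ι ι ℝ) (hN : ∀ i j, ContDiff ℝ 1 (fun t => N t i j))
    (u₀ : ι → ℝ) (lam₀ : ℝ) (p : ι) (h₀ : N 0 *ᵥ u₀ = lam₀ • u₀)
    (hinj : ∀ (v : ι → ℝ) (μ : ℝ), N 0 *ᵥ v = lam₀ • v + μ • u₀ → v p = 0 → v = 0 ∧ μ = 0)
    (hu₀ : ∀ i, u₀ i ≠ 0) :
    ∀ᶠ t in 𝓝 (0 : ℝ), ∃ (u : ι → ℝ) (lam : ℝ),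
      N t *ᵥ u = lam • u ∧ |lam - lam₀| < 1 ∧ ∀ i, 0 < u i * u₀ i := by
  let G : ℝ × (ι → ℝ) × ℝ → ℝ × (ι → ℝ) × ℝ := fun z =>
    (z.1, fun i => ∑ j, N z.1 i j * z.2.1 j - z.2.2 * z.2.1 i, z.2.1 p)
  have hG : ContDiff ℝ 1 G := by
    have hN' : ∀ i j, ContDiff ℝ 1 (fun z : ℝ × (ι → ℝ) × ℝ => N z.1 i j) :=
      fun i j => (hN i j).comp contDiff_fst
    have hc : ∀ i, ContDiff ℝ 1 (fun z : ℝ × (ι → ℝ) × ℝ => z.2.1 i) := fun i => by fun_prop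
    refine contDiff_fst.prodMk (ContDiff.prodMk (contDiff_pi.2 fun i => ?_) (hc p))
    refine ContDiff.sub (ContDiff.sum fun j _ => (hN' i j).mul (hc j)) (ContDiff.mul ?_ (hc i))
    fun_prop
  set a : ℝ × (ι → ℝ) × ℝ := (0, u₀, lam₀) with ha
  have hstrict : HasStrictFDerivAt G (fderiv ℝ G a) a :=
    hG.contDiffAt.hasStrictFDerivAt (by norm_num)
  have hline : ∀ z : ℝ × (ι → ℝ) × ℝ,
      HasDerivAt (fun h : ℝ => G (a + h • z)) (fderiv ℝ G a z) 0 := by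
    intro z
    have h1 : HasFDerivAt G (fderiv ℝ G a) (a + (0 : ℝ) • z) := by
      simpa using hstrict.hasFDerivAt
    have h2 : HasDerivAt (fun h : ℝ => a + h • z) z 0 := by
      simpa using ((hasDerivAt_id (0 : ℝ)).smul_const z).const_add a
    exact h1.comp_hasDerivAt 0 h2
  have hker : Function.Injective (fderiv ℝ G a).toLinearMap := by
    rw [← LinearMap.ker_eq_bot, LinearMap.ker_eq_bot']
    rintro ⟨τ, v, μ⟩ hz
    have hd := hline (τ, v, μ)
    have hz' : fderiv ℝ G a (τ, v, μ) = 0 := hz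
    rw [hz'] at hd
    have hτ : τ = 0 := by
      have h1 : HasDerivAt (fun h : ℝ => h * τ) 0 0 := by
        simpa [G, ha, Function.comp_def] using
          (ContinuousLinearMap.fst ℝ ℝ ((ι → ℝ) × ℝ)).hasFDerivAt.comp_hasDerivAt 0 hd
      have h2 : HasDerivAt (fun h : ℝ => h * τ) τ 0 := by
        simpa using (hasDerivAt_id (0 : ℝ)).mul_const τ
      exact h2.unique h1
    subst hτ
    have hvp : v p = 0 := by
      have h1 : HasDerivAt (fun h : ℝ => u₀ p + h * v p) 0 0 := by
        simpa [G, ha, Function.comp_def] using ((ContinuousLinearMap.snd ℝ (ι → ℝ) ℝ).comp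
          (ContinuousLinearMap.snd ℝ ℝ ((ι → ℝ) × ℝ))).hasFDerivAt.comp_hasDerivAt 0 hd
      have h2 : HasDerivAt (fun h : ℝ => u₀ p + h * v p) (v p) 0 := by
        simpa using ((hasDerivAt_id (0 : ℝ)).mul_const (v p)).const_add (u₀ p)
      exact h2.unique h1
    have hrow : N 0 *ᵥ v = lam₀ • v + μ • u₀ := by
      ext i
      have h1 : HasDerivAt (fun h : ℝ => ∑ j, N 0 i j * (u₀ j + h * v j)
          - (lam₀ + h * μ) * (u₀ i + h * v i)) 0 0 := by
        simpa [G, ha, Function.comp_def] using (((ContinuousLinearMap.proj i).comp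
          (ContinuousLinearMap.fst ℝ (ι → ℝ) ℝ)).comp
            (ContinuousLinearMap.snd ℝ ℝ ((ι → ℝ) × ℝ))).hasFDerivAt.comp_hasDerivAt 0 hd
      have hl : ∀ x y : ℝ, HasDerivAt (fun h : ℝ => x + h * y) y 0 := fun x y => by
        simpa using ((hasDerivAt_id (0 : ℝ)).mul_const y).const_add x
      have h2 := (HasDerivAt.fun_sum (u := Finset.univ)
        fun j _ => (hl (u₀ j) (v j)).const_mul (N 0 i j)).sub
          ((hl lam₀ μ).mul (hl (u₀ i) (v i)))
      have h3 := h2.unique h1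
      simp only [Matrix.mulVec, dotProduct, Pi.add_apply, Pi.smul_apply, smul_eq_mul]
      simp only [zero_mul, add_zero] at h3
      linarith
    obtain ⟨rfl, rfl⟩ := hinj v μ hrow hvp
    rfl
  have hsurj : (fderiv ℝ G a).range = ⊤ :=
    LinearMap.range_eq_top.2 (LinearMap.injective_iff_surjective.1 hker)
  have hmap := hstrict.map_nhds_eq_of_surj hsurj
  have hGa : G a = (0, 0, u₀ p) := by
    refine Prod.ext rfl (Prod.ext ?_ rfl)
    ext i
    have := congrFun h₀ i
    simp only [Matrix.mulVec, dotProduct, Pi.smul_apply, smul_eq_mul] at this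
    simp [G, ha, this]
  have hU : ∀ᶠ z in 𝓝 a, |z.2.2 - lam₀| < 1 ∧ ∀ i, 0 < z.2.1 i * u₀ i := by
    refine Filter.Eventually.and ?_ (Filter.eventually_all.2 fun i => ?_)
    · have hc : Continuous fun z : ℝ × (ι → ℝ) × ℝ => |z.2.2 - lam₀| := by fun_prop
      exact hc.continuousAt.eventually_lt continuousAt_const (by simp [ha])
    · have hc : Continuous fun z : ℝ × (ι → ℝ) × ℝ => z.2.1 i * u₀ i := by fun_prop
      exact continuousAt_const.eventually_lt hc.continuousAt (mul_self_pos.2 (hu₀ i))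
  have himg := Filter.image_mem_map (m := G) hU
  rw [hmap, hGa] at himg
  have hc : Continuous fun t : ℝ => ((t, 0, u₀ p) : ℝ × (ι → ℝ) × ℝ) := by fun_prop
  filter_upwards [hc.continuousAt.preimage_mem_nhds himg] with t ht
  obtain ⟨⟨t', u, lam⟩, ⟨hlam, hu⟩, hz⟩ := ht
  obtain rfl : t' = t := congrArg Prod.fst hz
  refine ⟨u, lam, ?_, hlam, hu⟩
  ext i
  have := congrFun (congrArg (fun z => z.2.1) hz) i
  simpa [G, Matrix.mulVec, dotProduct, sub_eq_zero] using this

/-- The weight of the edge joining the two vertices `2a`, `2a+1` of the cell `a`. -/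
def cellWeight (a : ℕ) : ℝ := 2 * a + 1

/-- Coefficient of the `(i, j)` entry, a monomial in the perturbation parameter. -/
noncomputable def entryCoeff (β i j : ℕ) : ℝ :=
  if i / 2 = j / 2 ∧ i ≠ j then cellWeight (i / 2)
  else if j = i + 1 ∨ i = j + 1 then 1
  else if (j = i + 4 ∧ i < β) ∨ (i = j + 4 ∧ j < β) then -1
  else 0

/-- Degree of the `(i, j)` entry in the perturbation parameter. -/
def entryDegree (i j : ℕ) : ℕ :=
  if i / 2 = j / 2 then 0 else if j = i + 1 ∨ i = j + 1 then 1 else 3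

/-- The distance from the cell of the vertex `i` to the cell `c`. -/
def cellDist (c i : ℕ) : ℕ := (i / 2 - c) + (c - i / 2)

/-- The entries of the perturbed matrix. -/
noncomputable def pathEntry (β : ℕ) (t : ℝ) (i j : ℕ) : ℝ :=
  entryCoeff β i j * t ^ entryDegree i j

/-- The entries of the perturbed matrix conjugated by the diagonal matrix with entries
`t ^ cellDist c i`. -/
noncomputable def scaledEntry (β c : ℕ) (t : ℝ) (i j : ℕ) : ℝ :=
  entryCoeff β i j * t ^ (entryDegree i j + cellDist c j - cellDist c i)

theorem pathEntry_mul_pow (β c : ℕ) (t : ℝ) (i j : ℕ) :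
    pathEntry β t i j * t ^ cellDist c j = t ^ cellDist c i * scaledEntry β c t i j := by
  unfold pathEntry scaledEntry
  by_cases h : entryCoeff β i j = 0
  · simp [h]
  · have hle : cellDist c i ≤ entryDegree i j + cellDist c j := by
      unfold entryCoeff at h
      unfold cellDist entryDegree
      split_ifs at h ⊢ <;> first | omega | exact absurd rfl h
    have he : entryDegree i j + cellDist c j
        = cellDist c i + (entryDegree i j + cellDist c j - cellDist c i) := by omega
    rw [mul_assoc, ← pow_add, he, pow_add, Nat.add_sub_cancel_left]
    ring

theorem pathEntry_comm (β : ℕ) (t : ℝ) (i j : ℕ) : pathEntry β t i j = pathEntry β t j i := by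
  unfold pathEntry
  congr 1
  · unfold entryCoeff
    split_ifs <;> first | rfl | omega | (congr 1; omega)
  · unfold entryDegree
    split_ifs <;> first | rfl | omega

theorem scaledEntry_zero (β c i j : ℕ) : scaledEntry β c 0 i j =
    if i / 2 = j / 2 ∧ i ≠ j then cellWeight (i / 2)
    else if (j = i + 1 ∧ i / 2 < c) ∨ (i = j + 1 ∧ c < i / 2) then 1 else 0 := by
  unfold scaledEntry entryCoeff entryDegree cellDist
  rw [zero_pow_eq]
  split_ifs <;> first | omega | simp

theorem sum_scaledEntry_zero_even {n a : ℕ} (β c : ℕ) (ha : a < n) (v : ℕ → ℝ) :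
    ∑ j ∈ Finset.range (2 * n), scaledEntry β c 0 (2 * a) j * v j
      = cellWeight a * v (2 * a + 1) + if c < a then v (2 * a - 1) else 0 := by
  have h : ∀ j, scaledEntry β c 0 (2 * a) j * v j
      = (if j = 2 * a + 1 then cellWeight a * v j else 0)
        + if j = 2 * a - 1 then (if c < a then v j else 0) else 0 := by
    intro j
    have h2 : 2 * a / 2 = a := by omega
    rw [scaledEntry_zero, h2]
    split_ifs <;> first | omega | simp
  simp only [h, Finset.sum_add_distrib, Finset.sum_ite_eq', Finset.mem_range]
  rw [if_pos (by omega), if_pos (by omega)]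

theorem sum_scaledEntry_zero_odd {n a : ℕ} (β : ℕ) {c : ℕ} (hc : c < n) (ha : a < n)
    (v : ℕ → ℝ) :
    ∑ j ∈ Finset.range (2 * n), scaledEntry β c 0 (2 * a + 1) j * v j
      = cellWeight a * v (2 * a) + if a < c then v (2 * a + 2) else 0 := by
  have h : ∀ j, scaledEntry β c 0 (2 * a + 1) j * v j
      = (if j = 2 * a then cellWeight a * v j else 0)
        + if j = 2 * a + 2 then (if a < c then v j else 0) else 0 := by
    intro j
    have h2 : (2 * a + 1) / 2 = a := by omega
    rw [scaledEntry_zero, h2]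
    split_ifs <;> first | omega | simp
  simp only [h, Finset.sum_add_distrib, Finset.sum_ite_eq', Finset.mem_range]
  rw [if_pos (by omega)]
  split_ifs <;> first | omega | rfl

theorem cellWeight_pos (a : ℕ) : 0 < cellWeight a := by
  unfold cellWeight; positivity

theorem cellWeight_lt {a b : ℕ} (h : a < b) : cellWeight a < cellWeight b := by
  unfold cellWeight
  have : (a : ℝ) < b := by exact_mod_cast h
  linarith

/-- The ratio between the components of the limiting eigenvector in consecutive cells. -/
noncomputable def cellRatio (c a : ℕ) : ℝ :=
  cellWeight a / (cellWeight c ^ 2 - cellWeight a ^ 2)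

theorem cellRatio_neg {c a : ℕ} (h : c < a) : cellRatio c a < 0 := by
  have := cellWeight_lt h
  have := cellWeight_pos c
  exact div_neg_of_pos_of_neg (cellWeight_pos a) (by nlinarith)

theorem cellRatio_pos {c a : ℕ} (h : a < c) : 0 < cellRatio c a := by
  have := cellWeight_lt h
  have := cellWeight_pos a
  exact div_pos (cellWeight_pos a) (by nlinarith)

theorem mul_cellRatio {c a : ℕ} (h : a ≠ c) :
    (cellWeight c ^ 2 - cellWeight a ^ 2) * cellRatio c a = cellWeight a := by
  refine mul_div_cancel₀ _ fun h0 => ?_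
  have h1 := cellWeight_pos a
  have h2 := cellWeight_pos c
  rcases lt_or_gt_of_ne h with h | h <;> have := cellWeight_lt h <;> nlinarith

/-- The product of the ratios over the cells between `c` and `a`. -/
noncomputable def cellProd (c a : ℕ) : ℝ :=
  (∏ m ∈ Finset.Ico a c, cellRatio c m) * ∏ m ∈ Finset.Ioc c a, cellRatio c m

theorem cellProd_succ {c a : ℕ} (h : c ≤ a) :
    cellProd c (a + 1) = cellProd c a * cellRatio c (a + 1) := by
  unfold cellProd
  rw [Finset.Ico_eq_empty (by omega), Finset.Ico_eq_empty (by omega),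
    ← Finset.insert_Ioc_right_eq_Ioc_add_one h,
    Finset.prod_insert (by simp)]
  simp [mul_comm]

theorem cellProd_of_lt {c a : ℕ} (h : a < c) :
    cellProd c a = cellRatio c a * cellProd c (a + 1) := by
  unfold cellProd
  rw [Finset.Ioc_eq_empty (by omega), Finset.Ioc_eq_empty (by omega),
    Finset.prod_eq_prod_Ico_succ_bot h]
  simp

theorem cellProd_self (c : ℕ) : cellProd c c = 1 := by simp [cellProd]

/-- The sign of the limiting eigenvector, up to `s`, on the cell `a`. -/
def cellSign (c a : ℕ) : ℝ := (-1) ^ (a - c)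

theorem cellProd_mul_cellSign_pos (c a : ℕ) : 0 < cellProd c a * cellSign c a := by
  unfold cellSign
  rcases le_total c a with h | h
  · induction a, h using Nat.le_induction with
    | base => simp [cellProd_self]
    | succ a h ih =>
      have hr := cellRatio_neg (Nat.lt_succ_of_le h)
      rw [cellProd_succ h, Nat.succ_sub h, pow_succ]
      nlinarith
  · induction h using Nat.decreasingInduction with
    | self => simp [cellProd_self]
    | of_succ a h ih =>
      rw [cellProd_of_lt h]
      rw [Nat.sub_eq_zero_of_le h] at ih
      rw [Nat.sub_eq_zero_of_le (Nat.le_of_lt h)]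
      have := mul_pos (cellRatio_pos h) ih
      linarith

/-- The limiting eigenvector for the eigenvalue `s * cellWeight c`. -/
noncomputable def limitVec (c : ℕ) (s : ℝ) (i : ℕ) : ℝ :=
  if i % 2 = 0 then
    cellProd c (i / 2) * if c < i / 2 then cellWeight c / cellWeight (i / 2) else 1
  else
    s * cellProd c (i / 2) * if i / 2 < c then cellWeight c / cellWeight (i / 2) else 1

/-- The sign of `limitVec`. -/
noncomputable def limitSign (c : ℕ) (s : ℝ) (i : ℕ) : ℝ :=
  (if i % 2 = 0 then 1 else s) * cellSign c (i / 2)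

theorem limitVec_even (c : ℕ) (s : ℝ) (a : ℕ) : limitVec c s (2 * a)
    = cellProd c a * if c < a then cellWeight c / cellWeight a else 1 := by
  have h1 : 2 * a / 2 = a := by omega
  simp [limitVec, h1]

theorem limitVec_odd (c : ℕ) (s : ℝ) (a : ℕ) : limitVec c s (2 * a + 1)
    = s * cellProd c a * if a < c then cellWeight c / cellWeight a else 1 := by
  have h1 : (2 * a + 1) / 2 = a := by omega
  have h2 : (2 * a + 1) % 2 = 1 := by omega
  simp [limitVec, h1, h2]

theorem limitVec_mul_limitSign_pos (c : ℕ) {s : ℝ} (hs : s ^ 2 = 1) (i : ℕ) :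
    0 < limitVec c s i * limitSign c s i := by
  have hp := cellProd_mul_cellSign_pos c (i / 2)
  have hq : 0 < cellWeight c / cellWeight (i / 2) := div_pos (cellWeight_pos _) (cellWeight_pos _)
  unfold limitVec limitSign
  split_ifs
  · have := mul_pos hp hq; linarith
  · linarith
  · have := mul_pos hp hq
    calc (0 : ℝ) < s ^ 2 * (cellProd c (i / 2) * cellSign c (i / 2)
          * (cellWeight c / cellWeight (i / 2))) := by rw [hs]; linarith
      _ = _ := by ring
  · calc (0 : ℝ) < s ^ 2 * (cellProd c (i / 2) * cellSign c (i / 2)) := by rw [hs]; linarith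
      _ = _ := by ring

theorem sum_scaledEntry_zero_limitVec {n : ℕ} (β : ℕ) {c : ℕ} {s : ℝ} (hs : s ^ 2 = 1)
    (hc : c < n) {i : ℕ} (hi : i < 2 * n) :
    ∑ j ∈ Finset.range (2 * n), scaledEntry β c 0 i j * limitVec c s j
      = s * cellWeight c * limitVec c s i := by
  obtain ⟨a, rfl | rfl⟩ : ∃ a, i = 2 * a ∨ i = 2 * a + 1 := ⟨i / 2, by omega⟩
  · have hd := (cellWeight_pos a).ne'
    rw [sum_scaledEntry_zero_even β c (by omega), limitVec_odd, limitVec_even]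
    rcases lt_trichotomy a c with h | rfl | h
    · rw [if_pos h, if_neg (by omega), if_neg (by omega)]
      field_simp
      ring
    · simp; ring
    · obtain ⟨b, rfl⟩ : ∃ b, a = b + 1 := ⟨a - 1, by omega⟩
      rw [if_neg (by omega), if_pos h, if_pos h, show 2 * (b + 1) - 1 = 2 * b + 1 by omega,
        limitVec_odd, if_neg (by omega), cellProd_succ (by omega)]
      have := mul_cellRatio h.ne'
      field_simp
      linear_combination (-s * cellProd c b) * this
  · have hd := (cellWeight_pos a).ne'
    rw [sum_scaledEntry_zero_odd β hc (by omega), limitVec_odd, limitVec_even]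
    rcases lt_trichotomy a c with h | rfl | h
    · rw [if_neg (by omega), if_pos h, if_pos h, show 2 * a + 2 = 2 * (a + 1) by ring,
        limitVec_even, if_neg (by omega), cellProd_of_lt h]
      have := mul_cellRatio h.ne
      field_simp
      linear_combination (-cellProd c (a + 1)) * this
        - (cellWeight c ^ 2 * cellRatio c a * cellProd c (a + 1)) * hs
    · simp
      linear_combination (-cellWeight a * cellProd a a) * hs
    · rw [if_pos h, if_neg (by omega), if_neg (by omega)]
      field_simp
      linear_combination (-(cellProd c a * cellWeight c)) * hs

theorem limitVec_simple {n : ℕ} (β : ℕ) {c : ℕ} {s : ℝ} (hs : s ^ 2 = 1) (hc : c < n)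
    (v : ℕ → ℝ) (μ : ℝ)
    (hv : ∀ i < 2 * n, ∑ j ∈ Finset.range (2 * n), scaledEntry β c 0 i j * v j
      = s * cellWeight c * v i + μ * limitVec c s i)
    (hvc : v (2 * c) = 0) : (∀ i < 2 * n, v i = 0) ∧ μ = 0 := by
  have heven : ∀ a < n, _ := fun a ha =>
    (sum_scaledEntry_zero_even β c ha v).symm.trans (hv (2 * a) (by omega))
  have hodd : ∀ a < n, _ := fun a ha =>
    (sum_scaledEntry_zero_odd β hc ha v).symm.trans (hv (2 * a + 1) (by omega))
  have hs0 : s ≠ 0 := by rintro rfl; norm_num at hs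
  have hc1 := heven c hc
  have hc2 := hodd c hc
  rw [limitVec_even] at hc1
  rw [limitVec_odd] at hc2
  simp only [lt_irrefl, if_false, cellProd_self, hvc] at hc1 hc2
  have hμ : μ = 0 := by
    have : 2 * s * μ = 0 := by linear_combination (-1 : ℝ) * hc2 - s * hc1
    simpa [hs0] using this
  subst hμ
  have hvc' : v (2 * c + 1) = 0 := by
    simpa [(cellWeight_pos c).ne'] using hc1
  have hblock : ∀ a, a ≠ c → ∀ x y : ℝ, cellWeight a * y = s * cellWeight c * x →
      cellWeight a * x = s * cellWeight c * y → x = 0 ∧ y = 0 := by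
    intro a hac x y h1 h2
    have hne : cellWeight c ^ 2 - cellWeight a ^ 2 ≠ 0 := by
      intro h0
      have h3 := mul_cellRatio hac
      rw [h0, zero_mul] at h3
      exact (cellWeight_pos a).ne h3
    have hx : (cellWeight c ^ 2 - cellWeight a ^ 2) * x = 0 := by
      linear_combination (-cellWeight a) * h2 - s * cellWeight c * h1
        - cellWeight c ^ 2 * x * hs
    have hx0 : x = 0 := by simpa [hne] using hx
    subst hx0
    simpa [(cellWeight_pos a).ne'] using h1
  have hup : ∀ a, c ≤ a → a < n → v (2 * a) = 0 ∧ v (2 * a + 1) = 0 := by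
    intro a h
    induction a, h using Nat.le_induction with
    | base => exact fun _ => ⟨hvc, hvc'⟩
    | succ a h ih =>
      intro ha
      have h1 := heven (a + 1) ha
      have h2 := hodd (a + 1) ha
      rw [if_pos (by omega), show 2 * (a + 1) - 1 = 2 * a + 1 by omega,
        (ih (by omega)).2] at h1
      rw [if_neg (by omega)] at h2
      exact hblock (a + 1) (by omega) _ _ (by linarith) (by linarith)
  have hdown : ∀ a, a ≤ c → v (2 * a) = 0 ∧ v (2 * a + 1) = 0 := by
    intro a h
    induction h using Nat.decreasingInduction with
    | self => exact ⟨hvc, hvc'⟩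
    | of_succ a h ih =>
      have h1 := heven a (by omega)
      have h2 := hodd a (by omega)
      rw [if_neg (by omega)] at h1
      rw [if_pos (by omega), show 2 * a + 2 = 2 * (a + 1) by ring, ih.1] at h2
      exact hblock a (by omega) _ _ (by linarith) (by linarith)
  refine ⟨fun i hi => ?_, rfl⟩
  have hcell : v (2 * (i / 2)) = 0 ∧ v (2 * (i / 2) + 1) = 0 := by
    rcases le_total c (i / 2) with h | h
    · exact hup _ h (by omega)
    · exact hdown _ h
  rcases Nat.mod_two_eq_zero_or_one i with h | h
  · rw [show i = 2 * (i / 2) by omega]; exact hcell.1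
  · rw [show i = 2 * (i / 2) + 1 by omega]; exact hcell.2

/-- The cell carrying the `k`-th limiting eigenvector. -/
def modeCell (n k : ℕ) : ℕ := if k < n then n - 1 - k else k - n

/-- The sign of the `k`-th limiting eigenvalue. -/
def modeSign (n k : ℕ) : ℝ := if k < n then -1 else 1

theorem modeSign_sq (n k : ℕ) : modeSign n k ^ 2 = 1 := by
  unfold modeSign; split_ifs <;> norm_num

theorem modeCell_lt {n k : ℕ} (hk : k < 2 * n) : modeCell n k < n := by
  unfold modeCell; split_ifs <;> omega

theorem modeSign_mul_cellWeight {n k : ℕ} :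
    modeSign n k * cellWeight (modeCell n k) = 2 * k + 1 - 2 * n := by
  unfold modeSign modeCell cellWeight
  split_ifs with h
  · obtain ⟨m, rfl⟩ : ∃ m, n = k + 1 + m := ⟨n - (k + 1), by omega⟩
    rw [show k + 1 + m - 1 - k = m by omega]
    push_cast; ring
  · rw [Nat.cast_sub (by omega)]; ring

theorem modeCell_rev {n k : ℕ} (hk : k < 2 * n) :
    modeCell n (2 * n - (k + 1)) = modeCell n k := by
  unfold modeCell; split_ifs <;> omega

theorem modeSign_rev {n k : ℕ} (hk : k < 2 * n) :
    modeSign n (2 * n - (k + 1)) = -modeSign n k := by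
  unfold modeSign; split_ifs <;> first | omega | norm_num

theorem cellSign_ne_zero (c a : ℕ) : cellSign c a ≠ 0 := by simp [cellSign]

theorem limitSign_mul_succ (c : ℕ) (s : ℝ) (i : ℕ) :
    limitSign c s i * limitSign c s (i + 1)
      = s * (cellSign c (i / 2) * cellSign c ((i + 1) / 2)) := by
  unfold limitSign
  split_ifs <;> first | omega | ring

theorem limitSign_mul_add_four (c : ℕ) {s : ℝ} (hs : s ^ 2 = 1) (i : ℕ) :
    limitSign c s i * limitSign c s (i + 4) = if c = i / 2 + 1 then -1 else 1 := by
  have h : limitSign c s i * limitSign c s (i + 4)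
      = cellSign c (i / 2) * cellSign c (i / 2 + 2) := by
    unfold limitSign
    rw [show (i + 4) / 2 = i / 2 + 2 by omega, show (i + 4) % 2 = i % 2 by omega]
    split_ifs
    · ring
    · linear_combination (cellSign c (i / 2) * cellSign c (i / 2 + 2)) * hs
  rw [h]
  unfold cellSign
  rw [← pow_add]
  split_ifs with hc
  · rw [show i / 2 - c + (i / 2 + 2 - c) = 1 by omega, pow_one]
  · apply Even.neg_one_pow
    rcases Nat.lt_or_ge c (i / 2 + 1) with h' | h'
    · exact ⟨i / 2 + 1 - c, by omega⟩
    · exact ⟨0, by omega⟩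

theorem entryCoeff_succ_pos (β i : ℕ) : 0 < entryCoeff β i (i + 1) := by
  unfold entryCoeff
  split_ifs <;> first | omega | exact cellWeight_pos _ | norm_num

theorem entryCoeff_add_four (β i : ℕ) :
    entryCoeff β i (i + 4) = if i < β then -1 else 0 := by
  unfold entryCoeff
  split_ifs <;> first | omega | rfl

theorem entryCoeff_eq_zero {β i j : ℕ} (hij : i < j) (h1 : j ≠ i + 1) (h4 : j ≠ i + 4) :
    entryCoeff β i j = 0 := by
  unfold entryCoeff
  split_ifs <;> first | omega | rfl

theorem sum_modeCell_eq {n b : ℕ} (hb : b < n) :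
    ∑ k : Fin (2 * n), (if modeCell n k = b then 1 else 0) = 2 := by
  rw [Fin.sum_univ_eq_sum_range (fun k => if modeCell n k = b then 1 else 0)]
  have h : ∀ k, (if modeCell n k = b then 1 else 0)
      = (if k = n - 1 - b then 1 else 0) + if k = n + b then 1 else 0 := by
    intro k
    unfold modeCell
    split_ifs <;> omega
  simp only [h, Finset.sum_add_distrib, Finset.sum_ite_eq', Finset.mem_range]
  rw [if_pos (by omega), if_pos (by omega)]

/-- The number of modes which are positive along the pair `(i, j)`. -/
theorem sum_modes_positive {n β i j : ℕ} (hij : i < j) (hj : j < 2 * n) :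
    ∑ k : Fin (2 * n), (if 0 < entryCoeff β i j *
        (limitSign (modeCell n k) (modeSign n k) i * limitSign (modeCell n k) (modeSign n k) j)
        then 1 else 0)
      = (if j = i + 1 then n else 0) + if j = i + 4 then (if i < β then 2 else 0) else 0 := by
  by_cases h1 : j = i + 1
  · subst h1
    simp only [limitSign_mul_succ, if_true, mul_pos_iff_of_pos_left (entryCoeff_succ_pos β i)]
    rw [if_neg (by omega), add_zero]
    set f : Fin (2 * n) → ℕ := fun k => if 0 < modeSign n k *
      (cellSign (modeCell n k) (i / 2) * cellSign (modeCell n k) ((i + 1) / 2)) then 1 else 0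
      with hf
    have hrev : ∀ k, f k + f (Fin.revPerm k) = 1 := by
      intro k
      simp only [hf, Fin.revPerm_apply, Fin.val_rev, modeCell_rev k.2, modeSign_rev k.2,
        neg_mul]
      have hne : modeSign n k *
          (cellSign (modeCell n k) (i / 2) * cellSign (modeCell n k) ((i + 1) / 2)) ≠ 0 := by
        refine mul_ne_zero (fun h0 => ?_)
          (mul_ne_zero (cellSign_ne_zero _ _) (cellSign_ne_zero _ _))
        have := modeSign_sq n k
        rw [h0] at this
        norm_num at this
      rcases lt_or_gt_of_ne hne with h | h
      · rw [if_neg (by linarith), if_pos (by linarith)]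
      · rw [if_pos h, if_neg (by linarith)]
    have hsum : ∑ k, f (Fin.revPerm k) = ∑ k, f k := Equiv.sum_comp Fin.revPerm f
    have h2 : ∑ k, f k + ∑ k, f (Fin.revPerm k) = 2 * n := by
      rw [← Finset.sum_add_distrib, Finset.sum_congr rfl fun k _ => hrev k]
      simp
    change ∑ k, f k = n
    omega
  rw [if_neg h1, zero_add]
  by_cases h4 : j = i + 4
  · subst h4
    simp only [entryCoeff_add_four, limitSign_mul_add_four _ (modeSign_sq n _), if_true]
    split_ifs with hβ
    · refine (Finset.sum_congr rfl fun k _ => ?_).trans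
        (sum_modeCell_eq (n := n) (b := i / 2 + 1) (by omega))
      split_ifs <;> first | rfl | (exfalso; linarith)
    · simp
  · simp [entryCoeff_eq_zero hij h1 h4, h4]

theorem sum_edges_eq {n β : ℕ} (hβ : β ≤ 2 * (n - 2)) :
    ∑ i : Fin (2 * n), ∑ j : Fin (2 * n), (if (i : ℕ) < j then
        (if (j : ℕ) = i + 1 then n else 0)
          + (if (j : ℕ) = i + 4 then (if (i : ℕ) < β then 2 else 0) else 0) else 0)
      = (2 * n).choose 2 + 2 * β := by
  rw [Fin.sum_univ_eq_sum_range (fun i => ∑ j : Fin (2 * n), (if i < j then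
        (if (j : ℕ) = i + 1 then n else 0)
          + (if (j : ℕ) = i + 4 then (if i < β then 2 else 0) else 0) else 0))]
  have hrow : ∀ i : ℕ, ∑ j : Fin (2 * n), (if i < j then
        (if (j : ℕ) = i + 1 then n else 0)
          + (if (j : ℕ) = i + 4 then (if i < β then 2 else 0) else 0) else 0)
      = (if i < 2 * n - 1 then n else 0) + if i < β then 2 else 0 := by
    intro i
    rw [Fin.sum_univ_eq_sum_range (fun j => if i < j then
        (if j = i + 1 then n else 0)
          + (if j = i + 4 then (if i < β then 2 else 0) else 0) else 0)]
    have h : ∀ j, (if i < j then (if j = i + 1 then n else 0)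
          + (if j = i + 4 then (if i < β then 2 else 0) else 0) else 0)
        = (if j = i + 1 then n else 0) + if j = i + 4 then (if i < β then 2 else 0) else 0 := by
      intro j
      split_ifs <;> omega
    simp only [h, Finset.sum_add_distrib, Finset.sum_ite_eq', Finset.mem_range]
    split_ifs <;> omega
  have hcount : ∀ m r : ℕ, m ≤ 2 * n →
      ∑ i ∈ Finset.range (2 * n), (if i < m then r else 0) = m * r := by
    intro m r hm
    have h : (Finset.range (2 * n)).filter (· < m) = Finset.range m := by
      ext x
      simp only [Finset.mem_filter, Finset.mem_range]
      omega
    rw [← Finset.sum_filter, h, Finset.sum_const, smul_eq_mul, Finset.card_range]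
  simp only [hrow, Finset.sum_add_distrib]
  rw [hcount _ _ (by omega), hcount _ _ (by omega), Nat.choose_two_right, mul_assoc 2,
    Nat.mul_div_cancel_left _ two_pos]
  ring

theorem nodalCount_eq_sum {n : ℕ} (A : Matrix (Fin n) (Fin n) ℝ) (φ : Fin n → ℝ) :
    nodalCount A φ
      = ∑ i : Fin n, ∑ j : Fin n, if (i : ℕ) < j then (if 0 < A i j * φ i * φ j then 1 else 0) else 0 := by
  unfold nodalCount
  rw [Nat.card_eq_fintype_card, Fintype.card_subtype, Finset.card_filter,
    ← Finset.univ_product_univ, Finset.sum_product]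
  simp only [ite_and, Fin.lt_def]

theorem pathEntry_ne_zero_iff {n β : ℕ} {t : ℝ} (ht : 0 < t) {i j : Fin (2 * n)} :
    pathEntry β t i j ≠ 0 ↔ (H0graph n β).Adj i j := by
  have hi := (cellWeight_pos (i / 2)).ne'
  have hij : i ≠ j ↔ (i : ℕ) ≠ j := by simp [Fin.ext_iff]
  unfold pathEntry entryCoeff H0graph
  rw [SimpleGraph.fromRel_adj, ne_eq, mul_eq_zero, not_or,
    and_iff_left (pow_ne_zero _ ht.ne'), hij]
  split_ifs <;> simp [hi] <;> omega

theorem sum_nodalCount_eq_s7 {n β : ℕ} (hβ : β ≤ 2 * (n - 2)) {t : ℝ} (ht : 0 < t)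
    (φ : Fin (2 * n) → Fin (2 * n) → ℝ)
    (hφ : ∀ k i, 0 < φ k i * limitSign (modeCell n k) (modeSign n k) i) :
    ∑ k, nodalCount (Matrix.of fun i j : Fin (2 * n) => pathEntry β t i j) (φ k)
      = (2 * n).choose 2 + 2 * β := by
  rw [← sum_edges_eq hβ]
  simp only [nodalCount_eq_sum, Matrix.of_apply]
  rw [Finset.sum_comm]
  refine Finset.sum_congr rfl fun i _ => ?_
  rw [Finset.sum_comm]
  refine Finset.sum_congr rfl fun j _ => ?_
  by_cases hij : (i : ℕ) < j
  · simp only [if_pos hij]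
    rw [← sum_modes_positive hij j.2]
    refine Finset.sum_congr rfl fun k _ => if_congr ?_ rfl rfl
    have hp := mul_pos (hφ k i) (hφ k j)
    have ht' := pow_pos ht (entryDegree i j)
    set σ := limitSign (modeCell n k) (modeSign n k) i *
      limitSign (modeCell n k) (modeSign n k) j with hσ
    have hpσ : 0 < (φ k i * φ k j) * σ := by rw [hσ]; linarith
    unfold pathEntry
    constructor
    · intro h
      have h1 : 0 < entryCoeff β i j * (φ k i * φ k j) := by
        refine pos_of_mul_pos_left (b := t ^ entryDegree i j) ?_ ht'.le
        linarith
      have h2 := mul_pos h1 hpσ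
      have h3 : 0 < (entryCoeff β i j * σ) * (φ k i * φ k j) ^ 2 := by linarith
      exact pos_of_mul_pos_left h3 (sq_nonneg _)
    · intro h
      have h2 := mul_pos h hpσ
      have h3 : 0 < (entryCoeff β i j * (φ k i * φ k j)) * σ ^ 2 := by linarith
      have h4 := mul_pos (pos_of_mul_pos_left h3 (sq_nonneg _)) ht'
      linarith
  · simp [hij]

open Filter Topology in
theorem eventually_exists_eigenpair_pathEntry {n : ℕ} (β : ℕ) (k : Fin (2 * n)) :
    ∀ᶠ t in 𝓝[>] (0 : ℝ), ∃ (φ : Fin (2 * n) → ℝ) (lam : ℝ),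
      (Matrix.of fun i j : Fin (2 * n) => pathEntry β t i j) *ᵥ φ = lam • φ ∧
      |lam - (2 * k + 1 - 2 * n)| < 1 ∧
      ∀ i, 0 < φ i * limitSign (modeCell n k) (modeSign n k) i := by
  set c := modeCell n k
  set s := modeSign n k
  have hc : c < n := modeCell_lt k.2
  have hs : s ^ 2 = 1 := modeSign_sq n k
  have hev := eventually_exists_eigenpair_near
    (fun t => Matrix.of fun i j : Fin (2 * n) => scaledEntry β c t i j)
    (fun i j => by
      simp only [Matrix.of_apply, scaledEntry]
      fun_prop)
    (fun i => limitVec c s i) (s * cellWeight c) ⟨2 * c, by omega⟩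
    (by
      ext i
      have := sum_scaledEntry_zero_limitVec β hs hc i.2
      rw [← Fin.sum_univ_eq_sum_range (fun j => scaledEntry β c 0 i j * limitVec c s j)] at this
      simpa [Matrix.mulVec, dotProduct] using this)
    (by
      intro v μ hv hvc
      set w : ℕ → ℝ := fun i => if h : i < 2 * n then v ⟨i, h⟩ else 0 with hw
      have hwv : ∀ i : Fin (2 * n), w i = v i := fun i => by simp [hw]
      obtain ⟨h0, hμ⟩ := limitVec_simple β hs hc w μ
        (fun i hi => by
          have := congrFun hv ⟨i, hi⟩
          rw [← Fin.sum_univ_eq_sum_range (fun j => scaledEntry β c 0 i j * w j)]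
          simp only [hw, hi, dif_pos]
          simpa [Matrix.mulVec, dotProduct] using this)
        ((hwv ⟨2 * c, by omega⟩).trans hvc)
      exact ⟨funext fun i => (hwv i).symm.trans (h0 i i.2), hμ⟩)
    (fun i h0 => by
      have := limitVec_mul_limitSign_pos c hs i
      rw [h0, zero_mul] at this
      exact this.false)
  filter_upwards [hev.filter_mono nhdsWithin_le_nhds, self_mem_nhdsWithin] with t ht ht0
  obtain ⟨u, lam, hu, hlam, hpos⟩ := ht
  refine ⟨fun i => t ^ cellDist c i * u i, lam, ?_, ?_, fun i => ?_⟩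
  · ext i
    have hi := congrFun hu i
    simp only [Matrix.mulVec, dotProduct, Matrix.of_apply, Pi.smul_apply, smul_eq_mul] at hi ⊢
    calc ∑ j : Fin (2 * n), pathEntry β t i j * (t ^ cellDist c j * u j)
        = t ^ cellDist c i * ∑ j : Fin (2 * n), scaledEntry β c t i j * u j := by
          rw [Finset.mul_sum]
          refine Finset.sum_congr rfl fun j _ => ?_
          rw [← mul_assoc, pathEntry_mul_pow, mul_assoc]
      _ = lam * (t ^ cellDist c i * u i) := by rw [hi]; ring
  · rwa [modeSign_mul_cellWeight] at hlam
  · have h1 := mul_pos (hpos i) (limitVec_mul_limitSign_pos c hs i)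
    have h2 : 0 < (u i * limitSign c s i) * limitVec c s i ^ 2 := by linarith
    have h3 := mul_pos (pow_pos (Set.mem_Ioi.1 ht0) (cellDist c i))
      (pos_of_mul_pos_left h2 (sq_nonneg _))
    linarith

/-- for `0 ≤ β ≤ 2(n-2)` there is a real symmetric `2n × 2n` matrix with zero
diagonal in `S₀(H⁰_{2n,β})`, strictly supported on `H⁰_{2n,β}`, satisfying the Nodal Count
Condition and having total nodal count `C(2n,2) + 2β`. -/
theorem exists_zero_diagonal_path_based_construction (n β : ℕ) (hβ : β ≤ 2 * (n - 2)) :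
    ∃ (M : Matrix (Fin (2 * n)) (Fin (2 * n)) ℝ) (lam : Fin (2 * n) → ℝ)
      (φ : Fin (2 * n) → Fin (2 * n) → ℝ),
      M.IsSymm ∧ (∀ i, M i i = 0) ∧
      SupportedOn (H0graph n β) M ∧ (∀ i j, (H0graph n β).Adj i j → M i j ≠ 0) ∧
      StrictMono lam ∧ (∀ k, M.mulVec (φ k) = lam k • φ k) ∧ (∀ k i, φ k i ≠ 0) ∧
      ∑ k : Fin (2 * n), nodalCount M (φ k) = (2 * n).choose 2 + 2 * β := by
  obtain ⟨t, hex, ht⟩ := ((Filter.eventually_all.2 fun k =>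
    eventually_exists_eigenpair_pathEntry (n := n) β k).and self_mem_nhdsWithin).exists
  choose φ lam hφ hlam hpos using hex
  have hoff : ∀ i j : Fin (2 * n), ¬ (H0graph n β).Adj i j → pathEntry β t i j = 0 :=
    fun i j h => not_not.1 fun h' => h ((pathEntry_ne_zero_iff ht).1 h')
  refine ⟨Matrix.of fun i j => pathEntry β t i j, lam, φ, ?_, fun i => hoff i i (by simp),
    fun i j _ h => hoff i j h, fun i j h => (pathEntry_ne_zero_iff ht).2 h, fun k l hkl => ?_,
    hφ, fun k i h0 => ?_, sum_nodalCount_eq_s7 hβ ht φ hpos⟩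
  · ext i j
    exact pathEntry_comm β t j i
  · have h1 := (abs_lt.1 (hlam k)).2
    have h2 := (abs_lt.1 (hlam l)).1
    have h3 : (k : ℝ) + 1 ≤ l := by exact_mod_cast hkl
    linarith
  · have := hpos k i
    rw [h0, zero_mul] at this
    exact this.false
end

section
/- Suppose G is a bipartite simple graph on an even number n of vertices and A ∈ S_0(G) satisfies the Nodal Count Condition, with eigenvectors φ_1,…,φ_n ordered by increasing eigenvalue. Then for every edge (ij) of G, the edge nodal count ν(A,(ij)) = #{k ∈ {1,…,n} : A_{ij}·φ_k(i)·φ_k(j) > 0} equals exactly n/2; consequently the total nodal count equals n·|E(G)|/2. -/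
open Matrix

/-- An eigenvector of a matrix with as many distinct eigenvalues as its size is a multiple of
one of the corresponding eigenvectors. -/
theorem exists_smul_of_mulVec_eq_smul {ι : Type*} [Fintype ι] [DecidableEq ι]
    {A : Matrix ι ι ℝ} {lam : ι → ℝ} {φ : ι → ι → ℝ} (hlam : Function.Injective lam)
    (heig : ∀ k, A.mulVec (φ k) = lam k • φ k) (hφ : ∀ k, φ k ≠ 0)
    {μ : ℝ} {ψ : ι → ℝ} (hψ : A.mulVec ψ = μ • ψ) (hψ0 : ψ ≠ 0) :
    ∃ m, lam m = μ ∧ ∃ c : ℝ, c ≠ 0 ∧ ψ = c • φ m := by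
  have hli : LinearIndependent ℝ φ :=
    Module.End.eigenvectors_linearIndependent' (Matrix.toLin' A) lam hlam φ fun k =>
      ⟨Module.End.mem_eigenspace_iff.2 (by simpa using heig k), hφ k⟩
  have hspan : Submodule.span ℝ (Set.range φ) = ⊤ :=
    hli.span_eq_top_of_card_eq_finrank' (by simp)
  obtain ⟨c, hc⟩ := (Submodule.mem_span_range_iff_exists_fun ℝ).1
    (hspan ▸ Submodule.mem_top : ψ ∈ Submodule.span ℝ (Set.range φ))
  have hzero : ∀ k, c k * (lam k - μ) = 0 := by
    refine Fintype.linearIndependent_iff.1 hli (fun k => c k * (lam k - μ)) ?_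
    have h := hψ
    rw [← hc, Matrix.mulVec_sum, Finset.smul_sum, ← sub_eq_zero, ← Finset.sum_sub_distrib] at h
    rw [← h]
    refine Finset.sum_congr rfl fun k _ => ?_
    rw [Matrix.mulVec_smul, heig, smul_smul, smul_smul, ← sub_smul]
    ring_nf
  obtain ⟨m, hm⟩ : ∃ m, c m ≠ 0 := by
    by_contra! h
    exact hψ0 (by simp [← hc, h])
  have hmμ : lam m = μ := by
    simpa [hm, sub_eq_zero] using hzero m
  refine ⟨m, hmμ, c m, hm, ?_⟩
  rw [← hc]
  refine Finset.sum_eq_single m (fun k _ hk => ?_) (by simp)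
  have hne : lam k - μ ≠ 0 := sub_ne_zero.2 fun h => hk (hlam (h.trans hmμ.symm))
  simp [(mul_eq_zero.1 (hzero k)).resolve_right hne]

/-- If `A` has no entry between vertices of the same colour, changing the sign of an eigenvector
on one colour class gives an eigenvector for the opposite eigenvalue. -/
theorem mulVec_sign_flip {ι : Type*} [Fintype ι] {A : Matrix ι ι ℝ} {f : ι → Bool}
    (hA : ∀ i j, f i = f j → A i j = 0) {μ : ℝ} {φ : ι → ℝ} (h : A.mulVec φ = μ • φ) :
    A.mulVec (fun i => (if f i then 1 else -1) * φ i) =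
      (-μ) • fun i => (if f i then 1 else -1) * φ i := by
  ext i
  have hi := congrFun h i
  simp only [Matrix.mulVec, dotProduct, Pi.smul_apply, smul_eq_mul] at hi ⊢
  have hsum : ∑ j, A i j * ((if f j then 1 else -1) * φ j) =
      -(if f i then 1 else -1) * ∑ j, A i j * φ j := by
    rw [Finset.mul_sum]
    refine Finset.sum_congr rfl fun j _ => ?_
    by_cases hij : f i = f j
    · simp [hA i j hij]
    · cases hfi : f i <;> cases hfj : f j <;> simp_all
  rw [hsum, hi]
  ring

/-- If an involution reverses the sign of a nowhere-vanishing function, then the function is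
positive on exactly half of the points. -/
theorem two_mul_card_pos_of_involutive {ι : Type*} [Finite ι] {π : ι → ι}
    (hπ : Function.Involutive π) {x : ι → ℝ} (hx : ∀ k, x k ≠ 0)
    (hsign : ∀ k, 0 < x k ↔ x (π k) < 0) :
    2 * Nat.card {k // 0 < x k} = Nat.card ι := by
  have h1 : Nat.card {k // 0 < x k} = Nat.card {k // ¬ 0 < x k} :=
    Nat.card_congr (hπ.toPerm.subtypeEquiv fun k => by
      rw [hsign k, Function.Involutive.coe_toPerm, not_lt]
      exact ⟨le_of_lt, fun h => lt_of_le_of_ne h (hx _)⟩)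
  classical
  rw [← Nat.card_congr (Equiv.sumCompl fun k => 0 < x k), Nat.card_sum, ← h1, two_mul]

/-- The edges of a graph on a linear order correspond to the increasing pairs of adjacent
vertices. -/
theorem card_lt_and_adj_eq_card_edgeSet {V : Type*} [LinearOrder V] (G : SimpleGraph V) :
    Nat.card {p : V × V // p.1 < p.2 ∧ G.Adj p.1 p.2} = Nat.card G.edgeSet := by
  refine Nat.card_congr (Equiv.ofBijective
    (fun p => ⟨s(p.1.1, p.1.2), p.2.2⟩) ⟨?_, ?_⟩)
  · rintro ⟨⟨a, b⟩, hab, _⟩ ⟨⟨c, d⟩, hcd, _⟩ h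
    rcases Sym2.eq_iff.1 (Subtype.ext_iff.1 h) with ⟨rfl, rfl⟩ | ⟨rfl, rfl⟩
    · rfl
    · exact absurd hab hcd.asymm
  · rintro ⟨e, he⟩
    induction e with
    | _ a b =>
      have hadj : G.Adj a b := he
      rcases lt_or_gt_of_ne hadj.ne with h | h
      · exact ⟨⟨(a, b), h, hadj⟩, rfl⟩
      · exact ⟨⟨(b, a), h, hadj.symm⟩, Subtype.ext Sym2.eq_swap⟩

/-- if `G` is bipartite on an even number `n` of vertices and `A ∈ S₀(G)`
satisfies the Nodal Count Condition, then every edge has edge nodal count exactly `n / 2`,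
and consequently the total nodal count equals `(n/2)·|E(G)|`. -/
theorem bipartite_edge_nodal_count {n : ℕ} (hn : Even n) (G : SimpleGraph (Fin n))
    (f : Fin n → Bool) (hbip : ∀ i j, G.Adj i j → f i ≠ f j)
    (A : Matrix (Fin n) (Fin n) ℝ) (hA : A.IsSymm) (hdiag : ∀ i, A i i = 0)
    (hsupp : SupportedOn G A) (hstrict : ∀ i j, G.Adj i j → A i j ≠ 0)
    (lam : Fin n → ℝ) (φ : Fin n → Fin n → ℝ) (hlam : StrictMono lam)
    (heig : ∀ k, A.mulVec (φ k) = lam k • φ k) (hnv : ∀ k i, φ k i ≠ 0) :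
    (∀ i j, G.Adj i j →
      Nat.card {k : Fin n // 0 < A i j * φ k i * φ k j} = n / 2) ∧
    ∑ k : Fin n, nodalCount A (φ k) = (n / 2) * Nat.card G.edgeSet := by
  have hcol : ∀ i j, f i = f j → A i j = 0 := fun i j hij => by
    by_cases h : i = j
    · exact h ▸ hdiag i
    · exact hsupp i j h fun hadj => hbip i j hadj hij
  have hflip : ∀ k, ∃ m, lam m = -lam k ∧ ∃ c : ℝ, c ≠ 0 ∧
      (fun i => (if f i then 1 else -1) * φ k i) = c • φ m := fun k =>
    exists_smul_of_mulVec_eq_smul hlam.injective heig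
      (fun l h => hnv l k (congrFun h k)) (mulVec_sign_flip hcol (heig k)) fun h => by
        have hk := congrFun h k
        cases hfk : f k <;> simp [hfk, hnv] at hk
  choose π hπ c hc hφπ using hflip
  have hinv : Function.Involutive π := fun k => hlam.injective (by rw [hπ, hπ, neg_neg])
  have hedge : ∀ i j, G.Adj i j →
      Nat.card {k : Fin n // 0 < A i j * φ k i * φ k j} = n / 2 := fun i j hij => by
    have h := two_mul_card_pos_of_involutive (x := fun k => A i j * φ k i * φ k j) hinv
      (fun k => mul_ne_zero (mul_ne_zero (hstrict i j hij) (hnv k i)) (hnv k j)) fun k => by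
        have hi := congrFun (hφπ k) i
        have hj := congrFun (hφπ k) j
        have hprod : A i j * φ k i * φ k j =
            c k ^ 2 * -(A i j * φ (π k) i * φ (π k) j) := by
          have hf := hbip i j hij
          simp only [Pi.smul_apply, smul_eq_mul] at hi hj
          calc A i j * φ k i * φ k j
              = -(A i j * ((if f i then 1 else -1) * φ k i) *
                  ((if f j then 1 else -1) * φ k j)) := by
                cases hfi : f i <;> cases hfj : f j <;> simp [hfi, hfj] at hf ⊢
            _ = _ := by rw [hi, hj]; ring
        simp only [hprod]
        rw [mul_pos_iff_of_pos_left (by have := hc k; positivity), neg_pos]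
    rw [Nat.card_fin] at h
    omega
  refine ⟨hedge, ?_⟩
  classical
  have hpair : ∀ p : Fin n × Fin n,
      Nat.card {k // p.1 < p.2 ∧ 0 < A p.1 p.2 * φ k p.1 * φ k p.2} =
        (n / 2) * (if p.1 < p.2 ∧ G.Adj p.1 p.2 then 1 else 0) := fun p => by
    by_cases h : p.1 < p.2 ∧ G.Adj p.1 p.2
    · simpa only [h, true_and, if_true, mul_one, and_self] using hedge p.1 p.2 h.2
    · have hempty : ∀ k, ¬ (p.1 < p.2 ∧ 0 < A p.1 p.2 * φ k p.1 * φ k p.2) := by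
        rintro k ⟨hlt, hpos⟩
        have h0 := hsupp p.1 p.2 hlt.ne fun hadj => h ⟨hlt, hadj⟩
        simp [h0] at hpos
      simp [h, hempty]
  rw [← card_lt_and_adj_eq_card_edgeSet]
  simp only [nodalCount, Nat.card_eq_fintype_card, Fintype.card_subtype, Finset.card_filter]
    at hpair ⊢
  rw [Finset.sum_comm, Finset.sum_congr rfl fun p _ => hpair p, ← Finset.mul_sum]
end

section
/- Let G be a simple graph on n vertices and suppose that det(A) = 0 for every real symmetric matrix A ∈ S_0(G) (that is, G is sub-determinantal). Then for every A ∈ S_0(G), either 0 is an eigenvalue of A of multiplicity at least two (dim ker A ≥ 2), or 0 is a simple eigenvalue and every vector φ in the kernel of A satisfies φ(i)·φ(j) = 0 for every edge (ij) of G. -/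
open Matrix

/-- If the symmetric matrix `A` has kernel spanned by `φ`, where `φ i` is nonzero, and a
nonzero perturbation of the entries `(i, j)` and `(j, i)` by `t` is singular, then
`t • (φ j • eᵢ - φ i • eⱼ)` has a preimage under `A` with entries `φ i` and `-φ j` at `i` and `j`. -/
lemma exists_mulVec_eq_of_det_add_single_eq_zero {V : Type*} [Fintype V] [DecidableEq V]
    {A : Matrix V V ℝ} (hA : A.IsSymm) {φ : V → ℝ} (hφ : A *ᵥ φ = 0)
    (hspan : ∀ x, A *ᵥ x = 0 → ∃ c : ℝ, x = c • φ) {i j : V} (hi : φ i ≠ 0)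
    {t : ℝ} (ht : t ≠ 0) (hdet : (A + (single i j t + single j i t)).det = 0) :
    ∃ ψ : V → ℝ, ψ i = φ i ∧ ψ j = -φ j ∧
      A *ᵥ ψ = t • (Pi.single i (φ j) - Pi.single j (φ i)) := by
  obtain ⟨ψ, hψ0, hψ⟩ := exists_mulVec_eq_zero_iff.mpr hdet
  have hAψ : A *ᵥ ψ = -(Pi.single i (t * ψ j) + Pi.single j (t * ψ i)) := by
    rw [add_mulVec, add_mulVec] at hψ
    have h := eq_neg_of_add_eq_zero_left hψ
    rw [h]
    congr 2 <;> ext k <;> simp [single_mulVec, Function.update_apply, Pi.single_apply]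
  have horth : φ i * ψ j + φ j * ψ i = 0 := by
    have h : φ ⬝ᵥ (A *ᵥ ψ) = 0 := by
      rw [dotProduct_mulVec, ← mulVec_transpose, hA.eq, hφ, zero_dotProduct]
    rw [hAψ, dotProduct_neg, dotProduct_add, dotProduct_single, dotProduct_single] at h
    apply mul_left_cancel₀ ht
    linarith
  have hψi : ψ i ≠ 0 := by
    intro h0
    have hψj : ψ j = 0 := by simpa [h0, hi] using horth
    obtain ⟨c, rfl⟩ := hspan ψ (by simp [hAψ, h0, hψj])
    have hc : c = 0 := by simpa [hi] using h0
    exact hψ0 (by simp [hc])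
  have hscale : φ i / ψ i * ψ j = -φ j := by
    field_simp
    linarith
  refine ⟨(φ i / ψ i) • ψ, ?_, ?_, ?_⟩
  · simp [hψi]
  · simpa using hscale
  · rw [mulVec_smul, hAψ]
    have hscale' : φ i / ψ i * ψ i = φ i := div_mul_cancel₀ _ hψi
    ext k
    simp only [Pi.smul_apply, Pi.neg_apply, Pi.add_apply, Pi.sub_apply, Pi.single_apply,
      smul_eq_mul]
    split_ifs
    · linear_combination (-t) * hscale - t * hscale'
    · linear_combination (-t) * hscale
    · linear_combination (-t) * hscale'
    · ring

/-- if `G` is sub-determinantal (every zero-diagonal symmetric matrix supported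
on `G` has zero determinant), then for every `A ∈ S₀(G)` either `0` is a multiple eigenvalue
(`dim ker A ≥ 2`), or `0` is simple and every kernel vector `φ` satisfies `φ i · φ j = 0` on
every edge. -/
theorem subdeterminantal_kernel_structure {n : ℕ} (G : SimpleGraph (Fin n))
    (hsub : ∀ A : Matrix (Fin n) (Fin n) ℝ,
      A.IsSymm → SupportedOn G A → (∀ i, A i i = 0) → A.det = 0)
    (A : Matrix (Fin n) (Fin n) ℝ) (hA : A.IsSymm)
    (hsupp : SupportedOn G A) (hdiag : ∀ i, A i i = 0) :
    2 ≤ Module.finrank ℝ (LinearMap.ker A.mulVecLin) ∨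
    (Module.finrank ℝ (LinearMap.ker A.mulVecLin) = 1 ∧
      ∀ φ ∈ LinearMap.ker A.mulVecLin, ∀ i j, G.Adj i j → φ i * φ j = 0) := by
  have hpos : Module.finrank ℝ (LinearMap.ker A.mulVecLin) ≠ 0 := by
    intro h
    obtain ⟨v, hv0, hv⟩ := exists_mulVec_eq_zero_iff.mpr (hsub A hA hsupp hdiag)
    have hmem : v ∈ LinearMap.ker A.mulVecLin := by simpa using hv
    rw [Submodule.finrank_eq_zero.mp h] at hmem
    exact hv0 (by simpa using hmem)
  by_cases h2 : 2 ≤ Module.finrank ℝ (LinearMap.ker A.mulVecLin)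
  · exact Or.inl h2
  have h1 : Module.finrank ℝ (LinearMap.ker A.mulVecLin) = 1 := by omega
  refine Or.inr ⟨h1, fun φ hφ i j hij => ?_⟩
  by_contra hne
  obtain ⟨hi, hj⟩ := mul_ne_zero_iff.mp hne
  have hAφ : A *ᵥ φ = 0 := by simpa using hφ
  have hspan : ∀ x, A *ᵥ x = 0 → ∃ c : ℝ, x = c • φ := by
    intro x hx
    have hφ0 : (⟨φ, hφ⟩ : LinearMap.ker A.mulVecLin) ≠ 0 := by
      intro h
      exact hi (congrFun (congrArg Subtype.val h) i)
    obtain ⟨c, hc⟩ := (finrank_eq_one_iff_of_nonzero' _ hφ0).mp h1 ⟨x, by simpa using hx⟩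
    exact ⟨c, (congrArg Subtype.val hc).symm⟩
  have hdet : ∀ t : ℝ, (A + (single i j t + single j i t)).det = 0 := by
    intro t
    apply hsub
    · refine hA.add ?_
      simp [IsSymm, add_comm]
    · intro k l hkl hadj
      have h₁ : ¬ (i = k ∧ j = l) := by
        rintro ⟨rfl, rfl⟩
        exact hadj hij
      have h₂ : ¬ (j = k ∧ i = l) := by
        rintro ⟨rfl, rfl⟩
        exact hadj hij.symm
      simp [hsupp k l hkl hadj, h₁, h₂]
    · intro k
      have h₁ : ¬ (i = k ∧ j = k) := fun h => hij.ne (h.1.trans h.2.symm)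
      have h₂ : ¬ (j = k ∧ i = k) := fun h => h₁ h.symm
      simp [hdiag k, h₁, h₂]
  obtain ⟨ψ₁, hi₁, hj₁, hA₁⟩ :=
    exists_mulVec_eq_of_det_add_single_eq_zero hA hAφ hspan hi one_ne_zero (hdet 1)
  obtain ⟨ψ₂, hi₂, hj₂, hA₂⟩ :=
    exists_mulVec_eq_of_det_add_single_eq_zero hA hAφ hspan hi two_ne_zero (hdet 2)
  obtain ⟨c, hc⟩ := hspan ((2 : ℝ) • ψ₁ - ψ₂) (by
    rw [mulVec_sub, mulVec_smul, hA₁, hA₂, one_smul, sub_self])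
  have hci := congrFun hc i
  have hcj := congrFun hc j
  simp only [Pi.sub_apply, Pi.smul_apply, smul_eq_mul, hi₁, hi₂, hj₁, hj₂] at hci hcj
  have hc1 : c = 1 := mul_right_cancel₀ hi (by linarith)
  rw [hc1] at hcj
  exact hj (by linarith)
end

section
/- Let C_{2n+1} be the cycle graph on 2n+1 vertices (n ≥ 1). Then there exists a real symmetric matrix A ∈ S_0(C_{2n+1}) with zero diagonal, strictly supported on C_{2n+1}, that satisfies the Nodal Count Condition: all of its eigenvalues are simple and all of its eigenvectors are nowhere-vanishing. -/
open Matrix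

/-- The cycle graph on `m` vertices (0-indexed): edges `(i, i+1)` and the edge `(0, m-1)`. -/
def cycleGraph (m : ℕ) : SimpleGraph (Fin m) :=
  SimpleGraph.fromRel (fun i j =>
    (j : ℕ) = (i : ℕ) + 1 ∨ ((i : ℕ) = 0 ∧ (j : ℕ) = m - 1))

/-- The weighted adjacency matrix of a cycle, with weight `w i` on the edge `(i, i + 1)`. -/
def weightedCycle {R : Type*} [CommRing R] {m : ℕ} [NeZero m] (w : Fin m → R) :
    Matrix (Fin m) (Fin m) R :=
  Matrix.of fun i j => (if j = i + 1 then w i else 0) + (if i = j + 1 then w j else 0)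

/-- The Krylov matrix of `A` at the vertex `v`, whose columns are the vectors `A ^ j e_v` with
entries listed cyclically starting from `v`. -/
def krylov {R : Type*} [CommRing R] {m : ℕ} [NeZero m] (A : Matrix (Fin m) (Fin m) R)
    (v : Fin m) : Matrix (Fin m) (Fin m) R :=
  Matrix.of fun i j => (A ^ (j : ℕ)) (v + i) v

section CommRing

variable {R S : Type*} [CommRing R] [CommRing S] {m : ℕ} [NeZero m]

lemma weightedCycle_isSymm (w : Fin m → R) : (weightedCycle w).IsSymm := by
  ext i j
  simp [weightedCycle, add_comm]

lemma weightedCycle_mul_apply (w : Fin m → R) (B : Matrix (Fin m) (Fin m) R) (i j : Fin m) :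
    (weightedCycle w * B) i j = w i * B (i + 1) j + w (i - 1) * B (i - 1) j := by
  simp only [Matrix.mul_apply, weightedCycle, Matrix.of_apply, add_mul, ite_mul, zero_mul,
    Finset.sum_add_distrib]
  congr 1
  · simp
  · simp [← sub_eq_iff_eq_add]

lemma weightedCycle_map (f : R →+* S) (w : Fin m → R) :
    (weightedCycle w).map f = weightedCycle (f ∘ w) := by
  ext i j
  simp [weightedCycle, apply_ite f]

lemma krylov_map (f : R →+* S) (A : Matrix (Fin m) (Fin m) R) (v : Fin m) :
    (krylov A v).map f = krylov (A.map f) v := by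
  ext i j
  have h : (A ^ (j : ℕ)).map f = (A.map f) ^ (j : ℕ) := by
    simpa using map_pow f.mapMatrix A (j : ℕ)
  simpa [krylov] using congrFun (congrFun h (v + i)) v

/-- When the edge entering `v` has weight zero and all others have weight one, the columns of the
Krylov matrix at `v` are unitriangular. -/
lemma weightedCycle_pow_apply (v : Fin m) (k : ℕ) :
    ∀ i : ℕ, i < m → k ≤ i →
      ((weightedCycle (fun l => if l = v - 1 then (0 : R) else 1)) ^ k)
        (v + Fin.ofNat m i) v = if i = k then 1 else 0 := by
  induction k with
  | zero =>
    intro i hi _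
    have : Fin.ofNat m i = 0 ↔ i = 0 := by
      rw [Fin.ext_iff]
      simp [Nat.mod_eq_of_lt hi]
    simp only [pow_zero, Matrix.one_apply, add_eq_left, this]
  | succ k ih =>
    intro i hi hki
    obtain ⟨i, rfl⟩ : ∃ j, i = j + 1 := ⟨i - 1, by omega⟩
    have hsucc : ∀ a : ℕ, Fin.ofNat m (a + 1) = Fin.ofNat m a + 1 := by
      intro a
      ext
      simp [Fin.val_add]
    have hpred : v + Fin.ofNat m (i + 1) - 1 = v + Fin.ofNat m i := by
      rw [hsucc]; abel
    have hweight : v + Fin.ofNat m i ≠ v - 1 := by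
      intro h
      have h0 : Fin.ofNat m (i + 1) = 0 := by
        rw [hsucc, ← add_right_inj v, ← add_assoc, h]
        simp
      rw [Fin.ext_iff] at h0
      simp [Nat.mod_eq_of_lt hi] at h0
    rw [pow_succ', weightedCycle_mul_apply, hpred, if_neg hweight, ih i (by omega) (by omega)]
    rcases Nat.lt_or_ge (i + 2) m with h | h
    · have hnext : v + Fin.ofNat m (i + 1) + 1 = v + Fin.ofNat m (i + 2) := by
        rw [hsucc (i + 1), add_assoc]
      rw [hnext, ih (i + 2) h (by omega), if_neg (by omega : i + 2 ≠ k)]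
      simp
    · have hlast : v + Fin.ofNat m (i + 1) = v - 1 := by
        have h0 : Fin.ofNat m (i + 1) + 1 = 0 := by
          rw [← hsucc, show i + 1 + 1 = m by omega]
          ext
          simp
        rw [eq_sub_iff_add_eq, add_assoc, h0, add_zero]
      rw [if_pos hlast]
      simp

lemma det_krylov_weightedCycle (v : Fin m) :
    (krylov (weightedCycle (fun l => if l = v - 1 then (0 : R) else 1)) v).det = 1 := by
  have key : ∀ i j : Fin m, j ≤ i →
      krylov (weightedCycle (fun l => if l = v - 1 then (0 : R) else 1)) v i j =
        if i = j then 1 else 0 := by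
    intro i j hij
    have := weightedCycle_pow_apply (R := R) v j i i.2 hij
    simpa [krylov, Fin.ext_iff] using this
  rw [Matrix.det_of_isUpperTriangular]
  · exact Finset.prod_eq_one fun i _ => by simp [key i i le_rfl]
  · intro i j hij
    simp only [id] at hij
    rw [key i j hij.le, if_neg hij.ne']

end CommRing

/-- Some choice of nonzero weights makes every vertex of the cycle a cyclic vector. -/
lemma exists_weights_det_krylov_ne_zero (m : ℕ) [NeZero m] :
    ∃ w : Fin m → ℝ, (∀ i, w i ≠ 0) ∧ ∀ v, (krylov (weightedCycle w) v).det ≠ 0 := by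
  let P : Fin m → MvPolynomial (Fin m) ℝ := fun v =>
    (krylov (weightedCycle MvPolynomial.X) v).det
  have heval : ∀ w v, MvPolynomial.eval w (P v) = (krylov (weightedCycle w) v).det := by
    intro w v
    have hw : (MvPolynomial.eval w) ∘ MvPolynomial.X = w := by
      ext i
      simp
    rw [RingHom.map_det, RingHom.mapMatrix_apply, krylov_map, weightedCycle_map, hw]
  have hP : ∀ v, P v ≠ 0 := by
    intro v h
    have := heval (fun l => if l = v - 1 then 0 else 1) v
    rw [h, det_krylov_weightedCycle] at this
    simp at this
  have hQ : (∏ i, MvPolynomial.X i) * ∏ v, P v ≠ 0 :=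
    mul_ne_zero (Finset.prod_ne_zero_iff.2 fun i _ => MvPolynomial.X_ne_zero i)
      (Finset.prod_ne_zero_iff.2 fun v _ => hP v)
  obtain ⟨w, hw⟩ : ∃ w, MvPolynomial.eval w ((∏ i, MvPolynomial.X i) * ∏ v, P v) ≠ 0 := by
    by_contra! h
    exact hQ (MvPolynomial.funext fun w => by rw [h w, map_zero])
  simp only [map_mul, map_prod, MvPolynomial.eval_X, heval, mul_ne_zero_iff,
    Finset.prod_ne_zero_iff, Finset.mem_univ, true_implies] at hw
  exact ⟨w, hw⟩

/-- If `v` is a cyclic vertex of a symmetric matrix, no eigenvector vanishes at `v`. -/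
lemma eq_zero_of_mulVec_eq_smul_of_apply_eq_zero {K : Type*} [Field K] {m : ℕ} [NeZero m]
    {A : Matrix (Fin m) (Fin m) K} (hA : A.IsSymm) {v : Fin m} (hv : (krylov A v).det ≠ 0)
    {x : Fin m → K} {μ : K} (hx : A *ᵥ x = μ • x) (hxv : x v = 0) : x = 0 := by
  have hpow : ∀ k : ℕ, (A ^ k) *ᵥ x = μ ^ k • x := by
    intro k
    induction k with
    | zero => simp
    | succ k ih => rw [pow_succ, ← Matrix.mulVec_mulVec, hx, Matrix.mulVec_smul, ih, smul_smul,
        pow_succ']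
  have hzero : (fun i => x (v + i)) ᵥ* krylov A v = 0 := by
    ext j
    have h := congrFun (hpow j) v
    rw [Pi.smul_apply, hxv, smul_zero] at h
    rw [Pi.zero_apply, ← h]
    simp only [Matrix.vecMul, Matrix.mulVec, dotProduct, krylov, Matrix.of_apply]
    rw [← Equiv.sum_comp (Equiv.addLeft v) fun i => (A ^ (j : ℕ)) v i * x i]
    refine Finset.sum_congr rfl fun i _ => ?_
    rw [mul_comm, Equiv.coe_addLeft, ← (hA.pow j).apply v]
  have h := Matrix.eq_zero_of_vecMul_eq_zero hv hzero
  ext i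
  simpa using congrFun h (i - v)

/-- A real symmetric matrix none of whose eigenvectors vanishes anywhere has simple spectrum. -/
lemma exists_strictMono_eigenvalues {m : ℕ} [NeZero m] {A : Matrix (Fin m) (Fin m) ℝ}
    (hA : A.IsSymm) (h : ∀ (x : Fin m → ℝ) (μ : ℝ) (v : Fin m), A *ᵥ x = μ • x → x v = 0 → x = 0) :
    ∃ (lam : Fin m → ℝ) (φ : Fin m → Fin m → ℝ),
      StrictMono lam ∧ (∀ k, A *ᵥ φ k = lam k • φ k) ∧ ∀ k i, φ k i ≠ 0 := by
  have hH : A.IsHermitian := by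
    rw [Matrix.IsHermitian, Matrix.conjTranspose_eq_transpose_of_trivial]
    exact hA
  let b := hH.eigenvectorBasis
  have heig : ∀ k, A *ᵥ ⇑(b k) = hH.eigenvalues k • ⇑(b k) := hH.mulVec_eigenvectorBasis
  have hne : ∀ k i, b k i ≠ 0 := by
    intro k i hki
    have := h _ _ i (heig k) hki
    exact b.toBasis.ne_zero k (by ext l; simpa using congrFun this l)
  have hinj : Function.Injective hH.eigenvalues := by
    intro k l hkl
    by_contra hne'
    have hcomb : b l 0 • ⇑(b k) - b k 0 • ⇑(b l) = 0 := by
      refine h _ (hH.eigenvalues k) 0 ?_ ?_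
      · rw [Matrix.mulVec_sub, Matrix.mulVec_smul, Matrix.mulVec_smul, heig, heig, ← hkl,
          smul_sub, smul_comm, smul_comm (b k 0)]
      · simp [mul_comm]
    have hcomb' : b l 0 • b k - b k 0 • b l = 0 := by
      ext i
      simpa using congrFun hcomb i
    have hinner := congrArg (inner ℝ (b k)) hcomb'
    rw [inner_sub_right, inner_smul_right, inner_smul_right, b.inner_eq_one,
      b.inner_eq_zero hne', inner_zero_right] at hinner
    exact hne l 0 (by simpa using hinner)
  refine ⟨hH.eigenvalues ∘ Tuple.sort hH.eigenvalues, fun k => b (Tuple.sort hH.eigenvalues k),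
    (Tuple.monotone_sort _).strictMono_of_injective (hinj.comp (Equiv.injective _)),
    fun k => heig _, fun k i => hne _ i⟩

lemma Fin.eq_add_one_iff_val {m : ℕ} [NeZero m] (i j : Fin m) :
    j = i + 1 ↔ (j : ℕ) = i + 1 ∨ ((j : ℕ) = 0 ∧ (i : ℕ) = m - 1) := by
  have hi := i.2
  have hj := j.2
  rw [Fin.ext_iff, Fin.val_add, Fin.val_one', Nat.add_mod_mod]
  rcases Nat.lt_or_ge (i + 1) m with h | h
  · rw [Nat.mod_eq_of_lt h]
    omega
  · rw [show (i : ℕ) + 1 = m by omega, Nat.mod_self]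
    omega

lemma cycleGraph_adj_iff {m : ℕ} [NeZero m] (i j : Fin m) :
    (cycleGraph m).Adj i j ↔ i ≠ j ∧ (j = i + 1 ∨ i = j + 1) := by
  rw [cycleGraph, SimpleGraph.fromRel_adj, Fin.eq_add_one_iff_val, Fin.eq_add_one_iff_val]
  tauto

/-- for the odd cycle `C_{2n+1}` (with `n ≥ 1`) there exists a zero-diagonal
real symmetric matrix strictly supported on it, with all eigenvalues simple and all
eigenvectors nowhere-vanishing (the Nodal Count Condition). -/
theorem odd_cycle_has_NCC_matrix (n : ℕ) (hn : 1 ≤ n) :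
    ∃ (A : Matrix (Fin (2 * n + 1)) (Fin (2 * n + 1)) ℝ)
      (lam : Fin (2 * n + 1) → ℝ) (φ : Fin (2 * n + 1) → Fin (2 * n + 1) → ℝ),
      A.IsSymm ∧ (∀ i, A i i = 0) ∧
      SupportedOn (cycleGraph (2 * n + 1)) A ∧
      (∀ i j, (cycleGraph (2 * n + 1)).Adj i j → A i j ≠ 0) ∧
      StrictMono lam ∧ (∀ k, A.mulVec (φ k) = lam k • φ k) ∧ (∀ k i, φ k i ≠ 0) := by
  obtain ⟨w, hw, hK⟩ := exists_weights_det_krylov_ne_zero (2 * n + 1)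
  have hsymm := weightedCycle_isSymm w
  obtain ⟨lam, φ, hlam, hφ, hne⟩ := exists_strictMono_eigenvalues hsymm
    fun _ _ v hx hxv => eq_zero_of_mulVec_eq_smul_of_apply_eq_zero hsymm (hK v) hx hxv
  refine ⟨weightedCycle w, lam, φ, hsymm, ?_, ?_, ?_, hlam, hφ, hne⟩
  · intro i
    have : i ≠ i + 1 := by
      rw [Ne, Fin.eq_add_one_iff_val]
      omega
    simp [weightedCycle, -left_eq_add, this]
  · intro i j hij hadj
    rw [cycleGraph_adj_iff] at hadj
    push Not at hadj
    obtain ⟨h₁, h₂⟩ := hadj hij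
    simp [weightedCycle, h₁, h₂]
  · intro i j hadj
    rw [cycleGraph_adj_iff] at hadj
    have hnot : ¬ (j = i + 1 ∧ i = j + 1) := by
      rw [Fin.eq_add_one_iff_val, Fin.eq_add_one_iff_val]
      omega
    rcases hadj.2 with h | h
    · have h' : ¬ i = j + 1 := fun h' => hnot ⟨h, h'⟩
      simp only [weightedCycle, Matrix.of_apply, if_pos h, if_neg h', add_zero]
      exact hw i
    · have h' : ¬ j = i + 1 := fun h' => hnot ⟨h', h⟩
      simp only [weightedCycle, Matrix.of_apply, if_pos h, if_neg h', zero_add]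
      exact hw j
end

section
/- Let G be a simple graph on n vertices and suppose there exists A ∈ S_0(G) with det(A) ≠ 0 (G is determinantal). Then G has a vertex-disjoint cover by edges and odd cycles: equivalently, there exists a fixed-point-free permutation σ of the vertex set such that (i, σ(i)) is an edge of G for every vertex i, and every cycle of σ has length equal to 2 or odd length. -/
open Matrix

open Equiv Equiv.Perm in
/-- The cycles of even length of a fixed-point-free permutation can be simultaneously coloured
with two alternating colours. -/
theorem exists_alternating_of_even_cycle {α : Type*} [Fintype α] [DecidableEq α] (σ : Perm α)
    (hσ : ∀ i, σ i ≠ i) :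
    ∃ E : α → Prop, ∀ y, Even (σ.cycleOf y).support.card → (E (σ y) ↔ ¬ E y) := by
  let r : α → α := fun y => (Quotient.mk (SameCycle.setoid σ) y).out
  have hr : ∀ y, SameCycle σ (r y) y := fun y => Quotient.mk_out (s := SameCycle.setoid σ) y
  have hrσ : ∀ y, r (σ y) = r y := fun y =>
    congrArg Quotient.out (Quotient.sound (s := SameCycle.setoid σ)
      (show SameCycle σ (σ y) y from (SameCycle.refl σ y).apply_left))
  refine ⟨fun y => ∃ k : ℤ, (σ ^ (2 * k)) (r y) = y, fun y hy => ?_⟩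
  simp only [hrσ]
  constructor
  · rintro ⟨l, hl⟩ ⟨k, hk⟩
    have hfix : (σ ^ (2 * k + 1 - 2 * l)) y = y := by
      have hl' : (σ ^ (-(2 * l))) (σ y) = r y := by
        rw [← hl, _root_.zpow_neg, Perm.inv_def, symm_apply_apply]
      calc (σ ^ (2 * k + 1 - 2 * l)) y = (σ ^ (2 * k)) ((σ ^ (-(2 * l))) (σ y)) := by
            rw [show 2 * k + 1 - 2 * l = 2 * k + (-(2 * l)) + 1 by ring, _root_.zpow_add_one,
              _root_.zpow_add]
            rfl
        _ = y := by rw [hl', hk]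
    have hmem : y ∈ (σ.cycleOf y).support :=
      mem_support_cycleOf_iff.2 ⟨SameCycle.refl σ y, mem_support.2 (hσ y)⟩
    have hdvd := ((isCycleOn_support_cycleOf σ y).zpow_apply_eq hmem).1 hfix
    obtain ⟨m, hm⟩ := hy
    obtain ⟨c, hc⟩ := hdvd
    rw [hm] at hc
    push_cast at hc
    have : 2 * k + 1 - 2 * l = 2 * (m * c) := by rw [hc]; ring
    omega
  · intro h
    obtain ⟨k, hk⟩ := hr y
    rcases Int.even_or_odd' k with ⟨j, rfl | rfl⟩
    · exact absurd ⟨j, hk⟩ h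
    · refine ⟨j + 1, ?_⟩
      rw [← hk, show 2 * (j + 1) = 1 + (2 * j + 1) by ring, _root_.zpow_one_add]
      simp [hk]

open Equiv Equiv.Perm in
/-- The even cycles of a fixed-point-free permutation can be split into transpositions, each
point still being sent to its image or its preimage. -/
theorem exists_perm_split_even_cycles {α : Type*} [Fintype α] [DecidableEq α] (σ : Perm α)
    (hσ : ∀ i, σ i ≠ i) :
    ∃ τ : Perm α, (∀ i, τ i = σ i ∨ τ i = σ.symm i) ∧
      ∀ i, (τ.cycleOf i).support.card = 2 ∨ Odd (τ.cycleOf i).support.card := by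
  classical
  obtain ⟨E, hE⟩ := exists_alternating_of_even_cycle σ hσ
  let P : α → Prop := fun y => Even (σ.cycleOf y).support.card
  have hP : ∀ y, P (σ y) ↔ P y := fun y => by
    simp only [P]
    rw [(show SameCycle σ (σ y) y from (SameCycle.refl σ y).apply_left).cycleOf_eq]
  have hP' : ∀ y, P (σ.symm y) ↔ P y := fun y => by
    rw [← hP, apply_symm_apply]
  have hE' : ∀ y, P y → (E (σ.symm y) ↔ ¬ E y) := fun y hy => by
    have := hE (σ.symm y) ((hP' y).2 hy)
    rw [apply_symm_apply] at this
    tauto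
  let f : α → α := fun y => if P y ∧ ¬ E y then σ.symm y else σ y
  have hf : ∀ y, f y = if P y ∧ ¬ E y then σ.symm y else σ y := fun _ => rfl
  have mixed : ∀ a b, ¬ (P a ∧ ¬ E a) → (P b ∧ ¬ E b) → σ a ≠ σ.symm b := by
    intro a b ha hb h
    have h1 := hP a
    have h2 := hP' b
    have h3 := hE' b hb.1
    have h4 := hE a
    rw [h] at h1 h4
    simp only [P] at *
    tauto
  have hinj : Function.Injective f := by
    intro a b hab
    rw [hf, hf] at hab
    split_ifs at hab with ha hb hb
    · exact σ.symm.injective hab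
    · exact absurd hab.symm (mixed b a hb ha)
    · exact absurd hab (mixed a b ha hb)
    · exact σ.injective hab
  let τ : Perm α := Equiv.ofBijective f (Finite.injective_iff_bijective.1 hinj)
  have hτ : ∀ y, τ y = if P y ∧ ¬ E y then σ.symm y else σ y := fun _ => rfl
  have hτσ : ∀ i, τ i = σ i ∨ τ i = σ.symm i := fun i => by
    rw [hτ]; split_ifs <;> simp
  have hne : ∀ i, τ i ≠ i := fun i h => by
    rcases hτσ i with h' | h' <;> rw [h'] at h
    · exact hσ i h
    · exact hσ i (by rw [symm_apply_eq] at h; exact h.symm)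
  refine ⟨τ, hτσ, fun i => ?_⟩
  by_cases hi : P i
  · left
    have hττ : τ (τ i) = i := by
      by_cases hEi : E i
      · have h1 : τ i = σ i := by rw [hτ, if_neg (by tauto)]
        have h2 : ¬ E (σ i) := fun h => (hE i hi).1 h hEi
        rw [h1, hτ, if_pos ⟨(hP i).2 hi, h2⟩, symm_apply_apply]
      · have h1 : τ i = σ.symm i := by rw [hτ, if_pos ⟨hi, hEi⟩]
        have h2 : E (σ.symm i) := (hE' i hi).2 hEi
        rw [h1, hτ, if_neg (by tauto), apply_symm_apply]
    have hmem : i ∈ (τ.cycleOf i).support :=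
      mem_support_cycleOf_iff.2 ⟨SameCycle.refl τ i, mem_support.2 (hne i)⟩
    have hdvd := ((isCycleOn_support_cycleOf τ i).pow_apply_eq hmem (n := 2)).1
      (by rw [pow_two]; exact hττ)
    have h2 : 2 ≤ (τ.cycleOf i).support.card :=
      ((isCycle_cycleOf τ (hne i)).two_le_card_support)
    exact le_antisymm (Nat.le_of_dvd two_pos hdvd) h2
  · right
    have hPk : ∀ k : ℕ, ¬ P ((σ ^ k) i) ∧ (τ ^ k) i = (σ ^ k) i := by
      intro k
      induction k with
      | zero => exact ⟨hi, rfl⟩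
      | succ k ih =>
        rw [pow_succ', pow_succ', mul_apply, mul_apply, ih.2, hP, hτ, if_neg (by tauto)]
        exact ⟨ih.1, rfl⟩
    have hsupp : (τ.cycleOf i).support = (σ.cycleOf i).support := by
      ext z
      rw [mem_support_cycleOf_iff, mem_support_cycleOf_iff, mem_support, mem_support]
      have : SameCycle τ i z ↔ SameCycle σ i z := by
        constructor
        · intro h
          obtain ⟨k, hk⟩ := h.exists_nat_pow_eq
          exact ⟨k, by rw [zpow_natCast, ← (hPk k).2, hk]⟩
        · intro h
          obtain ⟨k, hk⟩ := h.exists_nat_pow_eq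
          exact ⟨k, by rw [zpow_natCast, (hPk k).2, hk]⟩
      simp [this, hne, hσ]
    rw [hsupp]
    exact Nat.not_even_iff_odd.1 hi

/-- A matrix with nonzero determinant has a permutation along which no entry vanishes. -/
theorem exists_perm_forall_ne_zero_of_det_ne_zero {α R : Type*} [Fintype α] [DecidableEq α]
    [CommRing R] {A : Matrix α α R} (hA : A.det ≠ 0) :
    ∃ σ : Equiv.Perm α, ∀ i, A (σ i) i ≠ 0 := by
  rw [Matrix.det_apply] at hA
  obtain ⟨σ, -, hσ⟩ := Finset.exists_ne_zero_of_sum_ne_zero hA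
  refine ⟨σ, fun i hi => hσ ?_⟩
  rw [Finset.prod_eq_zero (f := fun i => A (σ i) i) (Finset.mem_univ i) hi, smul_zero]

/-- if `G` is determinantal (some zero-diagonal symmetric matrix supported on
`G` has nonzero determinant), then `G` has a vertex-disjoint cover by edges and odd cycles:
a fixed-point-free permutation `σ` of the vertices with `(i, σ i)` an edge for all `i`, all
of whose cycles have length `2` or odd length. -/
theorem determinantal_has_cycle_cover {n : ℕ} (G : SimpleGraph (Fin n))
    (hdet : ∃ A : Matrix (Fin n) (Fin n) ℝ,
      A.IsSymm ∧ SupportedOn G A ∧ (∀ i, A i i = 0) ∧ A.det ≠ 0) :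
    ∃ σ : Equiv.Perm (Fin n), (∀ i, σ i ≠ i) ∧ (∀ i, G.Adj i (σ i)) ∧
      ∀ i, (σ.cycleOf i).support.card = 2 ∨ Odd (σ.cycleOf i).support.card := by
  obtain ⟨A, -, hG, hdiag, hA⟩ := hdet
  obtain ⟨σ, hσ⟩ := exists_perm_forall_ne_zero_of_det_ne_zero hA
  have hfix : ∀ i, σ i ≠ i := fun i h => hσ i (by rw [h]; exact hdiag i)
  have hadj : ∀ i, G.Adj (σ i) i := fun i => by
    by_contra h
    exact hσ i (hG _ _ (hfix i) h)
  obtain ⟨τ, hτσ, hτ⟩ := exists_perm_split_even_cycles σ hfix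
  have hτadj : ∀ i, G.Adj i (τ i) := fun i => by
    rcases hτσ i with h | h <;> rw [h]
    · exact (hadj i).symm
    · simpa using hadj (σ.symm i)
  exact ⟨τ, fun i => (hτadj i).ne', hτadj, hτ⟩
end

section
/- Let G be a simple connected graph on n vertices and suppose there exists A ∈ S_0(G) with det(A) ≠ 0 (G is determinantal). Then there exists a matrix A' ∈ S_0(G) that satisfies the Nodal Count Condition: A' is strictly supported on G, all of its eigenvalues are simple, and all of its eigenvectors are nowhere-vanishing. -/
open Matrix

open MvPolynomial IntermediateField.algebraAdjoinAdjoin in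
/-- In characteristic zero, the values of a derivation may be prescribed freely on a
transcendence basis. -/
theorem IsTranscendenceBasis.exists_derivation {K L ι : Type*} [Field K] [Field L] [Algebra K L]
    [CharZero K] {x : ι → L} (hx : IsTranscendenceBasis K x) (c : ι → L) :
    ∃ D : Derivation K L L, ∀ i, D (x i) = c i := by
  let B := Algebra.adjoin K (Set.range x)
  let F := IntermediateField.adjoin K (Set.range x)
  let e : MvPolynomial ι K ≃ₐ[K] B := hx.1.aevalEquiv
  let : Algebra (MvPolynomial ι K) L := (aeval x).toAlgebra
  have : IsScalarTower K (MvPolynomial ι K) L := IsScalarTower.of_algHom (aeval x)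
  let D₀ : Derivation K (MvPolynomial ι K) L := mkDerivation K c
  have smul_e (b : B) (y : L) : e.symm b • y = b • y := by
    have : aeval x (e.symm b) = (b : L) := by
      rw [← hx.1.algebraMap_aevalEquiv]
      exact congrArg _ (e.apply_symm_apply b)
    rw [Algebra.smul_def, Algebra.smul_def]
    exact congrArg (· * y) this
  let D₁ : Derivation K B L :=
    Derivation.mk' (D₀.toLinearMap ∘ₗ e.symm.toLinearMap) fun a b => by
      change D₀ (e.symm (a * b)) = a • D₀ (e.symm b) + b • D₀ (e.symm a)
      rw [map_mul, D₀.leibniz, smul_e, smul_e]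
  have : Algebra.FormallyEtale B F := .of_isLocalization (nonZeroDivisors _)
  have : Algebra.IsAlgebraic F L := hx.isAlgebraic_field
  have : Algebra.FormallyEtale F L := .of_isSeparable F L
  have : Algebra.FormallyEtale B L := .comp B F L
  let T := KaehlerDifferential.tensorKaehlerEquivOfFormallyEtale K B L
  let D : Derivation K L L :=
    ((D₁.liftKaehlerDifferential.liftBaseChange L) ∘ₗ T.symm.toLinearMap).compDer
      (KaehlerDifferential.D K L)
  have hD (b : B) : D (b : L) = D₁ b := by
    change D₁.liftKaehlerDifferential.liftBaseChange L
      (T.symm (KaehlerDifferential.D K L (algebraMap B L b))) = D₁ b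
    rw [KaehlerDifferential.tensorKaehlerEquivOfFormallyEtale_symm_D_algebraMap]
    simp
  refine ⟨D, fun i => ?_⟩
  have hi : e (X i) = (⟨x i, Algebra.subset_adjoin ⟨i, rfl⟩⟩ : B) := by
    ext
    exact (hx.1.algebraMap_aevalEquiv (X i)).trans (aeval_X x i)
  refine (hD ⟨x i, Algebra.subset_adjoin ⟨i, rfl⟩⟩).trans ?_
  rw [← hi]
  change D₀ (e.symm (e (X i))) = c i
  rw [e.symm_apply_apply]
  exact mkDerivation_X _ _ _

open Cardinal in
/-- A transcendence basis of `ℝ` over `ℚ` is infinite. -/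
theorem IsTranscendenceBasis.infinite_of_rat_real {ι : Type*} {x : ι → ℝ}
    (hx : IsTranscendenceBasis ℚ x) : Infinite ι := by
  by_contra h
  rw [not_infinite_iff_finite] at h
  have := hx.isAlgebraic
  have : Countable (Algebra.adjoin ℚ (Set.range x)) :=
    hx.1.aevalEquiv.toEquiv.countable_iff.1 <| by
      rw [← mk_le_aleph0_iff]
      exact MvPolynomial.cardinalMk_le_max_lift.trans (by simp)
  have h1 := Algebra.IsAlgebraic.cardinalMk_le_max (Algebra.adjoin ℚ (Set.range x)) ℝ
  rw [mk_real, max_eq_right mk_le_aleph0] at h1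
  exact absurd h1 aleph0_lt_continuum.not_ge

/-- A real zero-diagonal symmetric matrix supported on `G` whose entries behave, with respect to
derivations of `ℝ`, as independent variables indexed by the edges of `G`. -/
structure IsDifferentiallyGeneric {n : ℕ} (G : SimpleGraph (Fin n))
    (A : Matrix (Fin n) (Fin n) ℝ) : Prop where
  isSymm : A.IsSymm
  eq_zero : ∀ i j, ¬ G.Adj i j → A i j = 0
  exists_derivation : ∀ i j, G.Adj i j → ∃ D : Derivation ℚ ℝ ℝ,
    ∀ a b, D (A a b) = if s(a, b) = s(i, j) then 1 else 0

/-- `v` is supported on `T`, and its restriction to `T` satisfies the eigenvector equation for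
the principal submatrix of `A` on `T` and the eigenvalue `μ`. -/
def IsSubEigenvector {n : ℕ} (A : Matrix (Fin n) (Fin n) ℝ) (μ : ℝ) (T : Set (Fin n))
    (v : Fin n → ℝ) : Prop :=
  (∀ s ∉ T, v s = 0) ∧ ∀ s ∈ T, ∑ t, A s t * v t = μ * v s

namespace IsSubEigenvector

variable {n : ℕ} {A : Matrix (Fin n) (Fin n) ℝ} {μ : ℝ} {T : Set (Fin n)} {u v : Fin n → ℝ}

theorem lin_comb (hu : IsSubEigenvector A μ T u) (hv : IsSubEigenvector A μ T v) (a b : ℝ) :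
    IsSubEigenvector A μ T (fun s => a * u s - b * v s) := by
  refine ⟨fun s hs => by simp [hu.1 s hs, hv.1 s hs], fun s hs => ?_⟩
  calc ∑ t, A s t * (a * u t - b * v t)
      = a * ∑ t, A s t * u t - b * ∑ t, A s t * v t := by
        rw [Finset.mul_sum, Finset.mul_sum, ← Finset.sum_sub_distrib]
        exact Finset.sum_congr rfl fun t _ => by ring
    _ = μ * (a * u s - b * v s) := by rw [hu.2 s hs, hv.2 s hs]; ring

theorem sum_mul_apply (hu : IsSubEigenvector A μ T u) (hv : ∀ s ∉ T, v s = 0) :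
    ∑ s, v s * ∑ t, A s t * u t = μ * ∑ s, v s * u s := by
  rw [Finset.mul_sum]
  refine Finset.sum_congr rfl fun s _ => ?_
  by_cases hs : s ∈ T
  · rw [hu.2 s hs]; ring
  · simp [hv s hs]

/-- First-order perturbation formula. -/
theorem derivation_pairing (hA : A.IsSymm) (hu : IsSubEigenvector A μ T u)
    (hv : IsSubEigenvector A μ T v) (D : Derivation ℚ ℝ ℝ) :
    ∑ s, u s * ∑ t, D (A s t) * v t = D μ * ∑ s, u s * v s := by
  have hDv : ∀ s ∉ T, D (v s) = 0 := fun s hs => by simp [hv.1 s hs]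
  have h1 : ∑ s, u s * D (∑ t, A s t * v t) = ∑ s, u s * D (μ * v s) := by
    refine Finset.sum_congr rfl fun s _ => ?_
    by_cases hs : s ∈ T
    · rw [hv.2 s hs]
    · simp [hu.1 s hs]
  have h2 : ∑ s, u s * ∑ t, A s t * D (v t) = μ * ∑ s, u s * D (v s) := by
    have := hu.sum_mul_apply hDv
    simp only [Finset.mul_sum] at this ⊢
    rw [Finset.sum_comm] at this
    convert this using 2 with s _ s _
    · refine Finset.sum_congr rfl fun t _ => ?_
      rw [hA.apply]; ring
    · ring
  have h3 : ∑ s, u s * D (∑ t, A s t * v t) =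
      ∑ s, u s * ∑ t, A s t * D (v t) + ∑ s, u s * ∑ t, D (A s t) * v t := by
    rw [← Finset.sum_add_distrib]
    refine Finset.sum_congr rfl fun s _ => ?_
    rw [map_sum, ← mul_add, ← Finset.sum_add_distrib]
    refine congrArg _ (Finset.sum_congr rfl fun t _ => ?_)
    rw [D.leibniz, smul_eq_mul, smul_eq_mul]; ring
  have h4 : ∑ s, u s * D (μ * v s) = μ * ∑ s, u s * D (v s) + D μ * ∑ s, u s * v s := by
    rw [Finset.mul_sum, Finset.mul_sum, ← Finset.sum_add_distrib]
    refine Finset.sum_congr rfl fun s _ => ?_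
    rw [D.leibniz, smul_eq_mul, smul_eq_mul]; ring
  linarith

end IsSubEigenvector

namespace IsDifferentiallyGeneric

variable {n : ℕ} {G : SimpleGraph (Fin n)} {A : Matrix (Fin n) (Fin n) ℝ} {μ : ℝ}
  {T : Set (Fin n)} {u v : Fin n → ℝ}

/-- The action on `v` of the adjacency matrix of the single edge `s(i, j)`. -/
theorem sum_edge_mul {i j : Fin n} (hij : i ≠ j) (v : Fin n → ℝ) (s : Fin n) :
    ∑ t, (if s(s, t) = s(i, j) then (1 : ℝ) else 0) * v t =
      (if s = i then v j else 0) + (if s = j then v i else 0) := by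
  have (t : Fin n) : (if s(s, t) = s(i, j) then (1 : ℝ) else 0) * v t =
      (if t = j then (if s = i then v j else 0) else 0) +
        (if t = i then (if s = j then v i else 0) else 0) := by
    simp only [Sym2.eq_iff]
    grind
  simp only [this, Finset.sum_add_distrib, Finset.sum_ite_eq',
    Finset.mem_univ, if_true]

theorem sum_mul_sum_edge_mul {i j : Fin n} (hij : i ≠ j) (u v : Fin n → ℝ) :
    ∑ s, u s * ∑ t, (if s(s, t) = s(i, j) then (1 : ℝ) else 0) * v t =
      u i * v j + u j * v i := by
  simp only [sum_edge_mul hij, mul_add, Finset.sum_add_distrib, mul_ite, mul_zero,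
    Finset.sum_ite_eq', Finset.mem_univ, if_true]

/-- Nonzero eigenvalues of principal submatrices are simple. -/
theorem eq_mul_of_isSubEigenvector (hA : IsDifferentiallyGeneric G A) (hμ : μ ≠ 0)
    (hu : IsSubEigenvector A μ T u) (hv : IsSubEigenvector A μ T v) (hu0 : u ≠ 0) :
    ∃ c : ℝ, ∀ s, v s = c * u s := by
  obtain ⟨i, hi⟩ := Function.ne_iff.1 hu0
  simp only [Pi.zero_apply] at hi
  by_contra! hne
  obtain ⟨k, hk⟩ := hne (v i / u i)
  let w : Fin n → ℝ := fun s => u i * v s - v i * u s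
  have hw : IsSubEigenvector A μ T w := hv.lin_comb hu _ _
  have hwi : w i = 0 := by simp only [w]; ring
  have hwk : w k ≠ 0 := fun h => hk <| by
    simp only [w] at h
    field_simp
    linarith
  have pos {f : Fin n → ℝ} (s : Fin n) (hs : f s ≠ 0) : ∑ s, f s * f s ≠ 0 :=
    (Finset.sum_pos' (fun s _ => mul_self_nonneg _)
      ⟨s, Finset.mem_univ _, mul_self_pos.2 hs⟩).ne'
  have edge (a b : Fin n) (hab : G.Adj a b) : u a * u b = 0 := by
    obtain ⟨D, hD⟩ := hA.exists_derivation a b hab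
    have pair {f : Fin n → ℝ} (hf : IsSubEigenvector A μ T f) :
        f a * f b + f b * f a = D μ * ∑ s, f s * f s := by
      rw [← hf.derivation_pairing hA.isSymm hf D, ← sum_mul_sum_edge_mul hab.ne]
      simp only [hD]
    obtain ⟨f, hf, hfa, s, hs⟩ : ∃ f, IsSubEigenvector A μ T f ∧ f a = 0 ∧ ∃ s, f s ≠ 0 := by
      by_cases hwa : w a = 0
      · exact ⟨w, hw, hwa, k, hwk⟩
      · exact ⟨_, hu.lin_comb hw (w a) (u a), by ring, i, by simp [hwi, hwa, hi]⟩
    have hDμ : D μ = 0 := by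
      have := pair hf
      rw [hfa] at this
      simpa [pos s hs] using this
    have := pair hu
    rw [hDμ] at this
    linarith
  refine mul_ne_zero hμ (pos i hi) ?_
  rw [← hu.sum_mul_apply hu.1]
  refine Finset.sum_eq_zero fun s _ => ?_
  rw [Finset.mul_sum]
  refine Finset.sum_eq_zero fun t _ => ?_
  by_cases hst : G.Adj s t
  · rw [mul_left_comm, edge s t hst, mul_zero]
  · simp [hA.eq_zero s t hst]

/-- On a connected graph, eigenvectors for nonzero eigenvalues vanish nowhere. -/
theorem eigenvector_ne_zero (hA : IsDifferentiallyGeneric G A) (hG : G.Connected) (hμ : μ ≠ 0)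
    (hu : IsSubEigenvector A μ Set.univ u) (hu0 : u ≠ 0) (i : Fin n) : u i ≠ 0 := by
  intro hi
  obtain ⟨k, hk⟩ := Function.ne_iff.1 hu0
  obtain ⟨p⟩ := hG.preconnected i k
  obtain ⟨d, -, ha, hb⟩ := p.exists_boundary_dart {s | u s = 0} hi hk
  obtain ⟨⟨a, b⟩, hab⟩ := d
  simp only [Set.mem_ofPred_eq] at ha hb
  obtain ⟨D, hD⟩ := hA.exists_derivation a b hab
  have hDμ : D μ = 0 := by
    have h := hu.derivation_pairing hA.isSymm hu D
    simp only [hD] at h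
    rw [sum_mul_sum_edge_mul hab.ne, ha] at h
    have : ∑ s, u s * u s ≠ 0 := (Finset.sum_pos' (fun s _ => mul_self_nonneg _)
      ⟨b, Finset.mem_univ _, mul_self_pos.2 hb⟩).ne'
    simpa [this] using h
  have key (s : Fin n) : ∑ t, A s t * D (u t) + (if s = a then u b else 0) = μ * D (u s) := by
    have h := congrArg D (hu.2 s trivial)
    have he := sum_edge_mul hab.ne u s
    rw [ha, ite_self, add_zero] at he
    simp only [map_sum, D.leibniz, smul_eq_mul, Finset.sum_add_distrib, hDμ, mul_zero,
      add_zero, hD] at h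
    rw [← h, ← he]
    exact congrArg _ (Finset.sum_congr rfl fun t _ => mul_comm _ _)
  have hu' : IsSubEigenvector A μ {s | u s ≠ 0} u :=
    ⟨fun s hs => by simpa using hs, fun s _ => hu.2 s trivial⟩
  have hv' : IsSubEigenvector A μ {s | u s ≠ 0} (fun s => D (u s)) := by
    refine ⟨fun s hs => ?_, fun s hs => ?_⟩
    · have : u s = 0 := by simpa using hs
      simp [this]
    · have hsa : s ≠ a := by rintro rfl; exact hs ha
      simpa [hsa] using key s
  obtain ⟨c, hc⟩ := hA.eq_mul_of_isSubEigenvector hμ hu' hv' hu0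
  have h := key a
  have hsum : ∑ t, A a t * (c * u t) = c * ∑ t, A a t * u t := by
    rw [Finset.mul_sum]
    exact Finset.sum_congr rfl fun t _ => by ring
  simp only [hc, hsum, hu.2 a trivial, ha] at h
  simp at h
  exact hb h

end IsDifferentiallyGeneric

open MvPolynomial in
/-- The entries on the edges of `G` may be taken algebraically independent over `ℚ`. -/
theorem exists_isDifferentiallyGeneric {n : ℕ} (G : SimpleGraph (Fin n))
    (hdet : ∃ A : Matrix (Fin n) (Fin n) ℝ,
      A.IsSymm ∧ SupportedOn G A ∧ (∀ i, A i i = 0) ∧ A.det ≠ 0) :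
    ∃ A : Matrix (Fin n) (Fin n) ℝ, IsDifferentiallyGeneric G A ∧ A.det ≠ 0 := by
  classical
  obtain ⟨A₀, hsymm, hsupp, hdiag, hdet⟩ := hdet
  obtain ⟨ι, x, hx⟩ := exists_isTranscendenceBasis' ℚ ℝ
  have := hx.infinite_of_rat_real
  obtain ⟨f⟩ : Nonempty (Sym2 (Fin n) ↪ ι) :=
    ⟨(Finite.equivFin _).toEmbedding.trans (Fin.valEmbedding.trans (Infinite.natEmbedding ι))⟩
  let M : Matrix (Fin n) (Fin n) (MvPolynomial (Sym2 (Fin n)) ℚ) :=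
    .of fun i j => if G.Adj i j then X s(i, j) else 0
  let w : Sym2 (Fin n) → ℝ := fun e => x (f e)
  have hw : AlgebraicIndependent ℚ w := hx.1.comp f f.injective
  let w₀ : Sym2 (Fin n) → ℝ := Sym2.lift ⟨fun i j => A₀ i j, fun i j => hsymm.apply j i⟩
  have hM : M.det ≠ 0 := by
    intro h
    have h0 := (aeval w₀).map_det M
    rw [h, map_zero] at h0
    refine hdet ?_
    rw [h0]
    congr 1
    ext i j
    by_cases hij : G.Adj i j
    · simp [M, hij, w₀]
    · by_cases hne : i = j
      · subst hne
        simp [M, hdiag]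
      · simp [M, hij, hsupp i j hne hij]
  have hA (i j : Fin n) : (aeval w).mapMatrix M i j = if G.Adj i j then w s(i, j) else 0 := by
    by_cases hij : G.Adj i j <;> simp [M, hij]
  refine ⟨(aeval w).mapMatrix M, ⟨?_, ?_, ?_⟩, ?_⟩
  · ext i j
    rw [Matrix.transpose_apply, hA, hA, G.adj_comm, Sym2.eq_swap]
  · intro i j hij
    rw [hA, if_neg hij]
  · intro i j hij
    obtain ⟨D, hD⟩ := hx.exists_derivation (Pi.single (f s(i, j)) 1)
    refine ⟨D, fun a b => ?_⟩
    rw [hA]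
    by_cases hab : G.Adj a b
    · rw [if_pos hab, hD, Pi.single_apply]
      simp only [f.injective.eq_iff]
    · rw [if_neg hab, map_zero, if_neg]
      intro h
      rw [← SimpleGraph.mem_edgeSet, h, SimpleGraph.mem_edgeSet] at hab
      exact hab hij
  · rw [← AlgHom.map_det]
    exact fun h => hM (hw (h.trans (map_zero _).symm))

/-- if `G` is connected and determinantal (some zero-diagonal symmetric matrix
supported on `G` has nonzero determinant), then there exists a zero-diagonal symmetric matrix
`A'` strictly supported on `G` satisfying the Nodal Count Condition: all eigenvalues simple
and all eigenvectors nowhere-vanishing. -/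
theorem determinantal_exists_NCC_matrix {n : ℕ} (G : SimpleGraph (Fin n)) (hG : G.Connected)
    (hdet : ∃ A : Matrix (Fin n) (Fin n) ℝ,
      A.IsSymm ∧ SupportedOn G A ∧ (∀ i, A i i = 0) ∧ A.det ≠ 0) :
    ∃ (A' : Matrix (Fin n) (Fin n) ℝ) (lam : Fin n → ℝ) (φ : Fin n → Fin n → ℝ),
      A'.IsSymm ∧ (∀ i, A' i i = 0) ∧
      SupportedOn G A' ∧ (∀ i j, G.Adj i j → A' i j ≠ 0) ∧
      StrictMono lam ∧ (∀ k, A'.mulVec (φ k) = lam k • φ k) ∧ (∀ k i, φ k i ≠ 0) := by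
  obtain ⟨A, hA, hAdet⟩ := exists_isDifferentiallyGeneric G hdet
  have hH : A.IsHermitian := by
    rw [Matrix.IsHermitian, Matrix.conjTranspose_eq_transpose_of_trivial]
    exact hA.isSymm
  let v : Fin n → Fin n → ℝ := fun k => ⇑(hH.eigenvectorBasis k)
  have hv (k : Fin n) : A.mulVec (v k) = hH.eigenvalues k • v k := hH.mulVec_eigenvectorBasis k
  have hsub (k : Fin n) : IsSubEigenvector A (hH.eigenvalues k) Set.univ (v k) :=
    ⟨fun s hs => absurd trivial hs, fun s _ => congrFun (hv k) s⟩
  have hv0 (k : Fin n) : v k ≠ 0 := fun h =>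
    hH.eigenvectorBasis.toBasis.ne_zero k <| by
      rw [OrthonormalBasis.coe_toBasis]
      ext s
      exact congrFun h s
  have hμ (k : Fin n) : hH.eigenvalues k ≠ 0 := fun h => hAdet <| by
    rw [hH.det_eq_prod_eigenvalues]
    exact Finset.prod_eq_zero (Finset.mem_univ k) (by simp [h])
  have hinj : Function.Injective hH.eigenvalues := by
    intro j k hjk
    by_contra hne
    have hk := hsub k
    rw [← hjk] at hk
    obtain ⟨c, hc⟩ := hA.eq_mul_of_isSubEigenvector (hμ j) (hsub j) hk (hv0 j)
    have horth := hH.eigenvectorBasis.inner_eq_zero hne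
    have hkc : hH.eigenvectorBasis k = c • hH.eigenvectorBasis j := by
      ext s
      exact hc s
    rw [hkc, inner_smul_right, hH.eigenvectorBasis.inner_eq_one, mul_one] at horth
    refine hv0 k (funext fun s => ?_)
    simp [hc s, horth]
  let S : Finset ℝ := Finset.univ.image hH.eigenvalues
  have hS : S.card = n := by
    rw [Finset.card_image_of_injective _ hinj, Finset.card_univ, Fintype.card_fin]
  have hex (k : Fin n) : ∃ j, hH.eigenvalues j = S.orderEmbOfFin hS k := by
    obtain ⟨j, -, hj⟩ := Finset.mem_image.1 (S.orderEmbOfFin_mem hS k)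
    exact ⟨j, hj⟩
  choose σ hσ using hex
  refine ⟨A, S.orderEmbOfFin hS, fun k => v (σ k), hA.isSymm, fun i => hA.eq_zero i i G.irrefl,
    fun i j _ hij => hA.eq_zero i j hij, fun i j hij h => ?_, (S.orderEmbOfFin hS).strictMono,
    fun k => by rw [← hσ]; exact hv _,
    fun k => hA.eigenvector_ne_zero hG (hμ _) (hsub _) (hv0 _)⟩
  obtain ⟨D, hD⟩ := hA.exists_derivation i j hij
  simpa [h] using hD i j
end

section
/- Let G be a simple connected graph on n vertices and let A ∈ S(G) be strictly supported on G with all entries nonnegative (A_{ij} ≥ 0 for all i,j and A_{ij} > 0 for every edge (ij)). Then there exists a finite set Λ ⊂ ℝ such that for every λ ∉ Λ, the matrix A − λI is invertible and every entry of (A − λI)^{-1} is nonzero. -/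
open Matrix

open Polynomial in
/-- If the resolvent of `A` exists and is entrywise nonzero at one point, the same holds outside
a finite set of points. -/
theorem exists_finset_resolvent_ne_zero {V K : Type*} [Fintype V] [DecidableEq V] [Field K]
    (A : Matrix V V K) (t : K) (hdet : (A - t • (1 : Matrix V V K)).det ≠ 0)
    (hinv : ∀ i j, (A - t • (1 : Matrix V V K))⁻¹ i j ≠ 0) :
    ∃ Λ : Finset K, ∀ lam : K, lam ∉ Λ →
      IsUnit (A - lam • (1 : Matrix V V K)) ∧
      ∀ i j, (A - lam • (1 : Matrix V V K))⁻¹ i j ≠ 0 := by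
  classical
  let M : Matrix V V K[X] := A.map C - (X : K[X]) • (1 : Matrix V V K[X])
  have hM (x : K) : (evalRingHom x).mapMatrix M = A - x • (1 : Matrix V V K) := by
    ext i j
    by_cases h : i = j <;> simp [M, h]
  have hMdet (x : K) : M.det.eval x = (A - x • (1 : Matrix V V K)).det := by
    rw [← hM x, ← RingHom.map_det, coe_evalRingHom]
  have hMadj (x : K) (i j : V) :
      (M.adjugate i j).eval x = (A - x • (1 : Matrix V V K)).adjugate i j := by
    rw [← hM x, ← RingHom.map_adjugate]
    rfl
  have hentry (x : K) (i j : V) : (A - x • (1 : Matrix V V K))⁻¹ i j =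
      (M.det.eval x)⁻¹ * (M.adjugate i j).eval x := by
    rw [hMadj, hMdet, Matrix.inv_def, Ring.inverse_eq_inv', Matrix.smul_apply, smul_eq_mul]
  let p : K[X] := M.det * ∏ i, ∏ j, M.adjugate i j
  have hp : p ≠ 0 := by
    refine mul_ne_zero (fun h => hdet ?_)
      (Finset.prod_ne_zero_iff.2 fun i _ => Finset.prod_ne_zero_iff.2 fun j _ h => hinv i j ?_)
    · rw [← hMdet, h, eval_zero]
    · rw [hentry, h, eval_zero, mul_zero]
  refine ⟨p.roots.toFinset, fun x hx => ?_⟩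
  have hpx : p.eval x ≠ 0 := fun h => hx (by simpa [hp] using h)
  rw [eval_mul, mul_ne_zero_iff, eval_prod, Finset.prod_ne_zero_iff] at hpx
  refine ⟨(Matrix.isUnit_iff_isUnit_det _).2 (hMdet x ▸ hpx.1.isUnit), fun i j => ?_⟩
  have hi := hpx.2 i (Finset.mem_univ i)
  rw [eval_prod, Finset.prod_ne_zero_iff] at hi
  rw [hentry]
  exact mul_ne_zero (inv_ne_zero hpx.1) (hi j (Finset.mem_univ j))

/-- Minimum principle: if `A` is nonnegative and `t` exceeds all its row sums, then
`A v ≤ t v` forces `v ≥ 0`. -/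
theorem nonneg_of_mulVec_le_smul {V : Type*} [Fintype V] {A : Matrix V V ℝ}
    (hnn : ∀ i j, 0 ≤ A i j) {t : ℝ} (ht : ∀ i, ∑ j, A i j < t) {v : V → ℝ}
    (hv : ∀ i, (A *ᵥ v) i ≤ t * v i) (i : V) : 0 ≤ v i := by
  have : Nonempty V := ⟨i⟩
  obtain ⟨m, hm⟩ := Finite.exists_min v
  refine le_trans ?_ (hm i)
  have hsum : (∑ j, A m j) * v m ≤ (A *ᵥ v) m := by
    rw [Finset.sum_mul]
    exact Finset.sum_le_sum fun j _ => mul_le_mul_of_nonneg_left (hm j) (hnn m j)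
  nlinarith [hv m, ht m]

/-- Strong minimum principle: on a connected graph, a solution of `t v = A v + e_j` with `t`
larger than all row sums of the nonnegative matrix `A` has no zero entry. -/
theorem ne_zero_of_smul_eq_mulVec_add_single {V : Type*} [Fintype V] [DecidableEq V]
    {G : SimpleGraph V} (hG : G.Connected) {A : Matrix V V ℝ}
    (hstrict : ∀ i j, G.Adj i j → A i j ≠ 0) (hnn : ∀ i j, 0 ≤ A i j)
    {t : ℝ} (ht : ∀ i, ∑ j, A i j < t) {v : V → ℝ} {j : V}
    (hv : ∀ i, t * v i = (A *ᵥ v) i + (Pi.single j 1 : V → ℝ) i) (i : V) : v i ≠ 0 := by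
  have hsingle (k : V) : 0 ≤ (Pi.single j 1 : V → ℝ) k :=
    (Pi.single_nonneg.2 zero_le_one : (0 : V → ℝ) ≤ Pi.single j 1) k
  have hpos := nonneg_of_mulVec_le_smul hnn ht (v := v) fun k => by linarith [hv k, hsingle k]
  have hterm (k l : V) : 0 ≤ A k l * v l := mul_nonneg (hnn k l) (hpos l)
  have hAv (k : V) : 0 ≤ (A *ᵥ v) k := Finset.sum_nonneg fun l _ => hterm k l
  have hstep (k l : V) (hkl : G.Adj k l) (hk : v k = 0) : v l = 0 := by
    have hzero : ∑ l, A k l * v l = 0 := by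
      have h1 := hv k
      rw [hk, mul_zero] at h1
      exact le_antisymm (by change (A *ᵥ v) k ≤ 0; linarith [hsingle k]) (hAv k)
    have := (Finset.sum_eq_zero_iff_of_nonneg fun l _ => hterm k l).1 hzero l (Finset.mem_univ l)
    exact (mul_eq_zero.1 this).resolve_left (hstrict k l hkl)
  intro hi
  obtain ⟨w⟩ := hG.preconnected i j
  have hj : v j = 0 := by
    induction w with
    | nil => exact hi
    | cons hadj _ ih => exact ih hv hsingle (hstep _ _ hadj hi)
  have := hv j
  rw [hj, mul_zero, Pi.single_eq_same] at this
  linarith [hAv j]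

/-- if `G` is connected and `A ∈ S(G)` is a nonnegative symmetric matrix
strictly supported on `G`, then there is a finite set `Λ ⊂ ℝ` such that for every `λ ∉ Λ`
the matrix `A - λI` is invertible and every entry of `(A - λI)⁻¹` is nonzero. -/
theorem resolvent_entrywise_nonzero {n : ℕ} (G : SimpleGraph (Fin n)) (hG : G.Connected)
    (A : Matrix (Fin n) (Fin n) ℝ) (hA : A.IsSymm)
    (hsupp : SupportedOn G A) (hstrict : ∀ i j, G.Adj i j → A i j ≠ 0)
    (hnn : ∀ i j, 0 ≤ A i j) :
    ∃ Λ : Finset ℝ, ∀ lam : ℝ, lam ∉ Λ →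
      IsUnit (A - lam • (1 : Matrix (Fin n) (Fin n) ℝ)) ∧
      ∀ i j, (A - lam • (1 : Matrix (Fin n) (Fin n) ℝ))⁻¹ i j ≠ 0 := by
  obtain ⟨t, ht⟩ : ∃ t : ℝ, ∀ i, ∑ j, A i j < t := by
    obtain ⟨b, hb⟩ := Finite.bddAbove_range fun i => ∑ j, A i j
    exact ⟨b + 1, fun i => (hb ⟨i, rfl⟩).trans_lt (lt_add_one b)⟩
  have hmul (v : Fin n → ℝ) (i : Fin n) :
      ((A - t • (1 : Matrix (Fin n) (Fin n) ℝ)) *ᵥ v) i = (A *ᵥ v) i - t * v i := by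
    simp [Matrix.sub_mulVec, Matrix.smul_mulVec]
  have hdet : (A - t • (1 : Matrix (Fin n) (Fin n) ℝ)).det ≠ 0 := by
    intro h
    obtain ⟨v, hv0, hv⟩ := Matrix.exists_mulVec_eq_zero_iff.2 h
    have heq (i : Fin n) : (A *ᵥ v) i - t * v i = 0 := by rw [← hmul, hv, Pi.zero_apply]
    refine hv0 (funext fun i => le_antisymm ?_ ?_)
    · have := nonneg_of_mulVec_le_smul hnn ht (v := -v)
        (fun i => by simp only [Matrix.mulVec_neg, Pi.neg_apply]; linarith [heq i]) i
      simpa using this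
    · exact nonneg_of_mulVec_le_smul hnn ht (v := v) (fun i => by linarith [heq i]) i
  refine exists_finset_resolvent_ne_zero A t hdet fun i j => ?_
  set R := (A - t • (1 : Matrix (Fin n) (Fin n) ℝ))⁻¹ with hR
  have hcol : (A - t • (1 : Matrix (Fin n) (Fin n) ℝ)) *ᵥ R.col j = Pi.single j 1 := by
    rw [← Matrix.mulVec_single_one, Matrix.mulVec_mulVec, hR,
      Matrix.mul_nonsing_inv _ hdet.isUnit, Matrix.one_mulVec]
  have := ne_zero_of_smul_eq_mulVec_add_single hG hstrict hnn ht (v := -R.col j) (j := j)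
    (fun k => by
      rw [← hcol, hmul]
      simp only [Matrix.mulVec_neg, Pi.neg_apply]
      ring) i
  simpa using this
end

section
/- Let A be a real symmetric n×n matrix with r distinct eigenvalues of multiplicities m_1, …, m_r (so Σ_{i=1}^{r} m_i = n). Then the vector space {AX − XA : X real antisymmetric n×n} (the tangent space at A to the orthogonal-conjugation orbit of A) has dimension C(n,2) − Σ_{i=1}^{r} C(m_i,2). -/
open Matrix

/-- The submodule of real antisymmetric `n × n` matrices. -/
def skewSubmodule (n : ℕ) : Submodule ℝ (Matrix (Fin n) (Fin n) ℝ) where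
  carrier := {X | Xᵀ = -X}
  add_mem' := by
    intro X Y hX hY
    simp only [Set.mem_setOf_eq] at *
    rw [Matrix.transpose_add, hX, hY, neg_add]
  zero_mem' := by simp
  smul_mem' := by
    intro c X hX
    simp only [Set.mem_setOf_eq] at *
    rw [Matrix.transpose_smul, hX, smul_neg]

/-- The linear map `X ↦ A * X - X * A`. -/
def adA {n : ℕ} (A : Matrix (Fin n) (Fin n) ℝ) :
    Matrix (Fin n) (Fin n) ℝ →ₗ[ℝ] Matrix (Fin n) (Fin n) ℝ where
  toFun X := A * X - X * A
  map_add' X Y := by noncomm_ring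
  map_smul' c X := by
    simp [Matrix.mul_smul, Matrix.smul_mul, smul_sub]

/-- The spectral theorem for real symmetric matrices, in terms of an explicit orthogonal matrix. -/
lemma exists_orthogonal_diagonalization {n : Type*} [Fintype n] [DecidableEq n]
    {A : Matrix n n ℝ} (hA : A.IsSymm) :
    ∃ (U : Matrix n n ℝ) (d : n → ℝ), U * Uᵀ = 1 ∧ Uᵀ * U = 1 ∧ A = U * diagonal d * Uᵀ := by
  have hH : A.IsHermitian := by
    rw [Matrix.IsHermitian, conjTranspose_eq_transpose_of_trivial]
    exact hA
  refine ⟨hH.eigenvectorUnitary, hH.eigenvalues, ?_, ?_, ?_⟩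
  · simpa [star_eq_conjTranspose] using Unitary.coe_mul_star_self hH.eigenvectorUnitary
  · simpa [star_eq_conjTranspose] using Unitary.coe_star_mul_self hH.eigenvectorUnitary
  · have h := hH.spectral_theorem
    rw [Unitary.conjStarAlgAut_apply] at h
    simpa [star_eq_conjTranspose, Function.comp_def] using h

lemma finrank_ker_mulVecLin_sub_smul {n : Type*} [Fintype n] [DecidableEq n]
    {A U : Matrix n n ℝ} {d : n → ℝ} (hU : U * Uᵀ = 1) (hA : A = U * diagonal d * Uᵀ) (c : ℝ) :
    Module.finrank ℝ
      (LinearMap.ker (A.mulVecLin - c • (LinearMap.id : (n → ℝ) →ₗ[ℝ] n → ℝ)))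
      = (Finset.univ.filter fun j => d j = c).card := by
  have h1 : A.mulVecLin - c • (LinearMap.id : (n → ℝ) →ₗ[ℝ] n → ℝ)
      = (U * diagonal (fun j => d j - c) * Uᵀ).mulVecLin := by
    have h2 : diagonal (fun j => d j - c) = diagonal d - c • (1 : Matrix n n ℝ) := by
      rw [smul_one_eq_diagonal, diagonal_sub]
    rw [h2, mul_sub, sub_mul, ← hA, mul_smul_comm, mul_one, smul_mul_assoc, hU]
    ext v : 1
    simp
  have hdet : IsUnit U.det := isUnit_det_of_right_inverse hU
  have h3 : (U * diagonal (fun j => d j - c) * Uᵀ).rank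
      = Fintype.card {j // d j - c ≠ 0} := by
    rw [rank_mul_eq_left_of_isUnit_det _ _ (by rwa [det_transpose]),
      rank_mul_eq_right_of_isUnit_det _ _ hdet, rank_diagonal]
  have h4 := LinearMap.finrank_range_add_finrank_ker
    (U * diagonal (fun j => d j - c) * Uᵀ).mulVecLin
  rw [← Matrix.rank, h3, Module.finrank_fintype_fun_eq_card] at h4
  rw [h1]
  have h5 := Fintype.card_subtype_compl (fun j => d j = c)
  have h6 := Fintype.card_subtype_le (fun j => d j = c)
  have h7 : Fintype.card {j // d j - c ≠ 0} = Fintype.card {j // ¬ d j = c} :=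
    Fintype.card_congr (Equiv.subtypeEquivRight fun j => by rw [sub_ne_zero])
  rw [← Fintype.card_subtype]
  omega

lemma Finset.card_filter_lt_product_self {α : Type*} [LinearOrder α] (s : Finset α) :
    ((s ×ˢ s).filter fun p => p.1 < p.2).card = s.card.choose 2 := by
  induction s using Finset.induction_on_max with
  | empty => simp
  | insert a s ha ih =>
    have hna : a ∉ s := fun h => lt_irrefl _ (ha a h)
    have h : ((insert a s ×ˢ insert a s).filter fun p => p.1 < p.2)
        = ((s ×ˢ s).filter fun p => p.1 < p.2) ∪ s ×ˢ {a} := by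
      ext ⟨x, y⟩
      simp only [mem_filter, mem_product, mem_insert, mem_union, mem_singleton]
      constructor
      · rintro ⟨⟨rfl | hx, rfl | hy⟩, hxy⟩
        · exact absurd hxy (lt_irrefl _)
        · exact absurd hxy (ha y hy).asymm
        · exact Or.inr ⟨hx, rfl⟩
        · exact Or.inl ⟨⟨hx, hy⟩, hxy⟩
      · rintro (⟨⟨hx, hy⟩, hxy⟩ | ⟨hx, rfl⟩)
        · exact ⟨⟨Or.inr hx, Or.inr hy⟩, hxy⟩
        · exact ⟨⟨Or.inr hx, Or.inl rfl⟩, ha x hx⟩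
    have hdisj : Disjoint ((s ×ˢ s).filter fun p => p.1 < p.2) (s ×ˢ {a}) := by
      rw [disjoint_left]
      rintro ⟨x, y⟩ hxy hxa
      simp only [mem_filter, mem_product, mem_singleton] at hxy hxa
      exact hna (hxa.2 ▸ hxy.1.2)
    rw [h, card_union_of_disjoint hdisj, ih, card_product, card_singleton,
      card_insert_of_notMem hna, Nat.choose_succ_succ' s.card 1, Nat.choose_one_right, mul_one,
      add_comm]

lemma card_lt_pairs_ne {α β ι : Type*} [Fintype α] [LinearOrder α] [DecidableEq β] [Fintype ι]
    (d : α → β) {μ : ι → β} (hμ : Function.Injective μ)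
    (hsum : ∑ i, (Finset.univ.filter fun j => d j = μ i).card = Fintype.card α) :
    Fintype.card {p : α × α // p.1 < p.2 ∧ d p.1 ≠ d p.2}
      = (Fintype.card α).choose 2
        - ∑ i, ((Finset.univ.filter fun j => d j = μ i).card).choose 2 := by
  classical
  have hcover : ∀ j, ∃ i, d j = μ i := by
    have hdisj : ((Finset.univ : Finset ι) : Set ι).PairwiseDisjoint
        fun i => Finset.univ.filter fun j => d j = μ i := by
      intro i _ k _ hik
      rw [Function.onFun, Finset.disjoint_left]
      intro j hj hk
      simp only [Finset.mem_filter, Finset.mem_univ, true_and] at hj hk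
      exact hik (hμ (hj.symm.trans hk))
    rw [← Finset.card_biUnion hdisj, Finset.card_eq_iff_eq_univ] at hsum
    intro j
    have hj := Finset.mem_univ j
    rw [← hsum] at hj
    simpa using hj
  have heq : ((Finset.univ : Finset (α × α)).filter fun p => p.1 < p.2 ∧ d p.1 = d p.2).card
      = ∑ i, ((Finset.univ.filter fun j => d j = μ i).card).choose 2 := by
    simp_rw [← Finset.card_filter_lt_product_self]
    rw [← Finset.card_biUnion]
    · congr 1
      ext ⟨x, y⟩
      simp only [Finset.mem_filter, Finset.mem_univ, true_and, Finset.mem_biUnion,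
        Finset.mem_product]
      constructor
      · rintro ⟨hxy, h⟩
        obtain ⟨i, hi⟩ := hcover x
        exact ⟨i, ⟨hi, h ▸ hi⟩, hxy⟩
      · rintro ⟨i, ⟨hx, hy⟩, hxy⟩
        exact ⟨hxy, hx.trans hy.symm⟩
    · intro i _ k _ hik
      rw [Function.onFun, Finset.disjoint_left]
      intro p hp hq
      simp only [Finset.mem_filter, Finset.mem_univ, true_and, Finset.mem_product] at hp hq
      exact hik (hμ (hp.1.1.symm.trans hq.1.1))
  have hall := Finset.card_filter_lt_product_self (Finset.univ : Finset α)
  rw [Finset.univ_product_univ, Finset.card_univ,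
    ← Finset.card_filter_add_card_filter_not (fun p : α × α => d p.1 = d p.2),
    Finset.filter_filter, Finset.filter_filter, heq] at hall
  rw [Fintype.card_subtype]
  exact Nat.eq_sub_of_add_eq' hall

lemma commutator_diagonal_apply {n : Type*} [Fintype n] [DecidableEq n]
    (d : n → ℝ) (X : Matrix n n ℝ) (i j : n) :
    (diagonal d * X - X * diagonal d) i j = (d i - d j) * X i j := by
  rw [Matrix.sub_apply, diagonal_mul, mul_diagonal]
  ring

/-- Up to an orthogonal change of basis, the image of the antisymmetric matrices under `adA A` is
coordinatized by the entries above the diagonal that link distinct eigenvalues. -/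
lemma finrank_map_adA_skewSubmodule {n : ℕ} {A U : Matrix (Fin n) (Fin n) ℝ} {d : Fin n → ℝ}
    (hU : U * Uᵀ = 1) (hU' : Uᵀ * U = 1) (hA : A = U * diagonal d * Uᵀ) :
    Module.finrank ℝ (Submodule.map (adA A) (skewSubmodule n))
      = Fintype.card {p : Fin n × Fin n // p.1 < p.2 ∧ d p.1 ≠ d p.2} := by
  have hconj (X : Matrix (Fin n) (Fin n) ℝ) : Uᵀ * adA A X * U
      = diagonal d * (Uᵀ * X * U) - (Uᵀ * X * U) * diagonal d := by
    have h1 : Uᵀ * A = diagonal d * Uᵀ := by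
      rw [hA, mul_assoc, ← mul_assoc, hU', one_mul]
    have h2 : A * U = U * diagonal d := by
      rw [hA, mul_assoc, hU', mul_one]
    change Uᵀ * (A * X - X * A) * U = _
    calc Uᵀ * (A * X - X * A) * U = (Uᵀ * A) * X * U - Uᵀ * X * (A * U) := by noncomm_ring
      _ = _ := by rw [h1, h2]; noncomm_ring
  let E : Matrix (Fin n) (Fin n) ℝ →ₗ[ℝ]
      ({p : Fin n × Fin n // p.1 < p.2 ∧ d p.1 ≠ d p.2} → ℝ) :=
    { toFun := fun Y p => (Uᵀ * Y * U) p.1.1 p.1.2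
      map_add' := fun X Y => by ext p; simp [mul_add, add_mul]
      map_smul' := fun c X => by ext p; simp }
  have hE (X : Matrix (Fin n) (Fin n) ℝ) (p) : E (adA A X) p
      = (d p.1.1 - d p.1.2) * (Uᵀ * X * U) p.1.1 p.1.2 := by
    change (Uᵀ * adA A X * U) p.1.1 p.1.2 = _
    rw [hconj, commutator_diagonal_apply]
  have hbij : Function.Bijective (E.domRestrict (Submodule.map (adA A) (skewSubmodule n))) := by
    constructor
    · rw [injective_iff_map_eq_zero]
      rintro ⟨_, X, hX, rfl⟩ h0
      have hskew (i j) : (Uᵀ * X * U) j i = -(Uᵀ * X * U) i j := by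
        have hX' : Xᵀ = -X := hX
        have h : (Uᵀ * X * U)ᵀ = -(Uᵀ * X * U) := by
          simp [transpose_mul, hX', mul_assoc]
        exact congrFun₂ h i j
      have hlt (i j) (hij : i < j) (hd : d i ≠ d j) : (Uᵀ * X * U) i j = 0 := by
        have h := congrFun h0 ⟨(i, j), hij, hd⟩
        rw [LinearMap.domRestrict_apply, hE] at h
        exact (mul_eq_zero.mp h).resolve_left (sub_ne_zero.mpr hd)
      have hzero : Uᵀ * adA A X * U = 0 := by
        rw [hconj]
        ext i j
        rw [commutator_diagonal_apply, Matrix.zero_apply]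
        by_cases hd : d i = d j
        · rw [hd, sub_self, zero_mul]
        · rcases lt_trichotomy i j with hij | rfl | hij
          · rw [hlt i j hij hd, mul_zero]
          · exact absurd rfl hd
          · rw [hskew j i, hlt j i hij (Ne.symm hd), neg_zero, mul_zero]
      apply Subtype.ext
      calc adA A X = (U * Uᵀ) * adA A X * (U * Uᵀ) := by rw [hU, one_mul, mul_one]
        _ = U * (Uᵀ * adA A X * U) * Uᵀ := by simp only [mul_assoc]
        _ = 0 := by rw [hzero, mul_zero, zero_mul]
    · intro f
      let T : Matrix (Fin n) (Fin n) ℝ := fun i j =>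
        if h : i < j ∧ d i ≠ d j then f ⟨(i, j), h⟩ / (d i - d j) else 0
      let X := U * (T - Tᵀ) * Uᵀ
      have hX : X ∈ skewSubmodule n := by
        change Xᵀ = -X
        simp only [X, transpose_mul, transpose_sub, transpose_transpose]
        noncomm_ring
      refine ⟨⟨adA A X, X, hX, rfl⟩, ?_⟩
      ext ⟨⟨i, j⟩, hij, hd⟩
      have hXU : Uᵀ * X * U = T - Tᵀ := by
        calc Uᵀ * X * U = (Uᵀ * U) * (T - Tᵀ) * (Uᵀ * U) := by simp only [X, mul_assoc]
          _ = T - Tᵀ := by rw [hU', one_mul, mul_one]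
      rw [LinearMap.domRestrict_apply, hE, hXU, Matrix.sub_apply, transpose_apply]
      have h1 : T i j = f ⟨(i, j), hij, hd⟩ / (d i - d j) := dif_pos ⟨hij, hd⟩
      have h2 : T j i = 0 := dif_neg fun h => hij.asymm h.1
      rw [h1, h2, sub_zero, mul_div_cancel₀ _ (sub_ne_zero.mpr hd)]
  rw [(LinearEquiv.ofBijective _ hbij).finrank_eq, Module.finrank_fintype_fun_eq_card]

/-- if `A` is real symmetric with `r` distinct eigenvalues of multiplicities
`m 1, …, m r` summing to `n`, then the tangent space `{AX - XA : X antisymmetric}` of the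
orthogonal-conjugation orbit of `A` has dimension `C(n,2) - ∑ᵢ C(mᵢ,2)`. -/
theorem orbit_tangent_space_dimension {n r : ℕ} (A : Matrix (Fin n) (Fin n) ℝ)
    (hA : A.IsSymm) (μ : Fin r → ℝ) (hμ : Function.Injective μ) (m : Fin r → ℕ)
    (hm : ∀ i, Module.finrank ℝ
      (LinearMap.ker (A.mulVecLin - μ i • (LinearMap.id : (Fin n → ℝ) →ₗ[ℝ] Fin n → ℝ)))
      = m i)
    (hsum : ∑ i, m i = n) :
    Module.finrank ℝ (Submodule.map (adA A) (skewSubmodule n))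
      = n.choose 2 - ∑ i, (m i).choose 2 := by
  obtain ⟨U, d, hU, hU', hAd⟩ := exists_orthogonal_diagonalization hA
  have hcard (i) : (Finset.univ.filter fun j => d j = μ i).card = m i := by
    rw [← hm i, finrank_ker_mulVecLin_sub_smul hU hAd]
  rw [finrank_map_adA_skewSubmodule hU hU' hAd,
    card_lt_pairs_ne d hμ (by simp_rw [hcard, hsum, Fintype.card_fin])]
  simp_rw [hcard, Fintype.card_fin]
end

section
/- Let A be a real symmetric n×n matrix, let W be a vector subspace of the space S(n) of real symmetric n×n matrices with A ∈ W, and suppose the transversality condition {AX − XA : X real antisymmetric} + W = S(n) holds. Then for any orthonormal eigenbasis φ_1, …, φ_n of A with φ_k(i) ≠ 0 for all i,k, and any ε > 0, there exists A' ∈ W with ‖A' − A‖ < ε such that A' has simple eigenvalues and an orthonormal eigenbasis ψ_1, …, ψ_n with every ψ_k nowhere-vanishing, sign(ψ_k(i)) = sign(φ_k(i)) for all i,k, and sign(A'_{ij}) = sign(A_{ij}) for all pairs (ij) with A_{ij} ≠ 0. -/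
open Matrix

open Filter Topology

open scoped Matrix.Norms.Operator

/-- The submodule of skew-symmetric real matrices. -/
def skewSymmSubmodule (n : ℕ) : Submodule ℝ (Matrix (Fin n) (Fin n) ℝ) where
  carrier := {X | Xᵀ = -X}
  add_mem' {X Y} hX hY := by
    simp only [Set.mem_ofPred_eq] at *
    rw [transpose_add, hX, hY, neg_add]
  zero_mem' := by simp
  smul_mem' c X hX := by
    simp only [Set.mem_ofPred_eq] at *
    rw [transpose_smul, hX, smul_neg]

lemma mem_skewSymmSubmodule {n : ℕ} {X : Matrix (Fin n) (Fin n) ℝ} :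
    X ∈ skewSymmSubmodule n ↔ Xᵀ = -X := Iff.rfl

/-- Conjugation of a perturbation of `A` in `W` by the exponential of a skew-symmetric matrix,
plus a skew-symmetric error. -/
noncomputable def conjExpAdd {n : ℕ} (A : Matrix (Fin n) (Fin n) ℝ)
    (W : Submodule ℝ (Matrix (Fin n) (Fin n) ℝ))
    (p : skewSymmSubmodule n × W × skewSymmSubmodule n) : Matrix (Fin n) (Fin n) ℝ :=
  NormedSpace.exp (-(p.1 : Matrix (Fin n) (Fin n) ℝ)) * (A + p.2.1) *
    NormedSpace.exp (p.1 : Matrix (Fin n) (Fin n) ℝ) + p.2.2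

lemma hasStrictFDerivAt_conjExpAdd {n : ℕ} (A : Matrix (Fin n) (Fin n) ℝ)
    (W : Submodule ℝ (Matrix (Fin n) (Fin n) ℝ)) :
    ∃ L : (skewSymmSubmodule n × W × skewSymmSubmodule n) →L[ℝ] Matrix (Fin n) (Fin n) ℝ,
      HasStrictFDerivAt (conjExpAdd A W) L 0 ∧
      ∀ p, L p = (A * p.1 - p.1 * A) + p.2.1 + p.2.2 := by
  let X : skewSymmSubmodule n × W × skewSymmSubmodule n →L[ℝ] Matrix (Fin n) (Fin n) ℝ :=
    (skewSymmSubmodule n).subtypeL ∘L ContinuousLinearMap.fst ℝ _ _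
  let M : skewSymmSubmodule n × W × skewSymmSubmodule n →L[ℝ] Matrix (Fin n) (Fin n) ℝ :=
    W.subtypeL ∘L ContinuousLinearMap.fst ℝ _ _ ∘L ContinuousLinearMap.snd ℝ _ _
  let Y : skewSymmSubmodule n × W × skewSymmSubmodule n →L[ℝ] Matrix (Fin n) (Fin n) ℝ :=
    (skewSymmSubmodule n).subtypeL ∘L ContinuousLinearMap.snd ℝ _ _ ∘L
      ContinuousLinearMap.snd ℝ _ _
  have hexp : ∀ Z : skewSymmSubmodule n × W × skewSymmSubmodule n →L[ℝ] Matrix (Fin n) (Fin n) ℝ,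
      HasStrictFDerivAt (fun p => NormedSpace.exp (Z p)) Z 0 := by
    intro Z
    have h : HasStrictFDerivAt (NormedSpace.exp : Matrix (Fin n) (Fin n) ℝ → _)
        (1 : Matrix (Fin n) (Fin n) ℝ →L[ℝ] _) (Z 0) := by
      rw [map_zero]
      exact hasStrictFDerivAt_exp_zero
    exact h.comp 0 Z.hasStrictFDerivAt
  have h := (((hexp (-X)).mul' (M.hasStrictFDerivAt.const_add A)).mul' (hexp X)).add
    (Y.hasStrictFDerivAt (x := 0))
  refine ⟨_, h, fun p => ?_⟩
  simp only [Pi.mul_apply, map_zero, NormedSpace.exp_zero]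
  change 1 * (A + 0) * (p.1 : Matrix (Fin n) (Fin n) ℝ) +
    (1 * (p.2.1 : Matrix (Fin n) (Fin n) ℝ) +
      -(p.1 : Matrix (Fin n) (Fin n) ℝ) * (A + 0)) * 1 + p.2.2 = _
  noncomm_ring

lemma surjective_commutator_add {n : ℕ} {A : Matrix (Fin n) (Fin n) ℝ}
    {W : Submodule ℝ (Matrix (Fin n) (Fin n) ℝ)}
    (htrans : ∀ S : Matrix (Fin n) (Fin n) ℝ, S.IsSymm →
      ∃ X : Matrix (Fin n) (Fin n) ℝ, Xᵀ = -X ∧ ∃ M ∈ W, S = (A * X - X * A) + M) :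
    Function.Surjective fun p : skewSymmSubmodule n × W × skewSymmSubmodule n =>
      (A * (p.1 : Matrix (Fin n) (Fin n) ℝ) - p.1 * A) + p.2.1 + p.2.2 := by
  intro B
  obtain ⟨X, hX, M, hM, h⟩ := htrans ((2⁻¹ : ℝ) • (B + Bᵀ)) (by
    simp [IsSymm, add_comm])
  refine ⟨⟨⟨X, hX⟩, ⟨M, hM⟩, ⟨(2⁻¹ : ℝ) • (B - Bᵀ), ?_⟩⟩, ?_⟩
  · rw [mem_skewSymmSubmodule, transpose_smul, transpose_sub, transpose_transpose, ← smul_neg,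
      neg_sub]
  · simp only [← h]
    ext i j
    simp
    ring

lemma transpose_exp_of_mem_skewSymmSubmodule {n : ℕ} {X : Matrix (Fin n) (Fin n) ℝ}
    (hX : X ∈ skewSymmSubmodule n) : (NormedSpace.exp X)ᵀ = NormedSpace.exp (-X) := by
  rw [← Matrix.exp_transpose, mem_skewSymmSubmodule.1 hX]

lemma Matrix.exp_neg_mul_exp {n : ℕ} (X : Matrix (Fin n) (Fin n) ℝ) :
    NormedSpace.exp (-X) * NormedSpace.exp X = 1 := by
  rw [← Matrix.exp_add_of_commute _ _ (Commute.refl X).neg_left, neg_add_cancel,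
    NormedSpace.exp_zero]

/-- A matrix that is both symmetric and skew-symmetric vanishes, so a symmetric value of
`conjExpAdd` has no skew-symmetric error. -/
lemma conj_exp_eq_of_conjExpAdd_eq {n : ℕ} {A : Matrix (Fin n) (Fin n) ℝ} (hA : A.IsSymm)
    {W : Submodule ℝ (Matrix (Fin n) (Fin n) ℝ)} (hW : ∀ M ∈ W, M.IsSymm)
    {p : skewSymmSubmodule n × W × skewSymmSubmodule n} {B : Matrix (Fin n) (Fin n) ℝ}
    (hB : B.IsSymm) (h : conjExpAdd A W p = B) :
    NormedSpace.exp (-(p.1 : Matrix (Fin n) (Fin n) ℝ)) * (A + p.2.1) *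
      NormedSpace.exp (p.1 : Matrix (Fin n) (Fin n) ℝ) = B := by
  obtain ⟨⟨X, hX⟩, ⟨M, hM⟩, ⟨Y, hY⟩⟩ := p
  simp only [conjExpAdd] at h ⊢
  have hT := congrArg transpose h
  rw [transpose_add, transpose_mul, transpose_mul, transpose_add, hA.eq, (hW M hM).eq, hB.eq,
    mem_skewSymmSubmodule.1 hY, ← transpose_exp_of_mem_skewSymmSubmodule hX,
    transpose_transpose, transpose_exp_of_mem_skewSymmSubmodule hX, ← mul_assoc] at hT
  rw [← h, left_eq_add]
  have h2 := hT.trans h.symm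
  rw [add_right_inj] at h2
  have h3 : (2 : ℝ) • Y = 0 := by
    rw [two_smul]
    exact eq_neg_iff_add_eq_zero.1 h2.symm
  exact (smul_eq_zero.1 h3).resolve_left two_ne_zero

/-- The matrix with eigenvalue `k` on the `k`-th vector of an orthonormal family. -/
noncomputable def indexSpectrum {n : ℕ} (φ : Fin n → Fin n → ℝ) : Matrix (Fin n) (Fin n) ℝ :=
  ∑ k : Fin n, (k : ℝ) • vecMulVec (φ k) (φ k)

lemma isSymm_indexSpectrum {n : ℕ} (φ : Fin n → Fin n → ℝ) : (indexSpectrum φ).IsSymm := by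
  simp [IsSymm, indexSpectrum, transpose_sum, transpose_vecMulVec]

lemma indexSpectrum_mulVec {n : ℕ} {φ : Fin n → Fin n → ℝ}
    (horth : ∀ k l, φ k ⬝ᵥ φ l = if k = l then 1 else 0) (l : Fin n) :
    indexSpectrum φ *ᵥ φ l = (l : ℝ) • φ l := by
  simp [indexSpectrum, sum_mulVec, smul_mulVec, vecMulVec_mulVec, horth]

lemma eventually_injective_add_mul {n : ℕ} (μ : Fin n → ℝ) :
    ∀ᶠ t in 𝓝[≠] (0 : ℝ), Function.Injective fun k : Fin n => μ k + t * k := by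
  have h : ∀ k l : Fin n, k ≠ l → ∀ᶠ t in 𝓝[≠] (0 : ℝ), μ k + t * k ≠ μ l + t * l := by
    intro k l hkl
    have hkl' : (k : ℝ) - l ≠ 0 := sub_ne_zero.2 fun h => hkl (Fin.ext (by exact_mod_cast h))
    by_cases hμ : μ k = μ l
    · filter_upwards [self_mem_nhdsWithin] with t ht h
      refine mul_ne_zero ht hkl' ?_
      linarith
    · refine nhdsWithin_le_nhds (ContinuousAt.eventually_ne (x := (0 : ℝ))
        (g := fun t : ℝ => (μ k + t * k) - (μ l + t * l)) (y := 0) (by fun_prop) ?_ |>.mono ?_)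
      · simpa [sub_eq_zero] using hμ
      · exact fun t ht h => ht (sub_eq_zero.2 h)
  filter_upwards [eventually_all.2 fun k => eventually_all.2 fun l =>
    eventually_imp_distrib_left.2 (h k l)] with t ht k l hkl
  by_contra hne
  exact ht k l hne hkl

/-- transversality lemma.  If `A` is real symmetric, `W ⊆ S(n)` is a subspace
of symmetric matrices containing `A`, and the transversality condition
`{AX - XA : X antisymmetric} + W = S(n)` holds, then any orthonormal nowhere-vanishing
eigenbasis of `A` can be approximated: for every `ε > 0` there is `A' ∈ W`, entrywise
`ε`-close to `A`, with simple eigenvalues and an orthonormal nowhere-vanishing eigenbasis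
`ψ` matching the signs of `φ`, with the signs of the nonzero entries of `A` preserved. -/
theorem transversality_sign_preserving_perturbation {n : ℕ}
    (A : Matrix (Fin n) (Fin n) ℝ) (hA : A.IsSymm)
    (W : Submodule ℝ (Matrix (Fin n) (Fin n) ℝ)) (hW : ∀ M ∈ W, M.IsSymm) (hAW : A ∈ W)
    (htrans : ∀ S : Matrix (Fin n) (Fin n) ℝ, S.IsSymm →
      ∃ X : Matrix (Fin n) (Fin n) ℝ, Xᵀ = -X ∧ ∃ M ∈ W, S = (A * X - X * A) + M)
    (φ : Fin n → Fin n → ℝ) (μ : Fin n → ℝ)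
    (heig : ∀ k, A.mulVec (φ k) = μ k • φ k)
    (horth : ∀ k l, φ k ⬝ᵥ φ l = if k = l then 1 else 0)
    (hnv : ∀ k i, φ k i ≠ 0)
    (ε : ℝ) (hε : 0 < ε) :
    ∃ A' ∈ W, (∀ i j, |A' i j - A i j| < ε) ∧
      (∃ (μ' : Fin n → ℝ) (ψ : Fin n → Fin n → ℝ),
        Function.Injective μ' ∧
        (∀ k, A'.mulVec (ψ k) = μ' k • ψ k) ∧
        (∀ k l, ψ k ⬝ᵥ ψ l = if k = l then 1 else 0) ∧
        (∀ k i, ψ k i ≠ 0) ∧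
        (∀ k i, 0 < φ k i * ψ k i)) ∧
      (∀ i j, A i j ≠ 0 → 0 < A i j * A' i j) := by
  obtain ⟨L, hL, hLapp⟩ := hasStrictFDerivAt_conjExpAdd A W
  have hsurj : Function.Surjective L := by
    rw [show (L : _ → _) = _ from funext hLapp]
    exact surjective_commutator_add htrans
  have hnhds := hL.map_nhds_eq_of_surj (LinearMap.range_eq_top.2 hsurj)
  have hzero : conjExpAdd A W 0 = A := by simp [conjExpAdd, NormedSpace.exp_zero]
  rw [hzero] at hnhds
  have hclose : ∀ᶠ p : skewSymmSubmodule n × W × skewSymmSubmodule n in 𝓝 0,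
      ∀ i j, |(p.2.1 : Matrix (Fin n) (Fin n) ℝ) i j| < ε := by
    refine eventually_all.2 fun i => eventually_all.2 fun j => ?_
    refine ContinuousAt.eventually_lt (Continuous.continuousAt ?_) continuousAt_const ?_
    · exact (Continuous.matrix_elem (by fun_prop) i j).abs
    · simpa using hε
  have hsign : ∀ᶠ p : skewSymmSubmodule n × W × skewSymmSubmodule n in 𝓝 0,
      ∀ i j, A i j ≠ 0 → 0 < A i j * (A + p.2.1) i j := by
    refine eventually_all.2 fun i => eventually_all.2 fun j => ?_
    refine eventually_imp_distrib_left.2 fun hij => ?_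
    refine ContinuousAt.eventually_lt continuousAt_const (Continuous.continuousAt ?_) ?_
    · exact continuous_const.mul (Continuous.matrix_elem (by fun_prop) i j)
    · simpa using hij
  have hvec : ∀ᶠ p : skewSymmSubmodule n × W × skewSymmSubmodule n in 𝓝 0,
      ∀ k i, 0 < φ k i *
        (NormedSpace.exp (p.1 : Matrix (Fin n) (Fin n) ℝ) *ᵥ φ k) i := by
    refine eventually_all.2 fun k => eventually_all.2 fun i => ?_
    refine ContinuousAt.eventually_lt continuousAt_const (Continuous.continuousAt ?_) ?_
    · have hexp : Continuous fun p : skewSymmSubmodule n × W × skewSymmSubmodule n =>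
          NormedSpace.exp (p.1 : Matrix (Fin n) (Fin n) ℝ) :=
        NormedSpace.exp_continuous.comp (by fun_prop)
      exact continuous_const.mul
        ((continuous_apply i).comp (hexp.matrix_mulVec continuous_const))
    · simpa [NormedSpace.exp_zero] using hnv k i
  have himage := hnhds ▸ image_mem_map (m := conjExpAdd A W) (hclose.and (hsign.and hvec))
  have htend : Tendsto (fun t : ℝ => A + t • indexSpectrum φ) (𝓝[≠] 0) (𝓝 A) := by
    have : Continuous fun t : ℝ => A + t • indexSpectrum φ := by fun_prop
    exact (this.tendsto' 0 A (by simp)).mono_left nhdsWithin_le_nhds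
  obtain ⟨t, ⟨p, ⟨hp1, hp2, hp3⟩, hp⟩, hinj⟩ :=
    ((htend.eventually himage).and (eventually_injective_add_mul μ)).exists
  have hconj := conj_exp_eq_of_conjExpAdd_eq hA hW
    (hA.add ((isSymm_indexSpectrum φ).smul t)) hp
  have hQT := transpose_exp_of_mem_skewSymmSubmodule p.1.2
  have hQ := Matrix.exp_neg_mul_exp (p.1 : Matrix (Fin n) (Fin n) ℝ)
  set Q := NormedSpace.exp (p.1 : Matrix (Fin n) (Fin n) ℝ)
  set R := NormedSpace.exp (-(p.1 : Matrix (Fin n) (Fin n) ℝ))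
  have hQ' : Q * R = 1 := mul_eq_one_comm.1 hQ
  refine ⟨A + p.2.1, W.add_mem hAW p.2.1.2, fun i j => by simpa using hp1 i j,
    ⟨fun k => μ k + t * k, fun k => Q *ᵥ φ k, hinj, fun k => ?_, fun k l => ?_,
      fun k i h => ?_, hp3⟩, hp2⟩
  · have hcomm : (A + p.2.1) * Q = Q * (A + t • indexSpectrum φ) := by
      rw [← hconj, mul_assoc R, ← mul_assoc Q, hQ', one_mul]
    rw [mulVec_mulVec, hcomm, ← mulVec_mulVec, add_mulVec, heig, smul_mulVec,
      indexSpectrum_mulVec horth, smul_smul, ← add_smul, mulVec_smul]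
  · rw [dotProduct_mulVec, ← mulVec_transpose, mulVec_mulVec, hQT, hQ, one_mulVec, horth]
  · simpa [h] using hp3 k i
end

section
/- Let G be a simple connected graph and A ∈ S(G) a real symmetric matrix strictly supported on G. Let λ be an eigenvalue of A (possibly multiple) admitting a nowhere-vanishing eigenvector φ. Then the nodal count of φ satisfies ν(A,φ) ≥ N(A,λ) − 1, where N(A,λ) is the number of eigenvalues of A, counted with multiplicity, that are less than or equal to λ. Equivalently, if the eigenvalues satisfy λ_1 ≤ … ≤ λ_{k−1} < λ_k = … = λ_{k+m−1} < λ_{k+m} ≤ … ≤ λ_n with λ = λ_k, then ν(A,φ) ≥ k + (m−1) − 1. -/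
open Matrix

/-- The ground state representation: in terms of `u = f / φ`, where `φ` is an eigenvector,
the quadratic form of `A - lam` is a weighted sum of squared differences. -/
theorem sum_weight_mul_sq_sub {V : Type*} [Fintype V] {A : Matrix V V ℝ} (hA : A.IsSymm)
    {lam : ℝ} {φ : V → ℝ} (heig : A *ᵥ φ = lam • φ) (u : V → ℝ) :
    ∑ i, ∑ j, A i j * φ i * φ j * (u i - u j) ^ 2 =
      2 * (lam * ((φ * u) ⬝ᵥ (φ * u)) - (φ * u) ⬝ᵥ (A *ᵥ (φ * u))) := by
  have hrow : ∀ i, ∑ j, A i j * φ j = lam * φ i := fun i => by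
    simpa [mulVec, dotProduct] using congrFun heig i
  have hdiag : ∑ i, ∑ j, A i j * φ i * φ j * u i ^ 2 = lam * ((φ * u) ⬝ᵥ (φ * u)) := by
    simp only [dotProduct, Finset.mul_sum, Pi.mul_apply]
    refine Finset.sum_congr rfl fun i _ => ?_
    calc ∑ j, A i j * φ i * φ j * u i ^ 2 = (∑ j, A i j * φ j) * (φ i * u i ^ 2) := by
          rw [Finset.sum_mul]
          exact Finset.sum_congr rfl fun j _ => by ring
      _ = _ := by rw [hrow]; ring
  have hdiag' : ∑ i, ∑ j, A i j * φ i * φ j * u j ^ 2 = lam * ((φ * u) ⬝ᵥ (φ * u)) := by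
    rw [Finset.sum_comm, ← hdiag]
    refine Finset.sum_congr rfl fun i _ => Finset.sum_congr rfl fun j _ => ?_
    rw [hA.apply i j]
    ring
  have hcross : ∑ i, ∑ j, A i j * φ i * φ j * (u i * u j) = (φ * u) ⬝ᵥ (A *ᵥ (φ * u)) := by
    simp only [dotProduct, mulVec, Finset.mul_sum, Pi.mul_apply]
    exact Finset.sum_congr rfl fun i _ => Finset.sum_congr rfl fun j _ => by ring
  calc _ = ∑ i, ∑ j, (A i j * φ i * φ j * u i ^ 2 + A i j * φ i * φ j * u j ^ 2
        - 2 * (A i j * φ i * φ j * (u i * u j))) :=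
        Finset.sum_congr rfl fun i _ => Finset.sum_congr rfl fun j _ => by ring
    _ = _ := by
        simp only [Finset.sum_sub_distrib, Finset.sum_add_distrib, ← Finset.mul_sum]
        rw [hdiag, hdiag', hcross]
        ring

/-- On the span of eigenvectors with eigenvalues at most `lam`, the Rayleigh quotient is at
most `lam`. -/
theorem dotProduct_mulVec_le_of_eigenvalues_le {V : Type*} [Fintype V] [DecidableEq V]
    {A : Matrix V V ℝ} (hA : A.IsHermitian) {lam : ℝ} {s : Set V} [Fintype s]
    (hs : ∀ k ∈ s, hA.eigenvalues k ≤ lam) (c : s → ℝ) {f : V → ℝ}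
    (hf : f = ∑ k, c k • ⇑(hA.eigenvectorBasis k)) :
    f ⬝ᵥ (A *ᵥ f) ≤ lam * (f ⬝ᵥ f) := by
  have horth : ∀ k l : V, ⇑(hA.eigenvectorBasis k) ⬝ᵥ ⇑(hA.eigenvectorBasis l) =
      if k = l then 1 else 0 := fun k l => by
    have h := orthonormal_iff_ite.mp hA.eigenvectorBasis.orthonormal l k
    simpa [EuclideanSpace.inner_eq_star_dotProduct, eq_comm] using h
  have hff : f ⬝ᵥ f = ∑ k, c k ^ 2 := by
    simp [hf, sum_dotProduct, dotProduct_sum, horth, Subtype.coe_inj, pow_two]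
  have hAf : f ⬝ᵥ (A *ᵥ f) = ∑ k : s, hA.eigenvalues k * c k ^ 2 := by
    simp only [hf, mulVec_sum, mulVec_smul, hA.mulVec_eigenvectorBasis]
    simp only [sum_dotProduct, dotProduct_sum, smul_dotProduct, dotProduct_smul, horth,
      Subtype.coe_inj, smul_eq_mul, mul_ite, mul_one, mul_zero, Finset.sum_ite_eq',
      Finset.mem_univ, if_true]
    exact Finset.sum_congr rfl fun k _ => by ring
  rw [hff, hAf, Finset.mul_sum]
  exact Finset.sum_le_sum fun k _ => mul_le_mul_of_nonneg_right (hs k k.2) (sq_nonneg _)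

/-- If the quadratic form of `A - lam` is nonpositive at `φ * u` and `u` does not vary along the
edges of positive weight `A i j * φ i * φ j`, then `u` is constant. -/
theorem eq_of_forall_pos_weight_eq {V : Type*} [Fintype V] {G : SimpleGraph V}
    (hG : G.Preconnected) {A : Matrix V V ℝ} (hA : A.IsSymm)
    (hstrict : ∀ i j, G.Adj i j → A i j ≠ 0) {lam : ℝ} {φ : V → ℝ}
    (heig : A *ᵥ φ = lam • φ) (hnv : ∀ i, φ i ≠ 0) {u : V → ℝ}
    (hle : (φ * u) ⬝ᵥ (A *ᵥ (φ * u)) ≤ lam * ((φ * u) ⬝ᵥ (φ * u)))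
    (hpos : ∀ i j, 0 < A i j * φ i * φ j → u i = u j) (i j : V) : u i = u j := by
  have hterm : ∀ i j, A i j * φ i * φ j * (u i - u j) ^ 2 ≤ 0 := fun i j => by
    rcases lt_or_ge 0 (A i j * φ i * φ j) with h | h
    · simp [hpos i j h]
    · exact mul_nonpos_of_nonpos_of_nonneg h (sq_nonneg _)
  have hsum : ∑ i, ∑ j, A i j * φ i * φ j * (u i - u j) ^ 2 = 0 := by
    refine le_antisymm (Finset.sum_nonpos fun i _ => Finset.sum_nonpos fun j _ => hterm i j) ?_
    rw [sum_weight_mul_sq_sub hA heig]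
    linarith
  have hzero : ∀ i j, A i j * φ i * φ j * (u i - u j) ^ 2 = 0 := fun i j =>
    (Finset.sum_eq_zero_iff_of_nonpos fun j _ => hterm i j).mp
      ((Finset.sum_eq_zero_iff_of_nonpos fun i _ =>
        Finset.sum_nonpos fun j _ => hterm i j).mp hsum i (Finset.mem_univ i))
      j (Finset.mem_univ j)
  have hadj : ∀ i j, G.Adj i j → u i = u j := fun i j h => by
    simpa [hstrict i j h, hnv, sub_eq_zero] using hzero i j
  obtain ⟨p⟩ := hG i j
  induction p with
  | nil => rfl
  | cons h _ ih => exact (hadj _ _ h).trans ih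

/-- if `A` is real symmetric and strictly supported on a connected graph `G`,
and `lam` is an eigenvalue (possibly multiple) with a nowhere-vanishing eigenvector `φ`, then
`ν(A,φ) ≥ N(A,lam) - 1`, where `N(A,lam)` is the number of eigenvalues of `A` (with
multiplicity) that are `≤ lam`. -/
theorem nodal_count_lower_bound_multiplicity {n : ℕ}
    (G : SimpleGraph (Fin n)) (hG : G.Connected)
    (A : Matrix (Fin n) (Fin n) ℝ) (hA : A.IsHermitian)
    (hsupp : SupportedOn G A) (hstrict : ∀ i j, G.Adj i j → A i j ≠ 0)
    (lam : ℝ) (φ : Fin n → ℝ)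
    (heig : A.mulVec φ = lam • φ) (hnv : ∀ i, φ i ≠ 0) :
    (Finset.univ.filter fun k => hA.eigenvalues k ≤ lam).card ≤ nodalCount A φ + 1 := by
  obtain ⟨v⟩ := hG.nonempty
  have hsymm : A.IsSymm := by simpa [Matrix.IsHermitian, Matrix.IsSymm] using hA
  let s : Set (Fin n) := {k | hA.eigenvalues k ≤ lam}
  let P := {p : Fin n × Fin n // p.1 < p.2 ∧ 0 < A p.1 p.2 * φ p.1 * φ p.2}
  let b : s → Fin n → ℝ := fun k => ⇑(hA.eigenvectorBasis k)
  have hb : LinearIndependent ℝ b :=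
    (hA.eigenvectorBasis.orthonormal.linearIndependent.comp _ Subtype.val_injective).map'
      (WithLp.linearEquiv 2 ℝ (Fin n → ℝ)).toLinearMap (LinearEquiv.ker _)
  let quot : (Fin n → ℝ) →ₗ[ℝ] Fin n → ℝ := LinearMap.mulLeft ℝ φ⁻¹
  let coord (i : Fin n) : (Fin n → ℝ) →ₗ[ℝ] ℝ := LinearMap.proj i
  let diffs : (Fin n → ℝ) →ₗ[ℝ] (P → ℝ) × ℝ :=
    (LinearMap.pi fun p : P => coord p.1.1 - coord p.1.2).prod (coord v)
  let T : (s → ℝ) →ₗ[ℝ] (P → ℝ) × ℝ := diffs ∘ₗ quot ∘ₗ Fintype.linearCombination ℝ b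
  have hT : Function.Injective T := by
    rw [injective_iff_map_eq_zero]
    intro c hc
    let f := Fintype.linearCombination ℝ b c
    let u : Fin n → ℝ := φ⁻¹ * f
    have hf : f = ∑ k, c k • ⇑(hA.eigenvectorBasis k) := Fintype.linearCombination_apply ..
    have hu : φ * u = f := by
      ext i
      simp [u, hnv i]
    have hv : u v = 0 := congrArg Prod.snd hc
    have hdiff : ∀ p : P, u p.1.1 = u p.1.2 := fun p =>
      sub_eq_zero.mp (congrFun (congrArg Prod.fst hc) p)
    have hpos : ∀ i j, 0 < A i j * φ i * φ j → u i = u j := fun i j h => by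
      rcases lt_trichotomy i j with hij | rfl | hij
      · exact hdiff ⟨(i, j), hij, h⟩
      · rfl
      · refine (hdiff ⟨(j, i), hij, ?_⟩).symm
        rwa [← hsymm.apply j i, mul_right_comm]
    have hle := dotProduct_mulVec_le_of_eigenvalues_le hA (s := s) (fun _ hk => hk) c hf
    rw [← hu] at hle
    have hf0 : f = 0 := by
      rw [← hu]
      ext i
      simp [eq_of_forall_pos_weight_eq hG.preconnected hsymm hstrict heig hnv hle hpos i v, hv]
    exact funext (Fintype.linearIndependent_iff.mp hb c (by
      simpa only [f, Fintype.linearCombination_apply] using hf0))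
  have hrank := LinearMap.finrank_le_finrank_of_injective hT
  have hs : Fintype.card s = (Finset.univ.filter fun k => hA.eigenvalues k ≤ lam).card :=
    Fintype.card_subtype _
  have hP : Fintype.card P = nodalCount A φ := Fintype.card_eq_nat_card
  simpa [Module.finrank_prod, hs, hP] using hrank
end

section
/- Let G be a simple connected graph on n vertices and A ∈ S(G) be strictly supported on G with r distinct eigenvalues of multiplicities m_1, …, m_r (Σ m_i = n). Then for every orthonormal eigenbasis φ_1, …, φ_n of A, ordered so that the corresponding eigenvalues are nondecreasing, in which every φ_k is nowhere-vanishing, the total nodal count satisfies Σ_{k=1}^{n} ν(A,φ_k) ≥ C(n,2) + Σ_{i=1}^{r} C(m_i,2). -/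
open Matrix

/-- A symmetric matrix with eigenvector `f` acts, after rescaling by `f`, as a signed weighted
Laplacian. -/
theorem sum_mul_sub_sq_of_mulVec_eq_smul {V : Type*} [Fintype V] {A : Matrix V V ℝ}
    (hA : A.IsSymm) {f : V → ℝ} {c : ℝ} (hf : A.mulVec f = c • f) (x : V → ℝ) :
    ∑ i, ∑ j, A i j * f i * f j * (x i - x j) ^ 2 =
      2 * (c * ((f * x) ⬝ᵥ (f * x)) - (f * x) ⬝ᵥ A.mulVec (f * x)) := by
  have hrow (i : V) : ∑ j, A i j * f j = c * f i := by
    simpa [mulVec, dotProduct] using congrFun hf i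
  have h₁ : ∑ i, ∑ j, A i j * f i * f j * x i ^ 2 = c * ((f * x) ⬝ᵥ (f * x)) := by
    simp only [dotProduct, Finset.mul_sum, Pi.mul_apply]
    refine Finset.sum_congr rfl fun i _ => ?_
    calc ∑ j, A i j * f i * f j * x i ^ 2 = (∑ j, A i j * f j) * (f i * x i ^ 2) := by
          rw [Finset.sum_mul]
          exact Finset.sum_congr rfl fun j _ => by ring
      _ = c * (f i * x i * (f i * x i)) := by rw [hrow]; ring
  have h₂ : ∑ i, ∑ j, A i j * f i * f j * x j ^ 2 = c * ((f * x) ⬝ᵥ (f * x)) := by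
    rw [← h₁, Finset.sum_comm]
    refine Finset.sum_congr rfl fun i _ => Finset.sum_congr rfl fun j _ => ?_
    rw [hA.apply]
    ring
  have h₃ : ∑ i, ∑ j, A i j * f i * f j * (x i * x j) = (f * x) ⬝ᵥ A.mulVec (f * x) := by
    simp only [dotProduct, mulVec, Finset.mul_sum, Pi.mul_apply]
    exact Finset.sum_congr rfl fun i _ => Finset.sum_congr rfl fun j _ => by ring
  calc ∑ i, ∑ j, A i j * f i * f j * (x i - x j) ^ 2
      = ∑ i, ∑ j, A i j * f i * f j * x i ^ 2 + ∑ i, ∑ j, A i j * f i * f j * x j ^ 2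
        - 2 * ∑ i, ∑ j, A i j * f i * f j * (x i * x j) := by
        simp only [Finset.mul_sum, ← Finset.sum_add_distrib, ← Finset.sum_sub_distrib]
        exact Finset.sum_congr rfl fun i _ => Finset.sum_congr rfl fun j _ => by ring
    _ = _ := by rw [h₁, h₂, h₃]; ring

/-- If `f` is a nowhere-vanishing eigenvector for `c`, and the quadratic form of `A` at `f * x` is
at most `c` times the squared norm, where `x` is constant along the edges counted by the nodal
count of `f`, then `x` is constant. -/
theorem eq_of_quadraticForm_le {V : Type*} [Fintype V] {G : SimpleGraph V} (hG : G.Connected)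
    {A : Matrix V V ℝ} (hA : A.IsSymm) (hstrict : ∀ i j, G.Adj i j → A i j ≠ 0)
    {f : V → ℝ} {c : ℝ} (hf : A.mulVec f = c • f) (hnv : ∀ i, f i ≠ 0) {x : V → ℝ}
    (hle : (f * x) ⬝ᵥ A.mulVec (f * x) ≤ c * ((f * x) ⬝ᵥ (f * x)))
    (hx : ∀ i j, 0 < A i j * f i * f j → x i = x j) (i j : V) : x i = x j := by
  have hterm (i j : V) : A i j * f i * f j * (x i - x j) ^ 2 ≤ 0 := by
    rcases lt_or_ge 0 (A i j * f i * f j) with h | h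
    · simp [hx i j h]
    · exact mul_nonpos_of_nonpos_of_nonneg h (sq_nonneg _)
  have hsum : ∑ i, ∑ j, A i j * f i * f j * (x i - x j) ^ 2 = 0 := by
    refine le_antisymm (Finset.sum_nonpos fun i _ => Finset.sum_nonpos fun j _ => hterm i j) ?_
    rw [sum_mul_sub_sq_of_mulVec_eq_smul hA hf]
    linarith
  have hadj (i j : V) (h : G.Adj i j) : x i = x j := by
    have hi := (Finset.sum_eq_zero_iff_of_nonpos
      fun i _ => Finset.sum_nonpos fun j _ => hterm i j).1 hsum i (Finset.mem_univ _)
    have hij := (Finset.sum_eq_zero_iff_of_nonpos fun j _ => hterm i j).1 hi j (Finset.mem_univ _)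
    simpa [hstrict i j h, hnv, sub_eq_zero] using hij
  obtain ⟨w⟩ := hG.preconnected i j
  induction w with
  | nil => rfl
  | cons h _ ih => exact (hadj _ _ h).trans ih

/-- The dot product of two combinations of a family that is orthonormal for the dot product. -/
theorem sum_smul_dotProduct_sum_smul {ι V : Type*} [Fintype ι] [DecidableEq ι] [Fintype V]
    {ψ : ι → V → ℝ} (hψ : ∀ k l, ψ k ⬝ᵥ ψ l = if k = l then 1 else 0) (a b : ι → ℝ) :
    (∑ l, a l • ψ l) ⬝ᵥ (∑ l, b l • ψ l) = ∑ l, a l * b l := by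
  simp [sum_dotProduct, dotProduct_sum, hψ, mul_comm]

/-- The nodal count of a nowhere-vanishing eigenvector is at least the number of other
eigenvectors with an eigenvalue that is at most as large. -/
theorem card_eigenvalue_le_nodalCount_add_one {n : ℕ} {G : SimpleGraph (Fin n)}
    (hG : G.Connected) {A : Matrix (Fin n) (Fin n) ℝ} (hA : A.IsSymm)
    (hstrict : ∀ i j, G.Adj i j → A i j ≠ 0) {φ : Fin n → Fin n → ℝ} {μ : Fin n → ℝ}
    (heig : ∀ k, A.mulVec (φ k) = μ k • φ k)
    (horth : ∀ k l, φ k ⬝ᵥ φ l = if k = l then 1 else 0)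
    (k : Fin n) (hnv : ∀ i, φ k i ≠ 0) :
    (Finset.univ.filter fun l => μ l ≤ μ k).card ≤ nodalCount A (φ k) + 1 := by
  classical
  obtain ⟨i₀⟩ := hG.nonempty
  let L := {l // μ l ≤ μ k}
  let P := {p : Fin n × Fin n // p.1 < p.2 ∧ 0 < A p.1 p.2 * φ k p.1 * φ k p.2}
  let S : (L → ℝ) →ₗ[ℝ] (Fin n → ℝ) := Fintype.linearCombination ℝ fun l : L => φ l
  let Q (i : Fin n) : (L → ℝ) →ₗ[ℝ] ℝ := (φ k i)⁻¹ • (LinearMap.proj i ∘ₗ S)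
  let T : (L → ℝ) →ₗ[ℝ] (P → ℝ) × ℝ :=
    (LinearMap.pi fun p : P => Q p.1.1 - Q p.1.2).prod (Q i₀)
  have hS (a : L → ℝ) : S a = ∑ l, a l • φ l := rfl
  have hSA (a : L → ℝ) : A.mulVec (S a) = ∑ l, (a l * μ l) • φ l := by
    simp only [hS, mulVec_sum, mulVec_smul, heig, smul_smul]
  have hdot := sum_smul_dotProduct_sum_smul (ψ := fun l : L => φ l) fun l l' =>
    (horth l l').trans (if_congr Subtype.ext_iff.symm rfl rfl)
  have hT : Function.Injective T := by
    rw [← LinearMap.ker_eq_bot, LinearMap.ker_eq_bot']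
    intro a ha
    have hfx : φ k * (fun i => Q i a) = S a := by
      ext i
      simp [Q, hnv i]
    have hP (p : P) : Q p.1.1 a = Q p.1.2 a :=
      sub_eq_zero.1 (congrFun (congrArg Prod.fst ha) p)
    have hconst (i : Fin n) : Q i a = 0 := by
      refine (eq_of_quadraticForm_le hG hA hstrict (heig k) hnv (x := fun i => Q i a) ?_ ?_
        i i₀).trans (congrArg Prod.snd ha)
      · rw [hfx, hSA, hS, hdot, hdot, Finset.mul_sum]
        refine Finset.sum_le_sum fun l _ => ?_
        nlinarith [mul_nonneg (sub_nonneg.2 l.2) (mul_self_nonneg (a l))]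
      · intro i j h
        rcases lt_trichotomy i j with hij | rfl | hij
        · exact hP ⟨(i, j), hij, h⟩
        · rfl
        · refine (hP ⟨(j, i), hij, ?_⟩).symm
          rw [hA.apply]
          linarith
    have hS0 : S a = 0 := by
      rw [← hfx]
      ext i
      simp [hconst]
    have h0 : ∑ l, a l * a l = 0 := by
      rw [← hdot, ← hS, hS0, dotProduct_zero]
    ext l
    exact mul_self_eq_zero.1 <|
      (Finset.sum_eq_zero_iff_of_nonneg fun l _ => mul_self_nonneg (a l)).1 h0 l
        (Finset.mem_univ _)
  have h := LinearMap.finrank_le_finrank_of_injective hT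
  simp only [Module.finrank_prod, Module.finrank_fintype_fun_eq_card, Module.finrank_self] at h
  rw [nodalCount, Nat.card_eq_fintype_card, ← Fintype.card_subtype]
  exact h

/-- Counting ordered pairs by comparing their values: twice the number of pairs in weak order is
the number of all pairs plus the number of pairs of equal value. -/
theorem two_mul_sum_card_filter_le {ι α : Type*} [Fintype ι] [LinearOrder α] (μ : ι → α) :
    2 * ∑ k, (Finset.univ.filter fun l => μ l ≤ μ k).card =
      Fintype.card ι ^ 2 + ∑ k, (Finset.univ.filter fun l => μ l = μ k).card := by
  have hswap : ∑ k, (Finset.univ.filter fun l => μ l ≤ μ k).card =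
      ∑ k, (Finset.univ.filter fun l => μ k ≤ μ l).card := by
    simp only [Finset.card_filter]
    exact Finset.sum_comm
  have hone : Fintype.card ι ^ 2 = ∑ _k : ι, ∑ _l : ι, 1 := by simp [sq]
  rw [two_mul]
  nth_rewrite 2 [hswap]
  simp only [hone, Finset.card_filter, ← Finset.sum_add_distrib]
  refine Finset.sum_congr rfl fun k _ => Finset.sum_congr rfl fun l _ => ?_
  rcases lt_trichotomy (μ l) (μ k) with h | h | h
  · simp [h.le, h.not_ge, h.ne]
  · simp [h]
  · simp [h.le, h.not_ge, h.ne']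

/-- Twice a binomial coefficient `C(a, 2)` plus `a` is a square. -/
theorem two_mul_choose_two_add_self (a : ℕ) : 2 * a.choose 2 + a = a ^ 2 := by
  rw [Nat.choose_two_right, Nat.mul_div_cancel' (Nat.even_mul_pred_self a).two_dvd]
  cases a <;> simp; ring

/-- let `A` be symmetric and strictly supported on a connected graph `G`, with
orthonormal eigenbasis `φ` (ordered so the eigenvalues `μ` are nondecreasing) in which every
eigenvector is nowhere-vanishing.  If `A` has `r` distinct eigenvalues `e 1 < … < e r` with
multiplicities `m i`, then the total nodal count is at least `C(n,2) + ∑ᵢ C(mᵢ,2)`. -/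
theorem total_nodal_count_lower_bound_with_multiplicities {n r : ℕ}
    (G : SimpleGraph (Fin n)) (hG : G.Connected)
    (A : Matrix (Fin n) (Fin n) ℝ) (hA : A.IsSymm)
    (hsupp : SupportedOn G A) (hstrict : ∀ i j, G.Adj i j → A i j ≠ 0)
    (φ : Fin n → Fin n → ℝ) (μ : Fin n → ℝ) (hmono : Monotone μ)
    (heig : ∀ k, A.mulVec (φ k) = μ k • φ k)
    (horth : ∀ k l, φ k ⬝ᵥ φ l = if k = l then 1 else 0)
    (hnv : ∀ k i, φ k i ≠ 0)
    (e : Fin r → ℝ) (he : StrictMono e) (hcover : ∀ k, ∃ i, μ k = e i)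
    (m : Fin r → ℕ) (hm : ∀ i, m i = (Finset.univ.filter fun k => μ k = e i).card) :
    n.choose 2 + ∑ i, (m i).choose 2 ≤ ∑ k : Fin n, nodalCount A (φ k) := by
  have hfib (g : ℝ → ℕ) : ∑ k, g (μ k) = ∑ i, m i * g (e i) := by
    choose t ht using hcover
    rw [← Finset.sum_fiberwise Finset.univ t]
    refine Finset.sum_congr rfl fun i _ => ?_
    have hset : (Finset.univ.filter fun k => t k = i) =
        Finset.univ.filter fun k => μ k = e i := by
      ext k
      simp [ht k, he.injective.eq_iff]
    rw [hset, hm i, ← smul_eq_mul, ← Finset.sum_const]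
    exact Finset.sum_congr rfl fun k hk => by rw [(Finset.mem_filter.1 hk).2]
  have hcard : n = ∑ i, m i := by simpa using hfib fun _ => 1
  have hsq : ∑ k, (Finset.univ.filter fun l => μ l = μ k).card = ∑ i, m i ^ 2 := by
    rw [hfib fun c => (Finset.univ.filter fun l => μ l = c).card]
    exact Finset.sum_congr rfl fun i _ => by rw [← hm, sq]
  have hcount := two_mul_sum_card_filter_le μ
  have hnodal : ∑ k, (Finset.univ.filter fun l => μ l ≤ μ k).card ≤
      ∑ k, nodalCount A (φ k) + n := by
    refine (Finset.sum_le_sum fun k _ =>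
      card_eigenvalue_le_nodalCount_add_one hG hA hstrict heig horth k (hnv k)).trans ?_
    simp [Finset.sum_add_distrib]
  have hchoose : 2 * ∑ i, (m i).choose 2 + n = ∑ i, m i ^ 2 := by
    conv_lhs => rw [hcard, Finset.mul_sum, ← Finset.sum_add_distrib]
    exact Finset.sum_congr rfl fun i _ => two_mul_choose_two_add_self (m i)
  have hn := two_mul_choose_two_add_self n
  rw [hsq, Fintype.card_fin] at hcount
  lia
end
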